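/- arXiv:1203.2939 — 2 statements merged into one kernel-verified Lean document; each statement's English description precedes it below -/
import Mathlib

section
/- Let G and G' be Gauss diagrams related by a (2,1) triangle move: three chords a, b, c whose six endpoints contain three pairs of adjacent circle positions forming the vertices of a triangle — one vertex consisting of two heads, one of two feet, and one of a head and a foot — are switched between a configuration in which exactly one pair of the three chords intersects and a configuration in which exactly two pairs intersect, by sliding each adjacent pair of endpoints past each other while all other endpoints are fixed; the signs and orientations of a, b, c are in one of the admissible configurations (the configuration with sgn(a) = sgn(c) = −1 and sgn(b) = +1 exhibited in the paper, together with the configurations obtained from it by simultaneously reversing the sign and orientation of the two chords meeting at the head–head vertex, or of the two chords meeting at the foot–foot vertex, on both sides of the move). Then every chord of G, including a, b and c, has the same parity in G' as in G. -/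
/-! ## Gauss diagrams and parity -/

/-- `arc a b p` : position `p` lies strictly inside the arc traversed in the positive
direction from `a` to `b` on a circle whose positions are numbered `0, 1, 2, …`
in the positive direction. -/
def arc (a b p : ℕ) : Bool :=
  if a < b then decide (a < p ∧ p < b) else decide (p < b ∨ a < p)

/-- A Gauss diagram: `n` signed oriented chords whose `2n` endpoints are placed on the
`2n` points of an oriented circle.  Chord `i` has its head (arrowhead) at position
`head i`, its foot at position `foot i`, and sign `sign i`. -/
structure GaussDiagram where
  n : ℕ
  head : Fin n → Fin (2 * n)
  foot : Fin n → Fin (2 * n)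
  sign : Fin n → ℤ

namespace GaussDiagram

/-- A genuine Gauss diagram: all `2n` endpoints are distinct (hence they exhaust the
`2n` circle positions) and every sign is `±1`. -/
def Proper (G : GaussDiagram) : Prop :=
  Function.Injective (Sum.elim G.head G.foot) ∧ ∀ i, G.sign i = 1 ∨ G.sign i = -1

/-- `G.crosses c x` : chord `x` intersects chord `c` (their endpoint pairs interleave
in the cyclic order), i.e. `x ∈ N_c`. -/
def crosses (G : GaussDiagram) (c x : Fin G.n) : Bool :=
  x != c &&
    (arc (G.head c).1 (G.foot c).1 (G.head x).1 != arc (G.head c).1 (G.foot c).1 (G.foot x).1)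

/-- The intersection number `int_c(x)`: `+1` if the head of `x` lies on the arc traversed
in the positive direction from the head of `c` to the foot of `c`, and `-1` otherwise. -/
def inter (G : GaussDiagram) (c x : Fin G.n) : ℤ :=
  if arc (G.head c).1 (G.foot c).1 (G.head x).1 then 1 else -1

/-- The parity of a chord: `p(c) = ∑_{x ∈ N_c} sgn(x) · int_c(x)`. -/
def parity (G : GaussDiagram) (c : Fin G.n) : ℤ :=
  ∑ x : Fin G.n, if G.crosses c x then G.sign x * G.inter c x else 0

end GaussDiagram

/-- The cyclic successor of a circle position. -/
def psucc {m : ℕ} (v : Fin m) : Fin m := ⟨(v.1 + 1) % m, Nat.mod_lt _ v.pos⟩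

/-- Two circle positions are adjacent. -/
def adjPos {m : ℕ} (u v : Fin m) : Prop := v = psucc u ∨ u = psucc v

/-- A map of circle positions preserving the cyclic order (in particular injective). -/
def CyclicMap {k l : ℕ} (φ : Fin k → Fin l) : Prop :=
  ∀ a b p : Fin k, arc a.1 b.1 p.1 = arc (φ a).1 (φ b).1 (φ p).1

/-- A map of circle positions reversing the cyclic order. -/
def AntiCyclicMap {k l : ℕ} (φ : Fin k → Fin l) : Prop :=
  ∀ a b p : Fin k, arc a.1 b.1 p.1 = arc (φ b).1 (φ a).1 (φ p).1

/-! ## The chord moves -/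

/-- The single chord move: `G'` is obtained from `G` by inserting one chord `y` whose two
endpoints occupy adjacent positions on the circle; all old chords keep their mutual cyclic
position (via the cyclic-order preserving map `φ`), their orientation and their sign. -/
def SingleChordMove (G G' : GaussDiagram) : Prop :=
  G.Proper ∧ G'.Proper ∧ G'.n = G.n + 1 ∧
  ∃ (e : Fin G.n → Fin G'.n) (φ : Fin (2 * G.n) → Fin (2 * G'.n)) (y : Fin G'.n),
    Function.Injective e ∧ (∀ i, e i ≠ y) ∧ CyclicMap φ ∧
    (∀ i, G'.head (e i) = φ (G.head i) ∧ G'.foot (e i) = φ (G.foot i) ∧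
      G'.sign (e i) = G.sign i) ∧
    adjPos (G'.head y) (G'.foot y)

/-- The two chord move: `G'` is obtained from `G` by inserting a pair of oppositely signed
chords `y₁, y₂` whose heads occupy adjacent positions and whose feet occupy adjacent
positions on the circle. -/
def TwoChordMove (G G' : GaussDiagram) : Prop :=
  G.Proper ∧ G'.Proper ∧ G'.n = G.n + 2 ∧
  ∃ (e : Fin G.n → Fin G'.n) (φ : Fin (2 * G.n) → Fin (2 * G'.n)) (y₁ y₂ : Fin G'.n),
    Function.Injective e ∧ y₁ ≠ y₂ ∧ (∀ i, e i ≠ y₁ ∧ e i ≠ y₂) ∧ CyclicMap φ ∧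
    (∀ i, G'.head (e i) = φ (G.head i) ∧ G'.foot (e i) = φ (G.foot i) ∧
      G'.sign (e i) = G.sign i) ∧
    adjPos (G'.head y₁) (G'.head y₂) ∧ adjPos (G'.foot y₁) (G'.foot y₂) ∧
    G'.sign y₁ = -G'.sign y₂

/-- The triangle (vertex) structure of three chords `x y z` of `G`: their six endpoints
form three pairs of adjacent circle positions (the vertices of a triangle), namely
`{w₁, w₁+1}` (two heads), `{w₂, w₂+1}` (two feet) and `{w₃, w₃+1}` (a head and a foot).
Chord `x` runs from the head–head vertex to the foot–foot vertex. -/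
def TriangleVertices (G : GaussDiagram) (x y z : Fin G.n) (w₁ w₂ w₃ : Fin (2 * G.n)) : Prop :=
  x ≠ y ∧ y ≠ z ∧ x ≠ z ∧
  ((G.head x = w₁ ∧ G.head y = psucc w₁) ∨ (G.head x = psucc w₁ ∧ G.head y = w₁)) ∧
  ((G.foot x = w₂ ∧ G.foot z = psucc w₂) ∨ (G.foot x = psucc w₂ ∧ G.foot z = w₂)) ∧
  ((G.foot y = w₃ ∧ G.head z = psucc w₃) ∨ (G.foot y = psucc w₃ ∧ G.head z = w₃))

/-- The admissible sign configurations for a triangle move on the chords `x y z`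
(`x` being the chord joining the head–head vertex to the foot–foot vertex):
these are the configurations exhibited in the paper together with their modifications
obtained by simultaneously reversing the sign and orientation of the two chords meeting
at the head–head vertex or at the foot–foot vertex.
In the (3,0) case the two chords `y, z` carry one sign and `x` the opposite sign; in the
(2,1) case the signs are governed by the pair of chords crossing on the one-intersection
side of the move. -/
def AdmissibleSigns (G G' : GaussDiagram) (x y z : Fin G.n) (x' y' z' : Fin G'.n) : Prop :=
  -- (3,0) triangle move
  (((G.crosses x y = false ∧ G.crosses y z = false ∧ G.crosses x z = false) ∨
    (G'.crosses x' y' = false ∧ G'.crosses y' z' = false ∧ G'.crosses x' z' = false)) ∧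
    G.sign y = G.sign z ∧ G.sign x = -G.sign y) ∨
  -- (2,1) triangle move, the single intersection being between x and y
  (((G.crosses x y = true ∧ G.crosses y z = false ∧ G.crosses x z = false) ∨
    (G'.crosses x' y' = true ∧ G'.crosses y' z' = false ∧ G'.crosses x' z' = false)) ∧
    G.sign y = -G.sign x ∧ G.sign z = G.sign x) ∨
  -- (2,1) triangle move, the single intersection being between x and z
  (((G.crosses x z = true ∧ G.crosses x y = false ∧ G.crosses y z = false) ∨
    (G'.crosses x' z' = true ∧ G'.crosses x' y' = false ∧ G'.crosses y' z' = false)) ∧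
    G.sign z = -G.sign x ∧ G.sign y = G.sign x) ∨
  -- (2,1) triangle move, the single intersection being between y and z
  (((G.crosses y z = true ∧ G.crosses x y = false ∧ G.crosses x z = false) ∨
    (G'.crosses y' z' = true ∧ G'.crosses x' y' = false ∧ G'.crosses x' z' = false)) ∧
    G.sign y = G.sign x ∧ G.sign z = G.sign x)

/-- The triangle move: three chords `x y z` of `G` forming a triangle with three
adjacent-position vertices (one head–head, one foot–foot, one mixed), in an admissible
sign/orientation configuration, slide past each other: in `G'` each pair of adjacent
endpoints has been interchanged, while everything else is unchanged. -/
def TriangleMove (G G' : GaussDiagram) : Prop :=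
  G.Proper ∧ G'.Proper ∧
  ∃ (e : Fin G.n → Fin G'.n) (φ : Fin (2 * G.n) → Fin (2 * G'.n))
    (x y z : Fin G.n) (w₁ w₂ w₃ : Fin (2 * G.n)),
    Function.Bijective e ∧ Function.Bijective φ ∧ CyclicMap φ ∧
    TriangleVertices G x y z w₁ w₂ w₃ ∧
    (∀ i, G'.sign (e i) = G.sign i) ∧
    (∀ i, i ≠ x → i ≠ y → i ≠ z →
      G'.head (e i) = φ (G.head i) ∧ G'.foot (e i) = φ (G.foot i)) ∧
    -- sliding: each of the six endpoints is exchanged with its partner in its vertex pair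
    ((G'.head (e x) = φ (G.head y) ∧ G'.head (e y) = φ (G.head x)) ∧
     (G'.foot (e x) = φ (G.foot z) ∧ G'.foot (e z) = φ (G.foot x)) ∧
     (G'.foot (e y) = φ (G.head z) ∧ G'.head (e z) = φ (G.foot y))) ∧
    AdmissibleSigns G G' x y z (e x) (e y) (e z)

/-- One chord move (in either direction) between Gauss diagrams. -/
def GaussMove (G G' : GaussDiagram) : Prop :=
  SingleChordMove G G' ∨ SingleChordMove G' G ∨
  TwoChordMove G G' ∨ TwoChordMove G' G ∨
  TriangleMove G G' ∨ TriangleMove G' G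

/-! ## Invariants from parity -/

namespace GaussDiagram

/-- `|A_i(G)|`: the signed cardinality of the set of chords of parity `i`. -/
def cardA (G : GaussDiagram) (i : ℤ) : ℤ :=
  ∑ c : Fin G.n, if G.parity c = i then G.sign c else 0

/-- `|A_Z(G)|`: the signed cardinality of the set of tuples of chords with parities
prescribed by `Z`. -/
def cardATuple (G : GaussDiagram) {k : ℕ} (Z : Fin k → ℤ) : ℤ :=
  ∑ t : Fin k → Fin G.n,
    if ∀ j, G.parity (t j) = Z j then ∏ j, G.sign (t j) else 0

/-- `|V_i(G)|`: the signed cardinality of the set of chords whose parity has absolute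
value `i`. -/
def cardV (G : GaussDiagram) (i : ℤ) : ℤ :=
  ∑ c : Fin G.n, if |G.parity c| = i then G.sign c else 0

/-- `|V_Z(G)|`: the signed cardinality of the set of tuples of chords whose parities have
absolute values prescribed by `Z`. -/
def cardVTuple (G : GaussDiagram) {k : ℕ} (Z : Fin k → ℤ) : ℤ :=
  ∑ t : Fin k → Fin G.n,
    if ∀ j, |G.parity (t j)| = Z j then ∏ j, G.sign (t j) else 0

/-- Flip (reverse the orientation of and negate the sign of) every chord in `S`;
this corresponds to crossing changes in the corresponding virtual knot diagram. -/
def flipSet (G : GaussDiagram) (S : Finset (Fin G.n)) : GaussDiagram where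
  n := G.n
  head := fun i => if i ∈ S then G.foot i else G.head i
  foot := fun i => if i ∈ S then G.head i else G.foot i
  sign := fun i => if i ∈ S then -G.sign i else G.sign i

end GaussDiagram

/-! ## Smoothing and flat diagrams -/

/-- The chord of the smaller diagram indexed by `i` corresponds to the chord `skipAt x i`
of the original diagram (skipping the smoothed chord `x`). -/
def skipAt {n : ℕ} (x : Fin n) (i : Fin (n - 1)) : Fin n :=
  if h : i.1 < x.1 then ⟨i.1, lt_trans h x.2⟩ else ⟨i.1 + 1, by have := i.2; omega⟩

/-- Relabelling of the circle positions after vertically smoothing the chord with head at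
position `h` and foot at position `f` (on a circle with `m` positions): the two positions
`h` and `f` are deleted and the arc strictly between `h` and `f` is reversed. -/
def smoothPos (m h f p : ℕ) : ℕ :=
  let d := (f + m - (h + 1)) % m
  let r := (p + m - (h + 1)) % m
  if r < d then d - 1 - r else r - 1

/-- Vertical smoothing of the chord `x` of a Gauss diagram: the chord `x` is deleted and
the cyclic order of the arc of endpoints lying strictly between the two endpoints of `x`
is reversed. -/
def GaussDiagram.smooth (G : GaussDiagram) (x : Fin G.n) : GaussDiagram where
  n := G.n - 1
  head := fun i =>
    ⟨smoothPos (2 * G.n) (G.head x).1 (G.foot x).1 (G.head (skipAt x i)).1 % (2 * (G.n - 1)),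
      Nat.mod_lt _ (by have := i.2; omega)⟩
  foot := fun i =>
    ⟨smoothPos (2 * G.n) (G.head x).1 (G.foot x).1 (G.foot (skipAt x i)).1 % (2 * (G.n - 1)),
      Nat.mod_lt _ (by have := i.2; omega)⟩
  sign := fun i => G.sign (skipAt x i)

/-- The index of chord `i ≠ x` in the diagram obtained by smoothing the chord `x`. -/
def unskip? {n : ℕ} (x i : Fin n) : Option (Fin (n - 1)) :=
  if h : i.1 < x.1 then some ⟨i.1, by have := x.2; omega⟩
  else if h' : x.1 < i.1 then some ⟨i.1 - 1, by have := i.2; omega⟩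
  else none

/-- Smoothing a list of chords, one after the other. -/
def GaussDiagram.smoothList : (G : GaussDiagram) → List (Fin G.n) → GaussDiagram
  | G, [] => G
  | G, x :: xs => (G.smooth x).smoothList (xs.filterMap (unskip? x))
termination_by G l => l.length
decreasing_by simpa using Nat.lt_succ_of_le (List.length_filterMap_le _ _)

/-- A flat Gauss diagram: a chord diagram on the circle with no signs and no head/foot
designations. -/
structure FlatDiagram where
  n : ℕ
  fst : Fin n → Fin (2 * n)
  snd : Fin n → Fin (2 * n)

namespace FlatDiagram

/-- A genuine flat diagram: the `2n` endpoints are distinct. -/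
def Proper (F : FlatDiagram) : Prop := Function.Injective (Sum.elim F.fst F.snd)

/-- The (unordered) endpoints of the chord `y` are `u` and `v`. -/
def hasEnds (F : FlatDiagram) (y : Fin F.n) (u v : Fin (2 * F.n)) : Prop :=
  (F.fst y = u ∧ F.snd y = v) ∨ (F.fst y = v ∧ F.snd y = u)

end FlatDiagram

/-- Forgetting all signs and head/foot designations of a Gauss diagram. -/
def GaussDiagram.flatten (G : GaussDiagram) : FlatDiagram := ⟨G.n, G.head, G.foot⟩

/-- Isomorphism of flat diagrams: a bijection of chords induced by a bijection of the
circle preserving (or reversing) the cyclic order. -/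
def FlatIso (F F' : FlatDiagram) : Prop :=
  ∃ (e : Fin F.n → Fin F'.n) (φ : Fin (2 * F.n) → Fin (2 * F'.n)),
    Function.Bijective e ∧ Function.Bijective φ ∧ (CyclicMap φ ∨ AntiCyclicMap φ) ∧
    ∀ i, F'.hasEnds (e i) (φ (F.fst i)) (φ (F.snd i))

/-- Flat single chord move: insertion of a chord with adjacent endpoints. -/
def FlatSingleMove (F F' : FlatDiagram) : Prop :=
  F.Proper ∧ F'.Proper ∧ F'.n = F.n + 1 ∧
  ∃ (e : Fin F.n → Fin F'.n) (φ : Fin (2 * F.n) → Fin (2 * F'.n)) (y : Fin F'.n),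
    Function.Injective e ∧ (∀ i, e i ≠ y) ∧ CyclicMap φ ∧
    (∀ i, F'.hasEnds (e i) (φ (F.fst i)) (φ (F.snd i))) ∧
    adjPos (F'.fst y) (F'.snd y)

/-- Flat two chord move: insertion of a parallel pair of chords with pairwise adjacent
endpoints. -/
def FlatTwoMove (F F' : FlatDiagram) : Prop :=
  F.Proper ∧ F'.Proper ∧ F'.n = F.n + 2 ∧
  ∃ (e : Fin F.n → Fin F'.n) (φ : Fin (2 * F.n) → Fin (2 * F'.n)) (y₁ y₂ : Fin F'.n)
    (p q : Fin (2 * F'.n)),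
    Function.Injective e ∧ y₁ ≠ y₂ ∧ (∀ i, e i ≠ y₁ ∧ e i ≠ y₂) ∧ CyclicMap φ ∧
    (∀ i, F'.hasEnds (e i) (φ (F.fst i)) (φ (F.snd i))) ∧
    F'.hasEnds y₁ p q ∧ F'.hasEnds y₂ (psucc p) (psucc q)

/-- Flat triangle move: three chords whose six endpoints form three adjacent-position
vertex pairs slide past each other (no sign or orientation conditions). -/
def FlatTriangleMove (F F' : FlatDiagram) : Prop :=
  F.Proper ∧ F'.Proper ∧
  ∃ (e : Fin F.n → Fin F'.n) (φ : Fin (2 * F.n) → Fin (2 * F'.n))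
    (x y z : Fin F.n) (w₁ w₂ w₃ α₁ β₁ α₂ β₂ α₃ β₃ : Fin (2 * F.n)),
    Function.Bijective e ∧ Function.Bijective φ ∧ CyclicMap φ ∧
    x ≠ y ∧ y ≠ z ∧ x ≠ z ∧
    ((α₁ = w₁ ∧ β₁ = psucc w₁) ∨ (α₁ = psucc w₁ ∧ β₁ = w₁)) ∧
    ((α₂ = w₂ ∧ β₂ = psucc w₂) ∨ (α₂ = psucc w₂ ∧ β₂ = w₂)) ∧
    ((α₃ = w₃ ∧ β₃ = psucc w₃) ∨ (α₃ = psucc w₃ ∧ β₃ = w₃)) ∧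
    F.hasEnds x α₁ α₂ ∧ F.hasEnds y β₁ α₃ ∧ F.hasEnds z β₂ β₃ ∧
    F'.hasEnds (e x) (φ β₁) (φ β₂) ∧ F'.hasEnds (e y) (φ α₁) (φ β₃) ∧
    F'.hasEnds (e z) (φ α₂) (φ α₃) ∧
    (∀ i, i ≠ x → i ≠ y → i ≠ z → F'.hasEnds (e i) (φ (F.fst i)) (φ (F.snd i)))

/-- Generating relation for flat equivalence of flat diagrams. -/
def FlatRel (F F' : FlatDiagram) : Prop :=
  FlatIso F F' ∨ FlatSingleMove F F' ∨ FlatSingleMove F' F ∨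
  FlatTwoMove F F' ∨ FlatTwoMove F' F ∨ FlatTriangleMove F F' ∨ FlatTriangleMove F' F

/-- Flat equivalence classes of flat Gauss diagrams. -/
def FlatClass : Type := Quot FlatRel

/-- The flat equivalence class of a flat diagram. -/
def Fclass (F : FlatDiagram) : FlatClass := Quot.mk _ F

/-! ## The invariants `S_i` and `S_Z` -/

/-- `S_i(G) = ∑_{x ∈ V_i(G)} sgn(x) · F(G^x)`, an element of the free ℤ-module on flat
equivalence classes of flat Gauss diagrams. -/
noncomputable def Sone (G : GaussDiagram) (i : ℤ) : FlatClass →₀ ℤ :=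
  ∑ x : Fin G.n,
    if |G.parity x| = i then
      Finsupp.single (Fclass (G.smooth x).flatten) (G.sign x)
    else 0

/-- `S_Z(G) = ∑_{x̄ ∈ V_Z(G)} sgn(x₁)⋯sgn(x_n) · F(G^{x̄})`, an element of the free
ℤ-module on flat equivalence classes of flat Gauss diagrams. -/
noncomputable def SZ (G : GaussDiagram) {k : ℕ} (Z : Fin k → ℤ) : FlatClass →₀ ℤ :=
  ∑ t : Fin k → Fin G.n,
    if ∀ j, |G.parity (t j)| = Z j then
      Finsupp.single (Fclass (G.smoothList (List.ofFn t)).flatten) (∏ j, G.sign (t j))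
    else 0

/-! ## Helper lemmas -/

theorem arc_eq_true_iff (a b p : ℕ) :
    arc a b p = true ↔ (a < b ∧ a < p ∧ p < b) ∨ (b ≤ a ∧ (p < b ∨ a < p)) := by
  unfold arc
  split_ifs with h
  · simp only [decide_eq_true_eq]; omega
  · simp only [decide_eq_true_eq]; omega

/-- `v` follows `u` (if `o`) or `u` follows `v` (if not `o`) on a circle with `m` positions. -/
def AdjB (m : ℕ) (o : Bool) (u v : ℕ) : Prop :=
  u < m ∧ v < m ∧ u ≠ v ∧
  ((o = true ∧ (v = u + 1 ∨ (u + 1 = m ∧ v = 0))) ∨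
    (o = false ∧ (u = v + 1 ∨ (v + 1 = m ∧ u = 0))))

theorem AdjB.symm {m : ℕ} {o : Bool} {u v : ℕ} (h : AdjB m o u v) : AdjB m (!o) v u := by
  obtain ⟨h1, h2, h3, h4⟩ := h
  refine ⟨h2, h1, h3.symm, ?_⟩
  cases o <;> simp_all

theorem AdjB.of_psucc {m : ℕ} {u v w : Fin m} (huv : u ≠ v)
    (h : (u = w ∧ v = psucc w) ∨ (u = psucc w ∧ v = w)) : ∃ o, AdjB m o u.1 v.1 := by
  have key : (psucc w).1 = w.1 + 1 ∨ (w.1 + 1 = m ∧ (psucc w).1 = 0) := by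
    have hw := w.2
    by_cases hm : w.1 + 1 = m
    · right; exact ⟨hm, by simp [psucc, hm]⟩
    · left; simp only [psucc]; exact Nat.mod_eq_of_lt (by omega)
  have hne : u.1 ≠ v.1 := fun h => huv (Fin.ext h)
  rcases h with ⟨rfl, rfl⟩ | ⟨rfl, rfl⟩
  · exact ⟨true, u.2, (psucc u).2, hne, Or.inl ⟨rfl, key⟩⟩
  · exact ⟨false, (psucc v).2, v.2, hne, Or.inr ⟨rfl, key⟩⟩

theorem arc_shift₃ {m : ℕ} {o : Bool} {u v a b : ℕ} (h : AdjB m o u v) (ha : a < m) (hb : b < m)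
    (h1 : a ≠ u) (h2 : a ≠ v) (h3 : b ≠ u) (h4 : b ≠ v) : arc a b u = arc a b v := by
  obtain ⟨hu, hv, huv, h⟩ := h
  rw [Bool.eq_iff_iff, arc_eq_true_iff, arc_eq_true_iff]
  rcases h with ⟨_, h⟩ | ⟨_, h⟩ <;> rcases h with h | h <;> omega

theorem arc_shift₁ {m : ℕ} {o : Bool} {u v b p : ℕ} (h : AdjB m o u v) (hb : b < m) (hp : p < m)
    (h1 : b ≠ u) (h2 : b ≠ v) (h3 : p ≠ u) (h4 : p ≠ v) : arc u b p = arc v b p := by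
  obtain ⟨hu, hv, huv, h⟩ := h
  rw [Bool.eq_iff_iff, arc_eq_true_iff, arc_eq_true_iff]
  rcases h with ⟨_, h⟩ | ⟨_, h⟩ <;> rcases h with h | h <;> omega

theorem arc_shift₂ {m : ℕ} {o : Bool} {u v a p : ℕ} (h : AdjB m o u v) (ha : a < m) (hp : p < m)
    (h1 : a ≠ u) (h2 : a ≠ v) (h3 : p ≠ u) (h4 : p ≠ v) : arc a u p = arc a v p := by
  obtain ⟨hu, hv, huv, h⟩ := h
  rw [Bool.eq_iff_iff, arc_eq_true_iff, arc_eq_true_iff]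
  rcases h with ⟨_, h⟩ | ⟨_, h⟩ <;> rcases h with h | h <;> omega

theorem arc_start {m : ℕ} {o : Bool} {u v p : ℕ} (h : AdjB m o u v) (hp : p < m)
    (h3 : p ≠ u) (h4 : p ≠ v) : arc u p v = o := by
  obtain ⟨hu, hv, huv, h⟩ := h
  rw [Bool.eq_iff_iff, arc_eq_true_iff]
  rcases h with ⟨rfl, h⟩ | ⟨rfl, h⟩ <;> rcases h with h | h <;> simp <;> omega

theorem arc_end {m : ℕ} {o : Bool} {u v p : ℕ} (h : AdjB m o u v) (hp : p < m)
    (h3 : p ≠ u) (h4 : p ≠ v) : arc p u v = !o := by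
  obtain ⟨hu, hv, huv, h⟩ := h
  rw [Bool.eq_iff_iff, arc_eq_true_iff]
  rcases h with ⟨rfl, h⟩ | ⟨rfl, h⟩ <;> rcases h with h | h <;> simp <;> omega

theorem arc_swap {a b c : ℕ} (h1 : a ≠ b) (h2 : b ≠ c) (h3 : a ≠ c) :
    arc a c b = !arc a b c := by
  rw [Bool.eq_iff_iff, Bool.not_eq_true', ← Bool.not_eq_true, arc_eq_true_iff, arc_eq_true_iff]
  omega

theorem arc_rot {a b c : ℕ} (h1 : a ≠ b) (h2 : b ≠ c) (h3 : a ≠ c) :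
    arc b c a = arc a b c := by
  rw [Bool.eq_iff_iff, arc_eq_true_iff, arc_eq_true_iff]
  omega

/-- The six endpoints of the triangle are pairwise distinct. -/
def Distinct6 (a₁ b₁ a₂ b₂ a₃ b₃ : ℕ) : Prop :=
  a₁ ≠ a₂ ∧ a₁ ≠ b₂ ∧ a₁ ≠ a₃ ∧ a₁ ≠ b₃ ∧ b₁ ≠ a₂ ∧ b₁ ≠ b₂ ∧ b₁ ≠ a₃ ∧ b₁ ≠ b₃ ∧
  a₂ ≠ a₃ ∧ a₂ ≠ b₃ ∧ b₂ ≠ a₃ ∧ b₂ ≠ b₃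

/-- All relevant arcs of the triangle configuration `x = (a₁, a₂)`, `y = (b₁, a₃)`,
`z = (b₃, b₂)` (head, foot) in terms of three local orders and the cyclic order. -/
theorem tri_arcs {m : ℕ} {o₁ o₂ o₃ : Bool} {a₁ b₁ a₂ b₂ a₃ b₃ : ℕ}
    (h₁ : AdjB m o₁ a₁ b₁) (h₂ : AdjB m o₂ a₂ b₂) (h₃ : AdjB m o₃ a₃ b₃)
    (hd : Distinct6 a₁ b₁ a₂ b₂ a₃ b₃) :
    (arc a₁ a₂ b₁ = o₁ ∧ arc a₁ a₂ b₂ = !o₂ ∧ arc a₁ a₂ a₃ = arc a₁ a₂ a₃ ∧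
      arc a₁ a₂ b₃ = arc a₁ a₂ a₃) ∧
    (arc b₁ a₃ a₁ = !o₁ ∧ arc b₁ a₃ b₃ = !o₃ ∧ arc b₁ a₃ a₂ = !arc a₁ a₂ a₃ ∧
      arc b₁ a₃ b₂ = !arc a₁ a₂ a₃) ∧
    (arc b₃ b₂ a₃ = !o₃ ∧ arc b₃ b₂ a₂ = o₂ ∧ arc b₃ b₂ a₁ = !arc a₁ a₂ a₃ ∧
      arc b₃ b₂ b₁ = !arc a₁ a₂ a₃) ∧
    arc b₁ b₂ b₃ = arc a₁ a₂ a₃ := by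
  obtain ⟨d1, d2, d3, d4, d5, d6, d7, d8, d9, d10, d11, d12⟩ := hd
  have la₁ := h₁.1
  have lb₁ := h₁.2.1
  have la₂ := h₂.1
  have lb₂ := h₂.2.1
  have la₃ := h₃.1
  have lb₃ := h₃.2.1
  have g1 : arc a₁ a₂ b₃ = arc a₁ a₂ a₃ := by
    apply Eq.symm; apply arc_shift₃ h₃ <;> assumption
  have g2 : arc a₁ a₃ a₂ = !arc a₁ a₂ a₃ := arc_swap d1 d9 d3
  have g3 : arc b₁ a₃ a₂ = !arc a₁ a₂ a₃ := by
    rw [← g2]; apply Eq.symm; apply arc_shift₁ h₁ <;> first | assumption | (symm; assumption)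
  have g4 : arc b₁ a₃ b₂ = !arc a₁ a₂ a₃ := by
    rw [← g3]; apply Eq.symm; apply arc_shift₃ h₂ <;> first | assumption | (symm; assumption)
  have g5 : arc b₁ b₂ a₃ = arc a₁ a₂ a₃ := by
    rw [arc_swap d7 d11.symm d6, g4, Bool.not_not]
  have g6 : arc b₁ b₂ b₃ = arc a₁ a₂ a₃ := by
    rw [← g5]; apply Eq.symm; apply arc_shift₃ h₃ <;> first | assumption | (symm; assumption)
  have g7 : arc b₃ b₂ b₁ = !arc a₁ a₂ a₃ := by
    rw [arc_rot d8 d12.symm d6, arc_swap d6 d12 d8, g6]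
  have g8 : arc b₃ b₂ a₁ = !arc a₁ a₂ a₃ := by
    rw [← g7]; apply arc_shift₃ h₁ <;> first | assumption | (symm; assumption)
  refine ⟨⟨?_, ?_, rfl, g1⟩, ⟨?_, ?_, g3, g4⟩, ⟨?_, ?_, g8, g7⟩, g6⟩
  · apply arc_start h₁ <;> first | assumption | (symm; assumption)
  · apply arc_end h₂ <;> first | assumption | (symm; assumption)
  · apply arc_start h₁.symm <;> first | assumption | (symm; assumption)
  · apply arc_end h₃ <;> first | assumption | (symm; assumption)
  · apply arc_start h₃.symm <;> first | assumption | (symm; assumption)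
  · rw [arc_end h₂.symm, Bool.not_not] <;> first | assumption | (symm; assumption)

/-- Integer value of a Boolean. -/
def bval (b : Bool) : ℤ := if b then 1 else 0

/-- Contribution (up to sign) of the chord `x` to the parity of the chord `c`. -/
def GaussDiagram.contrib (G : GaussDiagram) (c x : Fin G.n) : ℤ :=
  bval (arc (G.head c).1 (G.foot c).1 (G.head x).1) -
    bval (arc (G.head c).1 (G.foot c).1 (G.foot x).1)

theorem GaussDiagram.contrib_self (G : GaussDiagram) (c : Fin G.n) : G.contrib c c = 0 := by
  have h1 : arc (G.head c).1 (G.foot c).1 (G.head c).1 = false := by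
    rw [← Bool.not_eq_true, arc_eq_true_iff]; omega
  have h2 : arc (G.head c).1 (G.foot c).1 (G.foot c).1 = false := by
    rw [← Bool.not_eq_true, arc_eq_true_iff]
    unfold arc at h1
    have : ((G.head c).1 ≤ (G.foot c).1) ∨ (G.foot c).1 < (G.head c).1 := le_or_gt _ _
    omega
  simp [GaussDiagram.contrib, h1, h2]

theorem GaussDiagram.parity_eq (G : GaussDiagram) (c : Fin G.n) :
    G.parity c = ∑ i, G.sign i * G.contrib c i := by
  unfold GaussDiagram.parity
  refine Finset.sum_congr rfl fun i _ => ?_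
  by_cases h : i = c
  · subst h
    simp [GaussDiagram.crosses, GaussDiagram.contrib_self]
  · unfold GaussDiagram.crosses GaussDiagram.inter GaussDiagram.contrib
    have h' : (i != c) = true := by simpa using h
    rw [h']
    generalize arc (G.head c).1 (G.foot c).1 (G.head i).1 = p
    generalize arc (G.head c).1 (G.foot c).1 (G.foot i).1 = q
    cases p <;> cases q <;> simp [bval]

theorem sum_eq_of_three {n : ℕ} {f g : Fin n → ℤ} {x y z : Fin n}
    (hxy : x ≠ y) (hyz : y ≠ z) (hxz : x ≠ z)
    (h : ∀ i, i ≠ x → i ≠ y → i ≠ z → f i = g i)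
    (h3 : f x + f y + f z = g x + g y + g z) : ∑ i, f i = ∑ i, g i := by
  rw [← Finset.sum_sdiff (Finset.subset_univ {x, y, z}),
    ← Finset.sum_sdiff (Finset.subset_univ {x, y, z}) (f := g)]
  congr 1
  · refine Finset.sum_congr rfl fun i hi => ?_
    simp only [Finset.mem_sdiff, Finset.mem_univ, Finset.mem_insert, Finset.mem_singleton,
      true_and, not_or] at hi
    exact h i hi.1 hi.2.1 hi.2.2
  · have hx : x ∉ ({y, z} : Finset (Fin n)) := by simp [hxy, hxz]
    have hy : y ∉ ({z} : Finset (Fin n)) := by simp [hyz]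
    simp only [Finset.sum_insert hx, Finset.sum_insert hy, Finset.sum_singleton]
    linarith

/-- A (2,1) triangle move: three chords `x, y, z` of `G` whose six
endpoints form three pairs of adjacent circle positions (one head–head vertex `w₁`,
one foot–foot vertex `w₂`, one mixed vertex `w₃`, with `x` joining the head–head vertex to
the foot–foot vertex) slide past each other — each adjacent pair of endpoints being
interchanged while all other endpoints are fixed — switching between a configuration in
which exactly one pair of the three chords intersects and one in which exactly two pairs
intersect.  The signs are in an admissible configuration, governed by the pair of chords
that intersect on the one-intersection side of the move (this family is exactly the
paper's exhibited configuration together with its modifications by simultaneously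
reversing the sign and orientation of the two chords meeting at the head–head vertex, or
at the foot–foot vertex, on both sides).  Then every chord of `G`, including `x`, `y` and
`z`, has the same parity in `G'` as in `G`. -/
theorem triangle_move_21_preserves_parity
    (G G' : GaussDiagram) (hG : G.Proper) (hG' : G'.Proper)
    (e : Fin G.n → Fin G'.n) (φ : Fin (2 * G.n) → Fin (2 * G'.n))
    (x y z : Fin G.n) (w₁ w₂ w₃ : Fin (2 * G.n))
    (he : Function.Bijective e) (hφb : Function.Bijective φ) (hφ : CyclicMap φ)
    (hvert : TriangleVertices G x y z w₁ w₂ w₃)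
    (hsign : ∀ i, G'.sign (e i) = G.sign i)
    (hother : ∀ i, i ≠ x → i ≠ y → i ≠ z →
      G'.head (e i) = φ (G.head i) ∧ G'.foot (e i) = φ (G.foot i))
    (hslide : (G'.head (e x) = φ (G.head y) ∧ G'.head (e y) = φ (G.head x)) ∧
      (G'.foot (e x) = φ (G.foot z) ∧ G'.foot (e z) = φ (G.foot x)) ∧
      (G'.foot (e y) = φ (G.head z) ∧ G'.head (e z) = φ (G.foot y)))
    (hcount :
      ((if G.crosses x y then 1 else 0) + (if G.crosses y z then 1 else 0) +
          (if G.crosses x z then (1 : ℕ) else 0) = 1 ∧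
        (if G'.crosses (e x) (e y) then 1 else 0) + (if G'.crosses (e y) (e z) then 1 else 0) +
          (if G'.crosses (e x) (e z) then (1 : ℕ) else 0) = 2) ∨
      ((if G.crosses x y then 1 else 0) + (if G.crosses y z then 1 else 0) +
          (if G.crosses x z then (1 : ℕ) else 0) = 2 ∧
        (if G'.crosses (e x) (e y) then 1 else 0) + (if G'.crosses (e y) (e z) then 1 else 0) +
          (if G'.crosses (e x) (e z) then (1 : ℕ) else 0) = 1))
    (hadm :
      (((G.crosses x y = true ∧ G.crosses y z = false ∧ G.crosses x z = false) ∨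
        (G'.crosses (e x) (e y) = true ∧ G'.crosses (e y) (e z) = false ∧
          G'.crosses (e x) (e z) = false)) ∧
        G.sign y = -G.sign x ∧ G.sign z = G.sign x) ∨
      (((G.crosses x z = true ∧ G.crosses x y = false ∧ G.crosses y z = false) ∨
        (G'.crosses (e x) (e z) = true ∧ G'.crosses (e x) (e y) = false ∧
          G'.crosses (e y) (e z) = false)) ∧
        G.sign z = -G.sign x ∧ G.sign y = G.sign x) ∨
      (((G.crosses y z = true ∧ G.crosses x y = false ∧ G.crosses x z = false) ∨
        (G'.crosses (e y) (e z) = true ∧ G'.crosses (e x) (e y) = false ∧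
          G'.crosses (e x) (e z) = false)) ∧
        G.sign y = G.sign x ∧ G.sign z = G.sign x)) :
    ∀ c, G'.parity (e c) = G.parity c := by
  obtain ⟨hxy, hyz, hxz, hv₁, hv₂, hv₃⟩ := hvert
  obtain ⟨⟨hs1, hs2⟩, ⟨hs3, hs4⟩, hs5, hs6⟩ := hslide
  have hinj := hG.1
  -- distinctness of endpoints
  have hh : ∀ i j, i ≠ j → G.head i ≠ G.head j := fun i j hij h =>
    hij (Sum.inl_injective (hinj (a₁ := Sum.inl i) (a₂ := Sum.inl j) h))
  have ff : ∀ i j, i ≠ j → G.foot i ≠ G.foot j := fun i j hij h =>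
    hij (Sum.inr_injective (hinj (a₁ := Sum.inr i) (a₂ := Sum.inr j) h))
  have hf : ∀ i j, G.head i ≠ G.foot j := fun i j h => by
    have := hinj (a₁ := Sum.inl i) (a₂ := Sum.inr j) h
    exact Sum.inl_ne_inr this
  have hh' : ∀ i j, i ≠ j → (G.head i).1 ≠ (G.head j).1 := fun i j hij h => hh i j hij (Fin.ext h)
  have ff' : ∀ i j, i ≠ j → (G.foot i).1 ≠ (G.foot j).1 := fun i j hij h => ff i j hij (Fin.ext h)
  have hf' : ∀ i j, (G.head i).1 ≠ (G.foot j).1 := fun i j h => hf i j (Fin.ext h)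
  obtain ⟨o₁, h₁⟩ := AdjB.of_psucc (hh x y hxy) hv₁
  obtain ⟨o₂, h₂⟩ := AdjB.of_psucc (ff x z hxz) hv₂
  obtain ⟨o₃, h₃⟩ := AdjB.of_psucc (hf z y).symm hv₃
  have hd : Distinct6 (G.head x).1 (G.head y).1 (G.foot x).1 (G.foot z).1
      (G.foot y).1 (G.head z).1 :=
    ⟨hf' _ _, hf' _ _, hf' _ _, hh' _ _ hxz, hf' _ _, hf' _ _, hf' _ _, hh' _ _ hyz,
      ff' _ _ hxy, (hf' _ _).symm, ff' _ _ hyz.symm, (hf' _ _).symm⟩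
  have hd' : Distinct6 (G.head y).1 (G.head x).1 (G.foot z).1 (G.foot x).1
      (G.head z).1 (G.foot y).1 :=
    ⟨hf' _ _, hf' _ _, hh' _ _ hyz, hf' _ _, hf' _ _, hf' _ _, hh' _ _ hxz, hf' _ _,
      (hf' _ _).symm, ff' _ _ hyz.symm, (hf' _ _).symm, ff' _ _ hxy⟩
  obtain ⟨⟨p1, p2, -, p4⟩, ⟨p5, p6, p7, p8⟩, ⟨p9, p10, p11, p12⟩, p13⟩ := tri_arcs h₁ h₂ h₃ hd
  obtain ⟨⟨q1, q2, -, q4⟩, ⟨q5, q6, q7, q8⟩, ⟨q9, q10, q11, q12⟩, -⟩ :=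
    tri_arcs h₁.symm h₂.symm h₃.symm hd'
  rw [p13] at q4 q7 q8 q11 q12
  have exy : e y ≠ e x := fun h => hxy (he.1 h).symm
  have eyz : e z ≠ e y := fun h => hyz (he.1 h).symm
  have exz : e z ≠ e x := fun h => hxz (he.1 h).symm
  have n1 : (y != x) = true := by simpa using hxy.symm
  have n2 : (z != y) = true := by simpa using hyz.symm
  have n3 : (z != x) = true := by simpa using hxz.symm
  have n4 : (e y != e x) = true := by simpa using exy
  have n5 : (e z != e y) = true := by simpa using eyz
  have n6 : (e z != e x) = true := by simpa using exz
  simp only [GaussDiagram.crosses, n1, n2, n3, n4, n5, n6, Bool.true_and, hs1, hs2, hs3, hs4, hs5,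
    hs6, ← hφ _ _ _, p1, p2, p4, p5, p6, p7, p8, p9, p10, p11, p12, p13, q1, q2, q4, q5, q6, q7,
    q8, q9, q10, q11, q12] at hcount hadm
  have hpar : ∀ c, G'.parity (e c) = ∑ i, G.sign i * G'.contrib (e c) (e i) := fun c => by
    rw [GaussDiagram.parity_eq, ← he.sum_comp]
    exact Finset.sum_congr rfl fun i _ => by rw [hsign]
  intro c
  rw [hpar, GaussDiagram.parity_eq]
  by_cases cx : c = x
  · subst cx
    refine sum_eq_of_three hxy hyz hxz ?_ ?_
    · intro i ix iy iz
      obtain ⟨k1, k2⟩ := hother i ix iy iz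
      congr 1
      simp only [GaussDiagram.contrib, hs1, hs3, k1, k2, ← hφ _ _ _]
      have r : ∀ p : Fin (2 * G.n), p ≠ G.head c → p ≠ G.head y → p ≠ G.foot c → p ≠ G.foot z →
          arc (G.head y).1 (G.foot z).1 p.1 = arc (G.head c).1 (G.foot c).1 p.1 := by
        intro p t1 t2 t3 t4
        rw [← arc_shift₁ h₁ (G.foot z).2 p.2 (hf' _ _).symm (hf' _ _).symm
            (Fin.val_ne_of_ne t1) (Fin.val_ne_of_ne t2),
          arc_shift₂ h₂ (G.head c).2 p.2 (hf' _ _) (hf' _ _)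
            (Fin.val_ne_of_ne t3) (Fin.val_ne_of_ne t4)]
      rw [r _ (hh _ _ ix) (hh _ _ iy) (hf _ _) (hf _ _),
        r _ (hf _ _).symm (hf _ _).symm (ff _ _ ix) (ff _ _ iz)]
    · rw [GaussDiagram.contrib_self, GaussDiagram.contrib_self]
      simp only [GaussDiagram.contrib, hs1, hs2, hs3, hs4, hs5,
        hs6, ← hφ _ _ _, p1, p2, p4, p5, p6, p7, p8, p9, p10, p11, p12, p13, q1, q2, q4, q5, q6,
        q7, q8, q9, q10, q11, q12]
      clear * - hcount hadm
      generalize arc (G.head c).1 (G.foot c).1 (G.foot y).1 = t at hcount hadm ⊢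
      cases t <;> cases o₁ <;> cases o₂ <;> cases o₃ <;> simp [bval] at hcount hadm ⊢ <;> omega
  by_cases cy : c = y
  · subst cy
    refine sum_eq_of_three hxy hyz hxz ?_ ?_
    · intro i ix iy iz
      obtain ⟨k1, k2⟩ := hother i ix iy iz
      congr 1
      simp only [GaussDiagram.contrib, hs2, hs5, k1, k2, ← hφ _ _ _]
      have r : ∀ p : Fin (2 * G.n), p ≠ G.head x → p ≠ G.head c → p ≠ G.foot c → p ≠ G.head z →
          arc (G.head x).1 (G.head z).1 p.1 = arc (G.head c).1 (G.foot c).1 p.1 := by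
        intro p t1 t2 t3 t4
        rw [arc_shift₁ h₁ (G.head z).2 p.2 (hh' _ _ hxz.symm) (hh' _ _ hyz.symm)
            (Fin.val_ne_of_ne t1) (Fin.val_ne_of_ne t2),
          arc_shift₂ h₃ (G.head c).2 p.2 (hf' _ _) (hh' _ _ hyz)
            (Fin.val_ne_of_ne t3) (Fin.val_ne_of_ne t4)]
      rw [r _ (hh _ _ ix) (hh _ _ iy) (hf _ _) (hh _ _ iz),
        r _ (hf _ _).symm (hf _ _).symm (ff _ _ iy) (hf _ _).symm]
    · rw [GaussDiagram.contrib_self, GaussDiagram.contrib_self]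
      simp only [GaussDiagram.contrib, hs1, hs2, hs3, hs4, hs5,
        hs6, ← hφ _ _ _, p1, p2, p4, p5, p6, p7, p8, p9, p10, p11, p12, p13, q1, q2, q4, q5, q6,
        q7, q8, q9, q10, q11, q12]
      clear * - hcount hadm
      generalize arc (G.head x).1 (G.foot x).1 (G.foot c).1 = t at hcount hadm ⊢
      cases t <;> cases o₁ <;> cases o₂ <;> cases o₃ <;> simp [bval] at hcount hadm ⊢ <;> omega
  by_cases cz : c = z
  · subst cz
    refine sum_eq_of_three hxy hyz hxz ?_ ?_
    · intro i ix iy iz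
      obtain ⟨k1, k2⟩ := hother i ix iy iz
      congr 1
      simp only [GaussDiagram.contrib, hs4, hs6, k1, k2, ← hφ _ _ _]
      have r : ∀ p : Fin (2 * G.n), p ≠ G.foot y → p ≠ G.head c → p ≠ G.foot x → p ≠ G.foot c →
          arc (G.foot y).1 (G.foot x).1 p.1 = arc (G.head c).1 (G.foot c).1 p.1 := by
        intro p t1 t2 t3 t4
        rw [arc_shift₁ h₃ (G.foot x).2 p.2 (ff' _ _ hxy) (hf' _ _).symm
            (Fin.val_ne_of_ne t1) (Fin.val_ne_of_ne t2),
          arc_shift₂ h₂ (G.head c).2 p.2 (hf' _ _) (hf' _ _)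
            (Fin.val_ne_of_ne t3) (Fin.val_ne_of_ne t4)]
      rw [r _ (hf _ _) (hh _ _ iz) (hf _ _) (hf _ _),
        r _ (ff _ _ iy) (hf _ _).symm (ff _ _ ix) (ff _ _ iz)]
    · rw [GaussDiagram.contrib_self, GaussDiagram.contrib_self]
      simp only [GaussDiagram.contrib, hs1, hs2, hs3, hs4, hs5,
        hs6, ← hφ _ _ _, p1, p2, p4, p5, p6, p7, p8, p9, p10, p11, p12, p13, q1, q2, q4, q5, q6,
        q7, q8, q9, q10, q11, q12]
      clear * - hcount hadm
      generalize arc (G.head x).1 (G.foot x).1 (G.foot y).1 = t at hcount hadm ⊢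
      cases t <;> cases o₁ <;> cases o₂ <;> cases o₃ <;> simp [bval] at hcount hadm ⊢ <;> omega
  · -- a chord outside the triangle
    obtain ⟨c1, c2⟩ := hother c cx cy cz
    have s1 : arc (G.head c).1 (G.foot c).1 (G.head x).1 =
        arc (G.head c).1 (G.foot c).1 (G.head y).1 :=
      arc_shift₃ h₁ (G.head c).2 (G.foot c).2 (hh' _ _ cx) (hh' _ _ cy)
        (hf' _ _).symm (hf' _ _).symm
    have s2 : arc (G.head c).1 (G.foot c).1 (G.foot x).1 =
        arc (G.head c).1 (G.foot c).1 (G.foot z).1 :=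
      arc_shift₃ h₂ (G.head c).2 (G.foot c).2 (hf' _ _) (hf' _ _) (ff' _ _ cx) (ff' _ _ cz)
    have s3 : arc (G.head c).1 (G.foot c).1 (G.foot y).1 =
        arc (G.head c).1 (G.foot c).1 (G.head z).1 :=
      arc_shift₃ h₃ (G.head c).2 (G.foot c).2 (hf' _ _) (hh' _ _ cz) (ff' _ _ cy)
        (hf' _ _).symm
    refine Finset.sum_congr rfl fun i _ => ?_
    congr 1
    by_cases ix : i = x
    · subst ix
      simp only [GaussDiagram.contrib, c1, c2, hs1, hs3, ← hφ _ _ _, s1, s2]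
    by_cases iy : i = y
    · subst iy
      simp only [GaussDiagram.contrib, c1, c2, hs2, hs5, ← hφ _ _ _, s1, s3]
    by_cases iz : i = z
    · subst iz
      simp only [GaussDiagram.contrib, c1, c2, hs4, hs6, ← hφ _ _ _, s2, s3]
    · obtain ⟨k1, k2⟩ := hother i ix iy iz
      simp only [GaussDiagram.contrib, c1, c2, k1, k2, ← hφ _ _ _]
end

section
/- Let i ≥ 1. If two Gauss diagrams G and G' are related by a single chord move, a two chord move, or a triangle move (and hence if they are related by any finite sequence of chord moves), then S_i(G) = S_i(G') as elements of the free ℤ-module on flat equivalence classes of flat Gauss diagrams. -/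
namespace FlatWord

open List

theorem arc_iff (a b p : ℕ) :
    arc a b p = true ↔ (a < b ∧ a < p ∧ p < b) ∨ (b ≤ a ∧ (p < b ∨ a < p)) := by
  unfold arc
  split_ifs with h
  · simp; omega
  · simp; omega

theorem cyclic_of_mono {k l : ℕ} (φ : Fin k → Fin l)
    (h : ∀ a b : Fin k, a.1 < b.1 → (φ a).1 < (φ b).1) : CyclicMap φ := by
  have h' : ∀ a b : Fin k, a.1 < b.1 ↔ (φ a).1 < (φ b).1 := by
    intro a b
    refine ⟨h a b, fun hab => ?_⟩
    by_contra hc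
    rcases Nat.lt_or_ge b.1 a.1 with hlt | hge
    · have := h b a hlt; omega
    · have : a = b := Fin.ext (by omega)
      subst this; omega
  intro a b p
  rw [Bool.eq_iff_iff, arc_iff, arc_iff]
  have h1 := h' a b
  have h2 := h' b a
  have h3 := h' a p
  have h4 := h' p a
  have h5 := h' p b
  have h6 := h' b p
  omega

/-- The flat diagram `F` realises the word `u`, chord `i` having the letter `ℓ i`. -/
structure RepL {α : Type} (F : FlatDiagram) (u : List α) (ℓ : Fin F.n → α) : Prop where
  len : u.length = 2 * F.n
  inj : Function.Injective ℓ
  ne : ∀ i, F.fst i ≠ F.snd i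
  hfst : ∀ i, u[(F.fst i).1]? = some (ℓ i)
  hsnd : ∀ i, u[(F.snd i).1]? = some (ℓ i)

def Rep {α : Type} (F : FlatDiagram) (u : List α) : Prop := ∃ ℓ, RepL F u ℓ

theorem RepL.proper {α : Type} {F : FlatDiagram} {u : List α} {ℓ : Fin F.n → α}
    (h : RepL F u ℓ) : F.Proper := by
  have key : ∀ (i j : Fin F.n) (p : Fin (2 * F.n)), u[p.1]? = some (ℓ i) →
      u[p.1]? = some (ℓ j) → i = j := by
    intro i j p h1 h2
    rw [h1] at h2
    exact h.inj (Option.some.inj h2)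
  intro s t hst
  rcases s with i | i <;> rcases t with j | j <;> simp only [Sum.elim_inl, Sum.elim_inr] at hst
  · have := key i j _ (h.hfst i) (hst ▸ h.hfst j); rw [this]
  · have := key i j _ (h.hfst i) (hst ▸ h.hsnd j); subst this; exact absurd hst (h.ne i)
  · have := key i j _ (h.hsnd i) (hst ▸ h.hfst j); subst this; exact absurd hst.symm (h.ne i)
  · have := key i j _ (h.hsnd i) (hst ▸ h.hsnd j); rw [this]

theorem RepL.surj {α : Type} {F : FlatDiagram} {u : List α} {ℓ : Fin F.n → α}
    (h : RepL F u ℓ) (p : Fin (2 * F.n)) : ∃ j, F.fst j = p ∨ F.snd j = p := by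
  have hb : Function.Bijective (Sum.elim F.fst F.snd) := by
    rw [Fintype.bijective_iff_injective_and_card]
    refine ⟨h.proper, by simp; omega⟩
  obtain ⟨s, hs⟩ := hb.2 p
  rcases s with j | j
  · exact ⟨j, Or.inl hs⟩
  · exact ⟨j, Or.inr hs⟩

theorem RepL.lab {α : Type} {F : FlatDiagram} {u : List α} {ℓ : Fin F.n → α}
    (h : RepL F u ℓ) {a : α} (p : Fin (2 * F.n)) {j : Fin F.n} (hp : u[p.1]? = some a)
    (hj : ℓ j = a) : F.fst j = p ∨ F.snd j = p := by
  obtain ⟨k, hk⟩ := h.surj p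
  have : ℓ k = a := by
    rcases hk with hk | hk
    · have := h.hfst k; rw [hk, hp] at this; exact (Option.some.inj this).symm
    · have := h.hsnd k; rw [hk, hp] at this; exact (Option.some.inj this).symm
  have : k = j := h.inj (this.trans hj.symm)
  exact this ▸ hk

theorem RepL.exists_lab {α : Type} {F : FlatDiagram} {u : List α} {ℓ : Fin F.n → α}
    (h : RepL F u ℓ) {a : α} (ha : a ∈ u) : ∃ j, ℓ j = a := by
  obtain ⟨p, hp, hpa⟩ := List.getElem_of_mem ha
  obtain ⟨k, hk⟩ := h.surj ⟨p, by rw [← h.len]; exact hp⟩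
  refine ⟨k, ?_⟩
  have hp' : u[p]? = some a := by rw [List.getElem?_eq_getElem hp, hpa]
  rcases hk with hk | hk
  · have := h.hfst k; rw [hk, hp'] at this; exact (Option.some.inj this).symm
  · have := h.hsnd k; rw [hk, hp'] at this; exact (Option.some.inj this).symm

theorem RepL.mem {α : Type} {F : FlatDiagram} {u : List α} {ℓ : Fin F.n → α}
    (h : RepL F u ℓ) (i : Fin F.n) : ℓ i ∈ u := List.mem_of_getElem? (h.hfst i)

theorem RepL.ends {α : Type} {F : FlatDiagram} {u : List α} {ℓ : Fin F.n → α}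
    (h : RepL F u ℓ) {a : α} (p q : Fin (2 * F.n)) {j : Fin F.n} (hj : ℓ j = a) (hpq : p ≠ q)
    (hp : u[p.1]? = some a) (hq : u[q.1]? = some a) : F.hasEnds j p q := by
  have h1 := h.lab p hp hj
  have h2 := h.lab q hq hj
  rcases h1 with h1 | h1 <;> rcases h2 with h2 | h2
  · exact absurd (h1.symm.trans h2) hpq
  · exact Or.inl ⟨h1, h2⟩
  · exact Or.inr ⟨h2, h1⟩
  · exact absurd (h1.symm.trans h2) hpq

/-- The map on chords induced by an injective map of letters. -/
theorem RepL.chordMap {α β : Type} {F F' : FlatDiagram} {u : List α} {u' : List β}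
    {ℓ : Fin F.n → α} {ℓ' : Fin F'.n → β} (h : RepL F u ℓ) (h' : RepL F' u' ℓ') (g : α → β)
    (hg : Function.Injective g) (hmem : ∀ a ∈ u, g a ∈ u') :
    ∃ e : Fin F.n → Fin F'.n, Function.Injective e ∧ ∀ i, ℓ' (e i) = g (ℓ i) := by
  have := fun i => h'.exists_lab (hmem _ (h.mem i))
  choose e he using this
  refine ⟨e, fun i j hij => ?_, he⟩
  have h1 := he i
  rw [hij, he j] at h1
  exact (h.inj (hg h1)).symm

/-- Every letter occurs exactly twice. -/
def DO {α : Type} [DecidableEq α] (u : List α) : Prop := ∀ a ∈ u, u.count a = 2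

theorem DO.perm {α : Type} [DecidableEq α] {u v : List α} (h : DO u) (p : u ~ v) : DO v := by
  intro a ha
  rw [← p.count_eq]
  exact h a (p.mem_iff.2 ha)

theorem DO.map {α β : Type} [DecidableEq α] [DecidableEq β] {u : List α} (h : DO u) {g : α → β}
    (hg : Function.Injective g) : DO (u.map g) := by
  intro b hb
  obtain ⟨a, ha, rfl⟩ := List.mem_map.1 hb
  rw [List.count_map_of_injective _ _ hg]
  exact h a ha

theorem exists_two {α : Type} [DecidableEq α] {u : List α} {a : α} (h : u.count a = 2) :
    ∃ p q : ℕ, p < q ∧ q < u.length ∧ u[p]? = some a ∧ u[q]? = some a := by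
  have ha : a ∈ u := List.count_pos_iff.1 (by omega)
  obtain ⟨A, R, rfl, hA⟩ := List.eq_append_cons_of_mem ha
  have : R.count a = 1 := by
    rw [List.count_append, List.count_cons_self, List.count_eq_zero.2 hA] at h
    omega
  have hR : a ∈ R := List.count_pos_iff.1 (by omega)
  obtain ⟨B, C, rfl, hB⟩ := List.eq_append_cons_of_mem hR
  refine ⟨A.length, A.length + 1 + B.length, by omega, by simp; omega, by simp, ?_⟩
  rw [show A ++ a :: (B ++ a :: C) = (A ++ a :: B) ++ a :: C by simp]
  rw [List.getElem?_append_right (by simp; omega)]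
  simp [show A.length + 1 + B.length - (A.length + (B.length + 1)) = 0 by omega]

theorem exists_rep {α : Type} [DecidableEq α] {u : List α} (h : DO u) : ∃ F, Rep F u := by
  have hlen : u.length = 2 * u.dedup.length := by
    rw [← List.sum_map_count_dedup_eq_length u]
    rw [List.map_congr_left (g := fun _ => 2) (fun a ha => h a (List.mem_dedup.1 ha))]
    simp [mul_comm]
  have := fun i : Fin u.dedup.length =>
    exists_two (h u.dedup[i] (List.mem_dedup.1 (List.getElem_mem i.2)))
  choose p q hpq hq h1 h2 using this
  refine ⟨⟨u.dedup.length, fun i => ⟨p i, ?_⟩, fun i => ⟨q i, ?_⟩⟩, fun i => u.dedup[i], ?_⟩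
  · have := hpq i; have := hq i; omega
  · have := hq i; omega
  refine ⟨hlen, ?_, ?_, h1, h2⟩
  · intro i j hij
    exact Fin.ext ((List.nodup_dedup u).getElem_inj_iff.1 hij)
  · intro i hi
    have := hpq i
    simp at hi
    omega

open Classical in
/-- The flat class of a word. -/
noncomputable def cls {α : Type} (u : List α) : FlatClass :=
  if h : ∃ F, Rep F u then Fclass h.choose else Fclass ⟨0, Fin.elim0, Fin.elim0⟩

/-- Relabelling isomorphism along a bijection of positions. -/
theorem iso_of {α β : Type} {F F' : FlatDiagram} {u : List α} {u' : List β}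
    {ℓ : Fin F.n → α} {ℓ' : Fin F'.n → β} (h : RepL F u ℓ) (h' : RepL F' u' ℓ') (g : α → β)
    (hg : Function.Injective g) (hn : u.length = u'.length)
    (φ : Fin (2 * F.n) → Fin (2 * F'.n)) (hφ : Function.Injective φ)
    (hcyc : CyclicMap φ ∨ AntiCyclicMap φ)
    (hl : ∀ p : Fin (2 * F.n), u'[(φ p).1]? = (u[p.1]?).map g) : FlatIso F F' := by
  have hn' : F.n = F'.n := by have := h.len; have := h'.len; omega
  obtain ⟨e, hei, he⟩ := h.chordMap h' g hg (by
    intro a ha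
    obtain ⟨p, hp, hpa⟩ := List.getElem_of_mem ha
    have := hl ⟨p, by rw [← h.len]; exact hp⟩
    simp only [List.getElem?_eq_getElem hp, hpa, Option.map_some] at this
    exact List.mem_of_getElem? this)
  refine ⟨e, φ, ?_, ?_, hcyc, fun i => ?_⟩
  · rw [Fintype.bijective_iff_injective_and_card]; exact ⟨hei, by simpa using hn'⟩
  · rw [Fintype.bijective_iff_injective_and_card]; exact ⟨hφ, by simpa using hn'⟩
  · refine h'.ends _ _ (he i) (fun hh => h.ne i (hφ hh)) ?_ ?_
    · rw [hl, h.hfst]; rfl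
    · rw [hl, h.hsnd]; rfl

theorem cls_eq {α : Type} {F : FlatDiagram} {u : List α} (h : Rep F u) : Fclass F = cls u := by
  have hex : ∃ F, Rep F u := ⟨F, h⟩
  unfold cls
  rw [dif_pos hex]
  obtain ⟨ℓ, hF⟩ := h
  obtain ⟨ℓ', hF'⟩ := hex.choose_spec
  have hn : 2 * F.n = 2 * hex.choose.n := by rw [← hF.len, ← hF'.len]
  refine Quot.sound (Or.inl (iso_of hF hF' id Function.injective_id rfl (Fin.cast hn)
    (Fin.cast_injective hn) (Or.inl ?_) ?_))
  · exact cyclic_of_mono _ (fun a b hab => by simpa using hab)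
  · intro p; simp

theorem cls_of_rel {α β : Type} [DecidableEq α] [DecidableEq β] {u : List α} {u' : List β}
    (h : DO u) (h' : DO u')
    (H : ∀ F F' ℓ ℓ', RepL F u ℓ → RepL F' u' ℓ' → FlatRel F F') : cls u = cls u' := by
  obtain ⟨F, ℓ, hF⟩ := exists_rep h
  obtain ⟨F', ℓ', hF'⟩ := exists_rep h'
  rw [← cls_eq ⟨ℓ, hF⟩, ← cls_eq ⟨ℓ', hF'⟩]
  exact Quot.sound (H F F' ℓ ℓ' hF hF')

theorem cls_map {α β : Type} [DecidableEq α] [DecidableEq β] {u : List α} (h : DO u) (g : α → β)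
    (hg : Function.Injective g) : cls (u.map g) = cls u := by
  symm
  refine cls_of_rel h (h.map hg) fun F F' ℓ ℓ' hF hF' => Or.inl ?_
  have hn : 2 * F.n = 2 * F'.n := by rw [← hF.len, ← hF'.len]; simp
  refine iso_of hF hF' g hg (by simp) (Fin.cast hn) (Fin.cast_injective hn) (Or.inl ?_) ?_
  · exact cyclic_of_mono _ (fun a b hab => by simpa using hab)
  · intro p; simp

theorem cls_reverse {α : Type} [DecidableEq α] {u : List α} (h : DO u) :
    cls u.reverse = cls u := by
  symm
  refine cls_of_rel h (h.perm (List.reverse_perm u).symm) fun F F' ℓ ℓ' hF hF' => Or.inl ?_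
  have hn : 2 * F.n = 2 * F'.n := by rw [← hF.len, ← hF'.len]; simp
  have hlt : ∀ p : Fin (2 * F.n), 2 * F.n - 1 - p.1 < 2 * F'.n := by intro p; have := p.2; omega
  refine iso_of hF hF' id Function.injective_id (by simp) (fun p => ⟨2 * F.n - 1 - p.1, hlt p⟩)
    ?_ (Or.inr ?_) ?_
  · intro p q hpq
    simp only [Fin.mk.injEq] at hpq
    have := p.2; have := q.2
    exact Fin.ext (by omega)
  · intro a b p
    have := a.2; have := b.2; have := p.2
    rw [Bool.eq_iff_iff, arc_iff, arc_iff]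
    dsimp only
    omega
  · intro p
    have := p.2
    have hl := hF.len
    dsimp only
    rw [List.getElem?_reverse (by omega)]
    simp only [Option.map_id, id]
    congr 1
    omega

theorem cls_append_comm {α : Type} [DecidableEq α] {X Y : List α} (h : DO (X ++ Y)) :
    cls (X ++ Y) = cls (Y ++ X) := by
  refine cls_of_rel h (h.perm List.perm_append_comm) fun F F' ℓ ℓ' hF hF' => Or.inl ?_
  have hl := hF.len
  have hl' := hF'.len
  rw [List.length_append] at hl hl'
  have hlt : ∀ p : Fin (2 * F.n),
      (if p.1 < X.length then p.1 + Y.length else p.1 - X.length) < 2 * F'.n := by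
    intro p; have := p.2; split_ifs <;> omega
  refine iso_of hF hF' id Function.injective_id (by simp; omega) (fun p => ⟨_, hlt p⟩)
    ?_ (Or.inl ?_) ?_
  · intro p q hpq
    simp only [Fin.mk.injEq] at hpq
    have := p.2; have := q.2
    refine Fin.ext ?_
    split_ifs at hpq <;> omega
  · intro a b p
    have := a.2; have := b.2; have := p.2
    rw [Bool.eq_iff_iff, arc_iff, arc_iff]
    dsimp only
    split_ifs <;> omega
  · intro p
    have := p.2
    dsimp only
    split_ifs with hp
    · rw [List.getElem?_append_right (by omega), List.getElem?_append_left hp]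
      simp
    · rw [List.getElem?_append_left (by omega), List.getElem?_append_right (by omega)]
      simp

theorem rot_iff {α : Type} {u v : List α} : u ~r v ↔ ∃ X Y, u = X ++ Y ∧ v = Y ++ X := by
  constructor
  · rintro ⟨n, rfl⟩
    rw [← List.rotate_mod]
    rcases Nat.eq_zero_or_pos u.length with h0 | h0
    · rw [List.length_eq_zero_iff] at h0; subst h0; exact ⟨[], [], by simp⟩
    · have := Nat.mod_lt n h0
      exact ⟨u.take (n % u.length), u.drop (n % u.length), by simp,
        List.rotate_eq_drop_append_take this.le⟩
  · rintro ⟨X, Y, rfl, rfl⟩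
    exact List.isRotated_append

theorem cls_rot {α : Type} [DecidableEq α] {u v : List α} (h : DO u) (r : u ~r v) :
    cls u = cls v := by
  obtain ⟨X, Y, rfl, rfl⟩ := rot_iff.1 r
  exact cls_append_comm h

end FlatWord


namespace FlatWord

open List

theorem DO.cons2 {α : Type} [DecidableEq α] {a : α} {A : List α} (h : DO (a :: a :: A)) :
    a ∉ A ∧ DO A := by
  have ha : a ∉ A := by
    have := h a (by simp)
    simp only [List.count_cons_self] at this
    exact List.count_eq_zero.1 (by omega)
  refine ⟨ha, fun b hb => ?_⟩
  have hne : a ≠ b := fun hab => ha (hab ▸ hb)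
  have := h b (by simp [hb])
  simpa [List.count_cons, hne] using this

theorem DO.insert2 {α : Type} [DecidableEq α] {a : α} {A : List α} (h : DO A) (ha : a ∉ A) :
    DO (a :: a :: A) := by
  intro c hc
  by_cases hac : c = a
  · subst hac
    rw [List.count_cons_self, List.count_cons_self, List.count_eq_zero.2 ha]
  · rw [List.count_cons_of_ne (Ne.symm hac), List.count_cons_of_ne (Ne.symm hac)]
    exact h c (by simpa [hac] using hc)

theorem cls_single {α : Type} [DecidableEq α] {a : α} {A : List α} (h : DO (a :: a :: A)) :
    cls (a :: a :: A) = cls A := by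
  symm
  refine cls_of_rel h.cons2.2 h fun F F' ℓ ℓ' hF hF' => Or.inr (Or.inl ?_)
  have hl := hF.len
  have hl' := hF'.len
  simp only [List.length_cons] at hl'
  have hn : F'.n = F.n + 1 := by omega
  obtain ⟨e, hei, he⟩ := hF.chordMap hF' id Function.injective_id (by intro b hb; simp [hb])
  obtain ⟨y, hy⟩ := hF'.exists_lab (a := a) (by simp)
  have hlt : ∀ p : Fin (2 * F.n), p.1 + 2 < 2 * F'.n := by intro p; have := p.2; omega
  refine ⟨hF.proper, hF'.proper, hn, e, fun p => ⟨p.1 + 2, hlt p⟩, y, hei, ?_, ?_, ?_, ?_⟩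
  · intro i hi
    have h1 := he i
    rw [hi, hy] at h1
    exact h.cons2.1 (h1 ▸ hF.mem i)
  · exact cyclic_of_mono _ (fun a b hab => by simpa using hab)
  · intro i
    refine hF'.ends _ _ (he i) ?_ ?_ ?_
    · intro hh
      apply hF.ne i
      simp only [Fin.mk.injEq] at hh
      exact Fin.ext (by omega)
    · simpa using hF.hfst i
    · simpa using hF.hsnd i
  · have := hF'.ends (a := a) (⟨0, by omega⟩ : Fin (2 * F'.n)) ⟨1, by omega⟩ hy
      (by simp) (by simp) (by simp)
    have hs : (⟨1, by omega⟩ : Fin (2 * F'.n)) = psucc ⟨0, by omega⟩ := by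
      simp only [psucc, Fin.mk.injEq]
      rw [Nat.mod_eq_of_lt (by omega)]
    rcases this with ⟨h1, h2⟩ | ⟨h1, h2⟩
    · left; rw [h1, h2, hs]
    · right; rw [h1, h2, hs]

theorem DO.two {α : Type} [DecidableEq α] {a b : α} {A B : List α} {s t : List α}
    (hs : s ~ [a, b]) (ht : t ~ [a, b])
    (h : DO (s ++ A ++ t ++ B)) : a ≠ b ∧ (a ∉ A ++ B) ∧ (b ∉ A ++ B) ∧ DO (A ++ B) := by
  have h1 : DO (a :: a :: b :: b :: (A ++ B)) := by
    refine h.perm ?_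
    rw [List.perm_iff_count]
    intro c
    have h1 := hs.count_eq c
    have h2 := ht.count_eq c
    simp only [List.count_append, List.count_cons, h1, h2]
    simp
    omega
  have h2 := h1.cons2
  have h3 := h2.2.cons2
  simp only [List.mem_cons, not_or] at h2
  exact ⟨h2.1.1, h2.1.2.2, h3.1, h3.2⟩

theorem psucc_val {m : ℕ} (p : ℕ) (h : p + 1 < m) :
    psucc (⟨p, by omega⟩ : Fin m) = ⟨p + 1, h⟩ := by
  simp only [psucc, Fin.mk.injEq]
  exact Nat.mod_eq_of_lt h

theorem cls_two_co {α : Type} [DecidableEq α] {a b : α} {A B : List α}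
    (h : DO ([a, b] ++ A ++ [a, b] ++ B)) :
    cls ([a, b] ++ A ++ [a, b] ++ B) = cls (A ++ B) := by
  obtain ⟨hab, ha, hb, hd⟩ := DO.two (List.Perm.refl _) (List.Perm.refl _) h
  symm
  refine cls_of_rel hd h fun F F' ℓ ℓ' hF hF' => Or.inr (Or.inr (Or.inr (Or.inl ?_)))
  have hl := hF.len
  have hl' := hF'.len
  simp only [List.length_cons, List.length_append, List.length_nil] at hl' hl
  have hn : F'.n = F.n + 2 := by omega
  obtain ⟨e, hei, he⟩ := hF.chordMap hF' id Function.injective_id (by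
    intro c hc
    simp only [List.mem_append] at hc ⊢
    simp only [id]
    tauto)
  obtain ⟨y₁, hy₁⟩ := hF'.exists_lab (a := a) (by simp)
  obtain ⟨y₂, hy₂⟩ := hF'.exists_lab (a := b) (by simp)
  have hlt : ∀ p : Fin (2 * F.n), (if p.1 < A.length then p.1 + 2 else p.1 + 4) < 2 * F'.n := by
    intro p; have := p.2; split_ifs <;> omega
  have hget : ∀ p : ℕ, ([a, b] ++ A ++ [a, b] ++ B)[(if p < A.length then p + 2 else p + 4)]?
      = (A ++ B)[p]? := by
    intro p
    split_ifs with hp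
    · rw [List.getElem?_append_left (by simp; omega), List.getElem?_append_left (by simp; omega),
        List.getElem?_append_right (by simp), List.getElem?_append_left hp]
      simp
    · rw [List.getElem?_append_right (by simp; omega),
        List.getElem?_append_right (by omega)]
      congr 1
      simp; try omega
  refine ⟨hF.proper, hF'.proper, hn, e, fun p => ⟨_, hlt p⟩, y₁, y₂,
    ⟨0, by omega⟩, ⟨A.length + 2, by omega⟩, hei, ?_, ?_, ?_, ?_, ?_, ?_⟩
  · intro hy
    rw [hy, hy₂] at hy₁
    exact hab hy₁.symm
  · intro i
    constructor
    · intro hi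
      have h1 := he i
      rw [hi, hy₁] at h1
      exact ha (h1 ▸ hF.mem i)
    · intro hi
      have h1 := he i
      rw [hi, hy₂] at h1
      exact hb (h1 ▸ hF.mem i)
  · refine cyclic_of_mono _ (fun a b hab => ?_)
    dsimp only
    split_ifs <;> omega
  · intro i
    refine hF'.ends _ _ (he i) ?_ ?_ ?_
    · intro hh
      apply hF.ne i
      simp only [Fin.mk.injEq] at hh
      refine Fin.ext ?_
      split_ifs at hh <;> omega
    · rw [hget]; exact hF.hfst i
    · rw [hget]; exact hF.hsnd i
  · refine hF'.ends _ _ hy₁ (by simp) (by simp) ?_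
    rw [List.getElem?_append_left (by simp), List.getElem?_append_right (by simp)]
    simp
  · rw [psucc_val 0 (by omega), psucc_val (A.length + 2) (by omega)]
    refine hF'.ends _ _ hy₂ (by simp) (by simp) ?_
    rw [List.getElem?_append_left (by simp), List.getElem?_append_right (by simp)]
    simp

theorem pair_pos {α : Type} {s : List α} {x y : α} (h : s = [x, y] ∨ s = [y, x]) :
    ∃ a b : ℕ, ((a = 0 ∧ b = 1) ∨ (a = 1 ∧ b = 0)) ∧ s.length = 2 ∧
      s[a]? = some x ∧ s[b]? = some y ∧ s.reverse[b]? = some x ∧ s.reverse[a]? = some y := by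
  rcases h with rfl | rfl
  · exact ⟨0, 1, by simp⟩
  · exact ⟨1, 0, by simp⟩

theorem get6 {α : Type} (s A t B v C : List α) (hs : s.length = 2) (ht : t.length = 2)
    (hv : v.length = 2) :
    (∀ i, i < 2 → (s ++ A ++ t ++ B ++ v ++ C)[i]? = s[i]?) ∧
    (∀ i, i < 2 → (s ++ A ++ t ++ B ++ v ++ C)[2 + A.length + i]? = t[i]?) ∧
    (∀ i, i < 2 → (s ++ A ++ t ++ B ++ v ++ C)[2 + A.length + 2 + B.length + i]? = v[i]?) ∧
    (∀ i, i < A.length → (s ++ A ++ t ++ B ++ v ++ C)[2 + i]? = A[i]?) ∧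
    (∀ i, i < B.length → (s ++ A ++ t ++ B ++ v ++ C)[2 + A.length + 2 + i]? = B[i]?) ∧
    (∀ i, (s ++ A ++ t ++ B ++ v ++ C)[2 + A.length + 2 + B.length + 2 + i]? = C[i]?) := by
  refine ⟨fun i hi => ?_, fun i hi => ?_, fun i hi => ?_, fun i hi => ?_, fun i hi => ?_,
    fun i => ?_⟩
  · rw [List.append_assoc, List.append_assoc, List.append_assoc, List.append_assoc,
      List.getElem?_append_left (by omega)]
  · rw [List.append_assoc, List.append_assoc, List.append_assoc,
      List.getElem?_append_right (by simp; omega), List.getElem?_append_left (by simp; omega)]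
    congr 1; simp; omega
  · rw [List.append_assoc, 
      List.getElem?_append_right (by simp; omega), List.getElem?_append_left (by simp; omega)]
    congr 1; simp; omega
  · rw [List.append_assoc, List.append_assoc, List.append_assoc, List.append_assoc,
      List.getElem?_append_right (by omega), List.getElem?_append_left (by omega)]
    congr 1; omega
  · rw [List.append_assoc, List.append_assoc,
      List.getElem?_append_right (by simp; omega), List.getElem?_append_left (by simp; omega)]
    congr 1; simp; omega
  · rw [List.getElem?_append_right (by simp; omega)]
    congr 1; simp; omega

set_option maxHeartbeats 2000000 in
theorem cls_tri {α : Type} [DecidableEq α] {x y z : α} {A B C s t v : List α}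
    (hxy : x ≠ y) (hyz : y ≠ z) (hxz : x ≠ z)
    (hs : s = [x, y] ∨ s = [y, x]) (ht : t = [x, z] ∨ t = [z, x]) (hv : v = [y, z] ∨ v = [z, y])
    (h : DO (s ++ A ++ t ++ B ++ v ++ C)) :
    cls (s ++ A ++ t ++ B ++ v ++ C) =
      cls (s.reverse ++ A ++ t.reverse ++ B ++ v.reverse ++ C) := by
  have hp : (s ++ A ++ t ++ B ++ v ++ C) ~
      (s.reverse ++ A ++ t.reverse ++ B ++ v.reverse ++ C) := by
    rw [List.perm_iff_count]; intro c; simp [List.count_append]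
  obtain ⟨a1, b1, hab1, hl1, h1a, h1b, h1c, h1d⟩ := pair_pos hs
  obtain ⟨a2, b2, hab2, hl2, h2a, h2b, h2c, h2d⟩ := pair_pos ht
  obtain ⟨a3, b3, hab3, hl3, h3a, h3b, h3c, h3d⟩ := pair_pos hv
  have hxm : x ∈ s := by rcases hs with rfl | rfl <;> simp
  have hym : y ∈ s := by rcases hs with rfl | rfl <;> simp
  have hzm : z ∈ t := by rcases ht with rfl | rfl <;> simp
  refine cls_of_rel h (h.perm hp) fun F F' ℓ ℓ' hF hF' =>
    Or.inr (Or.inr (Or.inr (Or.inr (Or.inr (Or.inl ?_)))))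
  have hl := hF.len
  have hl' := hF'.len
  have hll : 2 * F.n = 2 * F'.n := by rw [← hl, ← hl', hp.length_eq]
  obtain ⟨g1, g2, g3, g4, g5, g6⟩ := get6 s A t B v C hl1 hl2 hl3
  obtain ⟨r1, r2, r3, r4, r5, r6⟩ := get6 s.reverse A t.reverse B v.reverse C
    (by simpa using hl1) (by simpa using hl2) (by simpa using hl3)
  obtain ⟨e, hei, he⟩ := hF.chordMap hF' id Function.injective_id (by
    intro c hc; exact hp.mem_iff.1 hc)
  obtain ⟨X, hX⟩ := hF.exists_lab (a := x) (by simp [hxm])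
  obtain ⟨Y, hY⟩ := hF.exists_lab (a := y) (by simp [hym])
  obtain ⟨Z, hZ⟩ := hF.exists_lab (a := z) (by simp [hzm])
  simp only [List.length_append, hl1, hl2, hl3] at hl
  have hother : ∀ i, i ≠ X → i ≠ Y → i ≠ Z → ∀ p : ℕ,
      (s ++ A ++ t ++ B ++ v ++ C)[p]? = some (ℓ i) →
      (s.reverse ++ A ++ t.reverse ++ B ++ v.reverse ++ C)[p]? = some (ℓ i) := by
    intro i hiX hiY hiZ p hpi
    have nx : ℓ i ≠ x := fun hh => hiX (hF.inj (hh.trans hX.symm))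
    have ny : ℓ i ≠ y := fun hh => hiY (hF.inj (hh.trans hY.symm))
    have nz : ℓ i ≠ z := fun hh => hiZ (hF.inj (hh.trans hZ.symm))
    by_cases c1 : p < 2
    · rw [g1 p c1] at hpi
      have := List.mem_of_getElem? hpi
      exfalso
      rcases hs with rfl | rfl <;> simp at this <;> tauto
    by_cases c2 : p < 2 + A.length
    · obtain ⟨k, rfl⟩ : ∃ k, p = 2 + k := ⟨p - 2, by omega⟩
      rw [r4 k (by omega), ← g4 k (by omega)]; exact hpi
    by_cases c3 : p < 2 + A.length + 2
    · obtain ⟨k, rfl⟩ : ∃ k, p = 2 + A.length + k := ⟨p - (2 + A.length), by omega⟩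
      rw [g2 k (by omega)] at hpi
      have := List.mem_of_getElem? hpi
      exfalso
      rcases ht with rfl | rfl <;> simp at this <;> tauto
    by_cases c4 : p < 2 + A.length + 2 + B.length
    · obtain ⟨k, rfl⟩ : ∃ k, p = 2 + A.length + 2 + k := ⟨p - (2 + A.length + 2), by omega⟩
      rw [r5 k (by omega), ← g5 k (by omega)]; exact hpi
    by_cases c5 : p < 2 + A.length + 2 + B.length + 2
    · obtain ⟨k, rfl⟩ : ∃ k, p = 2 + A.length + 2 + B.length + k :=
        ⟨p - (2 + A.length + 2 + B.length), by omega⟩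
      rw [g3 k (by omega)] at hpi
      have := List.mem_of_getElem? hpi
      exfalso
      rcases hv with rfl | rfl <;> simp at this <;> tauto
    · obtain ⟨k, rfl⟩ : ∃ k, p = 2 + A.length + 2 + B.length + 2 + k :=
        ⟨p - (2 + A.length + 2 + B.length + 2), by omega⟩
      rw [r6 k, ← g6 k]; exact hpi
  have hw : ∀ (c a b : ℕ) (hc : c + 1 < 2 * F.n) (hab : (a = 0 ∧ b = 1) ∨ (a = 1 ∧ b = 0)),
      (((⟨c + a, by omega⟩ : Fin (2 * F.n)) = ⟨c, by omega⟩ ∧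
        (⟨c + b, by omega⟩ : Fin (2 * F.n)) = psucc ⟨c, by omega⟩) ∨
       ((⟨c + a, by omega⟩ : Fin (2 * F.n)) = psucc ⟨c, by omega⟩ ∧
        (⟨c + b, by omega⟩ : Fin (2 * F.n)) = ⟨c, by omega⟩)) := by
    intro c a b hc hab
    rw [psucc_val c hc]
    simp only [Fin.mk.injEq]
    omega
  refine ⟨hF.proper, hF'.proper, e, Fin.cast hll, X, Y, Z,
    ⟨0, by omega⟩, ⟨2 + A.length, by omega⟩, ⟨2 + A.length + 2 + B.length, by omega⟩,
    ⟨0 + a1, by omega⟩, ⟨0 + b1, by omega⟩,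
    ⟨2 + A.length + a2, by omega⟩, ⟨2 + A.length + b2, by omega⟩,
    ⟨2 + A.length + 2 + B.length + a3, by omega⟩, ⟨2 + A.length + 2 + B.length + b3, by omega⟩,
    ?_, ?_, ?_, ?_, ?_, ?_, hw _ _ _ (by omega) hab1, hw _ _ _ (by omega) hab2,
    hw _ _ _ (by omega) hab3, ?_, ?_, ?_, ?_, ?_, ?_, ?_⟩
  · rw [Fintype.bijective_iff_injective_and_card]; exact ⟨hei, by simp; omega⟩
  · rw [Fintype.bijective_iff_injective_and_card]
    exact ⟨Fin.cast_injective hll, by simp; omega⟩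
  · exact cyclic_of_mono _ (fun a b hab => by simpa using hab)
  · rintro rfl; exact hxy (hX.symm.trans hY)
  · rintro rfl; exact hyz (hY.symm.trans hZ)
  · rintro rfl; exact hxz (hX.symm.trans hZ)
  · refine hF.ends _ _ hX (by simp only [ne_eq, Fin.mk.injEq]; omega) ?_ ?_
    · simp only [Nat.zero_add]; rw [g1 _ (by omega), h1a]
    · simp only []; rw [g2 _ (by omega), h2a]
  · refine hF.ends _ _ hY (by simp only [ne_eq, Fin.mk.injEq]; omega) ?_ ?_
    · simp only [Nat.zero_add]; rw [g1 _ (by omega), h1b]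
    · simp only []; rw [g3 _ (by omega), h3a]
  · refine hF.ends _ _ hZ (by simp only [ne_eq, Fin.mk.injEq]; omega) ?_ ?_
    · simp only []; rw [g2 _ (by omega), h2b]
    · simp only []; rw [g3 _ (by omega), h3b]
  · refine hF'.ends _ _ ((he X).trans hX)
      (by simp only [ne_eq, Fin.cast_mk, Fin.mk.injEq]; omega) ?_ ?_
    · simp only [Fin.cast_mk, Nat.zero_add]; rw [r1 _ (by omega), h1c]
    · simp only [Fin.cast_mk]; rw [r2 _ (by omega), h2c]
  · refine hF'.ends _ _ ((he Y).trans hY)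
      (by simp only [ne_eq, Fin.cast_mk, Fin.mk.injEq]; omega) ?_ ?_
    · simp only [Fin.cast_mk, Nat.zero_add]; rw [r1 _ (by omega), h1d]
    · simp only [Fin.cast_mk]; rw [r3 _ (by omega), h3c]
  · refine hF'.ends _ _ ((he Z).trans hZ)
      (by simp only [ne_eq, Fin.cast_mk, Fin.mk.injEq]; omega) ?_ ?_
    · simp only [Fin.cast_mk]; rw [r2 _ (by omega), h2d]
    · simp only [Fin.cast_mk]; rw [r3 _ (by omega), h3d]
  · intro i hiX hiY hiZ
    refine hF'.ends _ _ (he i) (fun hh => hF.ne i (Fin.cast_injective hll hh)) ?_ ?_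
    · exact hother i hiX hiY hiZ _ (hF.hfst i)
    · exact hother i hiX hiY hiZ _ (hF.hsnd i)

theorem cls_single_mid {α : Type} [DecidableEq α] {a : α} {X Y : List α}
    (h : DO (X ++ [a, a] ++ Y)) : cls (X ++ [a, a] ++ Y) = cls (X ++ Y) := by
  have r : X ++ [a, a] ++ Y ~r a :: a :: (Y ++ X) := by
    have := List.isRotated_append (l := X) (l' := [a, a] ++ Y)
    simpa using this
  have h' := h.perm r.perm
  rw [cls_rot h r, cls_single h', cls_append_comm h'.cons2.2]

/-- The antiparallel version of the flat two chord move follows from the others. -/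
theorem cls_two_anti {α : Type} [DecidableEq α] {a b : α} {A B : List α}
    (h : DO ([b, a] ++ A ++ [a, b] ++ B)) :
    cls ([b, a] ++ A ++ [a, b] ++ B) = cls (A ++ B) := by
  obtain ⟨hab, ha, hb, hd⟩ := DO.two (a := a) (b := b) (List.Perm.swap _ _ _) (List.Perm.refl _) h
  have hsome := Option.some_injective α
  have hc : ∀ u : List α, DO u → DO (none :: none :: u.map some) := by
    intro u hu
    exact (hu.map hsome).insert2 (by simp)
  rw [← cls_map h some hsome, ← cls_map hd some hsome]
  have h1 := hc _ h
  have h1' : DO ([some b, some a] ++ A.map some ++ [some a, none] ++ [] ++ [none, some b] ++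
      B.map some) := by
    refine h1.perm ?_
    rw [List.perm_iff_count]; intro c; simp [List.count_append, List.count_cons]; omega
  have h3 : DO ([some a, some b] ++ (A.map some ++ [none]) ++ [some a, some b] ++
      (none :: B.map some)) := by
    refine h1.perm ?_
    rw [List.perm_iff_count]; intro c; simp [List.count_append, List.count_cons]; omega
  have h4 : DO ((some b :: some a :: (A.map some ++ [some a])) ++ [none, none] ++
      (some b :: B.map some)) := by
    refine h1'.perm ?_
    rw [List.perm_iff_count]; intro c; simp [List.count_append, List.count_cons]
  have h5 : DO (A.map some ++ [none, none] ++ B.map some) := by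
    refine (DO.two (List.Perm.refl _) (List.Perm.refl _) h3).2.2.2.perm ?_
    simp
  calc _ = cls ((some b :: some a :: (A.map some ++ [some a])) ++ (some b :: B.map some)) := by
        simp
    _ = cls ((some b :: some a :: (A.map some ++ [some a])) ++ [none, none] ++
          (some b :: B.map some)) := (cls_single_mid h4).symm
    _ = cls ([some b, some a] ++ A.map some ++ [some a, none] ++ [] ++ [none, some b] ++
        B.map some) := by simp
    _ = _ := cls_tri (x := some a) (y := some b) (z := none) (by simpa using hab) (by simp)
        (by simp) (Or.inr rfl) (Or.inl rfl) (Or.inr rfl) h1'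
    _ = cls ([some a, some b] ++ (A.map some ++ [none]) ++ [some a, some b] ++
      (none :: B.map some)) := by simp
    _ = cls (A.map some ++ [none] ++ none :: B.map some) := cls_two_co h3
    _ = cls (A.map some ++ [none, none] ++ B.map some) := by simp
    _ = cls (A.map some ++ B.map some) := cls_single_mid h5
    _ = _ := by simp

theorem cls_two {α : Type} [DecidableEq α] {a b : α} {A B s t : List α}
    (hs : s = [a, b] ∨ s = [b, a]) (ht : t = [a, b] ∨ t = [b, a])
    (h : DO (s ++ A ++ t ++ B)) : cls (s ++ A ++ t ++ B) = cls (A ++ B) := by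
  rcases hs with rfl | rfl <;> rcases ht with rfl | rfl
  · exact cls_two_co h
  · exact cls_two_anti h
  · exact cls_two_anti h
  · exact cls_two_co h

end FlatWord


namespace FlatWord

open List

/-- The cyclic order of a word. -/
def cyc {β : Type} [DecidableEq β] (W : List β) (a b c : β) : Bool :=
  arc (W.idxOf a) (W.idxOf b) (W.idxOf c)

theorem cyc_rot {β : Type} [DecidableEq β] {u v : List β} (hn : u.Nodup) (r : u ~r v) {a b c : β}
    (ha : a ∈ u) (hb : b ∈ u) (hc : c ∈ u) : cyc u a b c = cyc v a b c := by
  obtain ⟨X, Y, rfl, rfl⟩ := rot_iff.1 r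
  have key : ∀ d ∈ X ++ Y, ((X ++ Y).idxOf d < X.length ∧
      (Y ++ X).idxOf d = (X ++ Y).idxOf d + Y.length) ∨
      (X.length ≤ (X ++ Y).idxOf d ∧ (X ++ Y).idxOf d < X.length + Y.length ∧
        (Y ++ X).idxOf d + X.length = (X ++ Y).idxOf d) := by
    intro d hd
    have hdisj := List.disjoint_of_nodup_append hn
    rcases List.mem_append.1 hd with hX | hY
    · left
      have hY : d ∉ Y := fun hY => hdisj hX hY
      rw [List.idxOf_append_of_mem hX, List.idxOf_append_of_notMem hY]
      exact ⟨List.idxOf_lt_length_iff.2 hX, by omega⟩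
    · right
      have hX : d ∉ X := fun hX => hdisj hX hY
      rw [List.idxOf_append_of_mem hY, List.idxOf_append_of_notMem hX]
      have := List.idxOf_lt_length_iff.2 hY
      omega
  unfold cyc
  rw [Bool.eq_iff_iff, arc_iff, arc_iff]
  have h1 := key a ha
  have h2 := key b hb
  have h3 := key c hc
  omega

theorem rot_head_eq {β : Type} {s : β} {X Y : List β} (hn : (s :: X).Nodup)
    (r : s :: X ~r s :: Y) : X = Y := by
  obtain ⟨P, Q, h1, h2⟩ := rot_iff.1 r
  rcases P with _ | ⟨p, P⟩
  · simp at h1 h2; rw [← h1] at h2; simpa using h2.symm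
  rcases Q with _ | ⟨q, Q⟩
  · simp at h1 h2; rw [h1.2, h2.2]
  · simp at h1 h2
    rw [h1.2] at hn
    simp [← h2.1] at hn

theorem split_exists {β : Type} {W : List β} {s t : β} (hst : s ≠ t) (hs : s ∈ W) (ht : t ∈ W) :
    ∃ A B, W ~r s :: A ++ t :: B := by
  obtain ⟨P, Q, rfl⟩ := List.append_of_mem hs
  have ht' : t ∈ Q ++ P := by
    simp only [List.mem_append, List.mem_cons] at ht ⊢
    rcases ht with h | h | h
    · exact Or.inr h
    · exact absurd h.symm hst
    · exact Or.inl h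
  obtain ⟨A, B, hAB⟩ := List.append_of_mem ht'
  refine ⟨A, B, ?_⟩
  have : P ++ s :: Q ~r s :: Q ++ P := List.isRotated_append
  rw [List.cons_append, hAB] at this
  simpa using this

theorem split_unique {β : Type} {s t : β} {A B A' B' : List β} (hn : (s :: A ++ t :: B).Nodup)
    (r : s :: A ++ t :: B ~r s :: A' ++ t :: B') : A = A' ∧ B = B' := by
  have h := rot_head_eq hn r
  have hn' : (A ++ t :: B).Nodup := (List.nodup_cons.1 hn).2
  have h : A ++ t :: B = A' ++ t :: B' := h
  have hn2 : (A' ++ t :: B').Nodup := h ▸ hn'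
  rw [List.nodup_append] at hn' hn2
  have hA : t ∉ A := fun hh => hn'.2.2 t hh t (by simp) rfl
  have hA' : t ∉ A' := fun hh => hn2.2.2 t hh t (by simp) rfl
  rcases List.append_eq_append_iff.1 h with ⟨as, h1, h2⟩ | ⟨as, h1, h2⟩
  · rcases as with _ | ⟨c, as⟩
    · simp at h1 h2; exact ⟨h1.symm, h2⟩
    · simp at h2; exact absurd (by rw [h1, h2.1]; simp) hA'
  · rcases as with _ | ⟨c, as⟩
    · simp at h1 h2; exact ⟨h1, h2.symm⟩
    · simp at h2; exact absurd (by rw [h1, h2.1]; simp) hA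

theorem rot_of_cyc {β : Type} [DecidableEq β] {u v : List β} (hu : u.Nodup) (hp : u ~ v)
    (h : ∀ a ∈ u, ∀ b ∈ u, ∀ c ∈ u, cyc u a b c = cyc v a b c) : u ~r v := by
  rcases u with _ | ⟨a, u⟩
  · rw [List.nil_perm.1 hp]
  have hv : v.Nodup := hp.nodup_iff.1 hu
  obtain ⟨P, Q, rfl⟩ := List.append_of_mem (hp.mem_iff.1 (List.mem_cons_self))
  have r : P ++ a :: Q ~r a :: (Q ++ P) := by
    have : P ++ a :: Q ~r a :: Q ++ P := List.isRotated_append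
    simpa using this
  have hp' : u ~ Q ++ P := (hp.trans r.perm).cons_inv
  have hv' : (a :: (Q ++ P)).Nodup := r.nodup_iff.1 hv
  have hpw : ∀ (w : List β), (a :: w).Nodup → w.Pairwise (fun b c => cyc (a :: w) a c b = true) := by
    intro w hw
    rw [List.pairwise_iff_getElem]
    intro i j hi hj hij
    have h1 := hw.idxOf_getElem (i + 1) (by simpa using hi)
    have h2 := hw.idxOf_getElem (j + 1) (by simpa using hj)
    have h0 := hw.idxOf_getElem 0 (by simp)
    simp only [List.getElem_cons_succ, List.getElem_cons_zero] at h0 h1 h2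
    unfold cyc
    rw [h0, h1, h2, arc_iff]
    omega
  have heq : u = Q ++ P := by
    refine hp'.eq_of_pairwise (le := fun b c => cyc (a :: u) a c b = true) ?_ (hpw u hu) ?_
    · intro b c hb hc h1 h2
      exfalso
      unfold cyc at h1 h2
      rw [arc_iff] at h1 h2
      have ha : (a :: u).idxOf a = 0 := by simp
      rw [ha] at h1 h2
      have hb' : (a :: u).idxOf b ≠ 0 := by
        have : a ≠ b := fun hh => (List.nodup_cons.1 hu).1 (hh ▸ hb)
        rw [List.idxOf_cons_ne _ this]; omega
      omega
    · refine (hpw _ hv').imp_of_mem ?_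
      intro b c hb hc hbc
      have hb' := hp'.mem_iff.2 hb
      have hc' := hp'.mem_iff.2 hc
      rw [h a (by simp) c (by simp [hc']) b (by simp [hb'])]
      rw [cyc_rot hv r (by simp) (r.perm.mem_iff.2 (by simp only [List.mem_cons]; exact Or.inr hc))
        (r.perm.mem_iff.2 (by simp only [List.mem_cons]; exact Or.inr hb))]
      exact hbc
  rw [heq]
  exact r.symm

theorem cyc_split {β : Type} [DecidableEq β] {s t r : β} {A B : List β}
    (hn : (s :: A ++ t :: B).Nodup) : cyc (s :: A ++ t :: B) s t r = decide (r ∈ A) := by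
  have hn0 := hn
  simp only [List.cons_append, List.nodup_cons, List.mem_append, List.mem_cons, not_or,
    List.nodup_append] at hn
  obtain ⟨⟨hsA, hst, hsB⟩, hA, ⟨htB, hB⟩, hdis⟩ := hn
  have htA : t ∉ A := fun h => (hdis t h t (Or.inl rfl)) rfl
  have i1 : (s :: A ++ t :: B).idxOf s = 0 := by simp
  have i2 : (s :: A ++ t :: B).idxOf t = A.length + 1 := by
    rw [List.cons_append, List.idxOf_cons_ne _ hst, List.idxOf_append_of_notMem htA]
    simp
  unfold cyc
  rw [i1, i2, Bool.eq_iff_iff, arc_iff, decide_eq_true_iff]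
  by_cases hrs : s = r
  · subst hrs
    rw [i1]
    simp [hsA]
  by_cases hr : r ∈ A
  · rw [List.cons_append, List.idxOf_cons_ne _ hrs, List.idxOf_append_of_mem hr]
    have := List.idxOf_lt_length_iff.2 hr
    simp only [hr, iff_true]
    omega
  · rw [List.cons_append, List.idxOf_cons_ne _ hrs, List.idxOf_append_of_notMem hr]
    simp only [hr, iff_false]
    omega

/-- Signed weight of a list of endpoints. -/
def wt {α : Type} (sg : α → ℤ) (A : List (α × Bool)) : ℤ :=
  (A.map fun s => if s.2 then sg s.1 else -sg s.1).sum

/-- Flat class of the smoothing of `c :: A ++ c :: B`. -/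
noncomputable def sm {α : Type} (A B : List (α × Bool)) : FlatClass :=
  cls ((A.reverse ++ B).map Prod.fst)

def gpos (G : GaussDiagram) (s : Fin G.n × Bool) : Fin (2 * G.n) :=
  if s.2 then G.head s.1 else G.foot s.1

/-- `W` is the Gauss word of `G`. -/
structure GRep (G : GaussDiagram) (W : List (Fin G.n × Bool)) : Prop where
  len : W.length = 2 * G.n
  nodup : W.Nodup
  get : ∀ s, W[(gpos G s).1]? = some s

theorem gpos_bij {G : GaussDiagram} (h : G.Proper) : Function.Bijective (gpos G) := by
  rw [Fintype.bijective_iff_injective_and_card]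
  refine ⟨?_, by simp; omega⟩
  have hi := h.1
  rintro ⟨i, b⟩ ⟨j, d⟩ hij
  cases b <;> cases d <;> simp only [gpos] at hij
  · have := @hi (Sum.inr i) (Sum.inr j) (by simpa using hij); simpa using this
  · have := @hi (Sum.inr i) (Sum.inl j) (by simpa using hij); simp at this
  · have := @hi (Sum.inl i) (Sum.inr j) (by simpa using hij); simp at this
  · have := @hi (Sum.inl i) (Sum.inl j) (by simpa using hij); simpa using this

theorem exists_grep {G : GaussDiagram} (h : G.Proper) : ∃ W, GRep G W := by
  let b := Equiv.ofBijective _ (gpos_bij h)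
  refine ⟨List.ofFn (fun p => b.symm p), by simp, ?_, ?_⟩
  · rw [List.nodup_ofFn]; exact b.symm.injective
  · intro s
    rw [List.getElem?_ofFn, dif_pos (gpos G s).2]
    have : b.symm (gpos G s) = s := b.symm_apply_apply s
    simp [this]

theorem GRep.mem {G : GaussDiagram} {W} (h : GRep G W) (s) : s ∈ W :=
  List.mem_of_getElem? (h.get s)

theorem idx_of_get {β : Type} [DecidableEq β] {W : List β} (hn : W.Nodup) {p : ℕ} {s : β}
    (h : W[p]? = some s) : W.idxOf s = p := by
  obtain ⟨hlt, h2⟩ := List.getElem?_eq_some_iff.1 h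
  have := hn.idxOf_getElem _ hlt
  rwa [h2] at this

theorem GRep.idx {G : GaussDiagram} {W} (h : GRep G W) (s) :
    @List.idxOf _ instBEqOfDecidableEq s W = (gpos G s).1 :=
  idx_of_get h.nodup (h.get s)

theorem GRep.cyc {G : GaussDiagram} {W} (h : GRep G W) (a b c) :
    cyc W a b c = arc (gpos G a).1 (gpos G b).1 (gpos G c).1 := by
  unfold FlatWord.cyc; rw [h.idx, h.idx, h.idx]

theorem GRep.arc {G : GaussDiagram} {W} (h : GRep G W) {c : Fin G.n} {A B}
    (r : W ~r (c, true) :: A ++ (c, false) :: B) (s) :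
    arc (G.head c).1 (G.foot c).1 (gpos G s).1 = decide (s ∈ A) := by
  have h1 := h.cyc (c, true) (c, false) s
  rw [cyc_rot h.nodup r (h.mem _) (h.mem _) (h.mem _), cyc_split (r.nodup_iff.1 h.nodup)] at h1
  have h2 := h1.symm
  simp only [gpos, if_true, Bool.false_eq_true, if_false] at h2 ⊢
  convert h2

theorem GRep.crosses {G : GaussDiagram} {W} (h : GRep G W) {c : Fin G.n} {A B}
    (r : W ~r (c, true) :: A ++ (c, false) :: B) (x) (hx : x ≠ c) :
    G.crosses c x = (decide ((x, true) ∈ A) != decide ((x, false) ∈ A)) := by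
  have h1 := h.arc r (x, true)
  have h2 := h.arc r (x, false)
  simp only [gpos, if_true] at h1 h2
  simp only [Bool.false_eq_true, if_false] at h2
  unfold GaussDiagram.crosses
  rw [h1, h2]
  simp [hx]

theorem GRep.parity {G : GaussDiagram} {W} (h : GRep G W) {c : Fin G.n} {A B}
    (r : W ~r (c, true) :: A ++ (c, false) :: B) : G.parity c = wt G.sign A := by
  have hn := r.nodup_iff.1 h.nodup
  have hA : A.Nodup := by
    simp only [List.cons_append, List.nodup_cons, List.nodup_append] at hn
    exact hn.2.1
  have hc1 : (c, true) ∉ A := by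
    simp only [List.cons_append, List.nodup_cons, List.mem_append, not_or] at hn
    exact hn.1.1
  have hc2 : (c, false) ∉ A := by
    simp only [List.cons_append, List.nodup_cons, List.nodup_append] at hn
    exact fun hh => hn.2.2.2 _ hh (c, false) (by simp) rfl
  have e1 : wt G.sign A = ∑ s : Fin G.n × Bool,
      if s ∈ A then (if s.2 then G.sign s.1 else -G.sign s.1) else 0 := by
    unfold wt
    rw [← List.sum_toFinset _ hA, ← Finset.sum_filter]
    congr 1
    ext s; simp
  rw [e1, Fintype.sum_prod_type]
  unfold GaussDiagram.parity
  refine Finset.sum_congr rfl fun x _ => ?_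
  rw [Fintype.sum_bool]
  by_cases hx : x = c
  · subst hx
    simp [GaussDiagram.crosses, hc1, hc2]
  · rw [h.crosses r x hx]
    have h1 := h.arc r (x, true)
    simp only [gpos, if_true] at h1
    unfold GaussDiagram.inter
    rw [h1]
    by_cases p1 : (x, true) ∈ A <;> by_cases p2 : (x, false) ∈ A <;> simp [p1, p2]

theorem skipAt_ne {n : ℕ} (x : Fin n) (i : Fin (n - 1)) : skipAt x i ≠ x := by
  unfold skipAt
  intro h
  split_ifs at h with hh
  · have := congrArg Fin.val h; simp at this; omega
  · have := congrArg Fin.val h; simp at this; omega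

theorem skipAt_inj {n : ℕ} (x : Fin n) : Function.Injective (skipAt x) := by
  intro i j h
  unfold skipAt at h
  refine Fin.ext ?_
  split_ifs at h <;> simp at h <;> omega

theorem GRep.smooth {G : GaussDiagram} {W} (h : GRep G W) {c : Fin G.n} {A B}
    (r : W ~r (c, true) :: A ++ (c, false) :: B) : Fclass (G.smooth c).flatten = sm A B := by
  have hlen := h.len
  have hrlen := r.perm.length_eq
  simp only [List.length_cons, List.length_append] at hrlen
  obtain ⟨X, Y, hW, hR⟩ := rot_iff.1 r
  have hn := h.nodup
  -- positions in the rotated word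
  have hgeneral : ∀ s : Fin G.n × Bool, s.1 ≠ c → 
      (smoothPos (2 * G.n) (G.head c).1 (G.foot c).1 (gpos G s).1 < 2 * (G.n - 1)) ∧
      (A.reverse ++ B)[smoothPos (2 * G.n) (G.head c).1 (G.foot c).1 (gpos G s).1]? = some s := by
    intro s hs
    have hmod : ∀ x m : ℕ, x < 2 * m → x % m = if x < m then x else x - m := by
      intro x m hx
      split_ifs with hxm
      · exact Nat.mod_eq_of_lt hxm
      · rw [Nat.mod_eq_sub_mod (by omega), Nat.mod_eq_of_lt (by omega)]
    have hXY : X.length + Y.length = 2 * G.n := by rw [← hlen, hW, List.length_append]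
    -- index in the rotated word
    have hj : ∀ t : Fin G.n × Bool, ∃ j, j < 2 * G.n ∧
        (((gpos G t).1 = j + X.length ∧ X.length ≤ (gpos G t).1) ∨
          ((gpos G t).1 < X.length ∧ j = (gpos G t).1 + Y.length)) ∧
        ((c, true) :: (A ++ (c, false) :: B))[j]? = some t := by
      intro t
      have hg := h.get t
      have hlt := (gpos G t).2
      rw [hW] at hg
      rw [List.cons_append] at hR
      rw [hR]
      by_cases hX : (gpos G t).1 < X.length
      · refine ⟨(gpos G t).1 + Y.length, by omega, Or.inr ⟨hX, rfl⟩, ?_⟩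
        rw [List.getElem?_append_left hX] at hg
        rw [List.getElem?_append_right (by omega)]
        simpa using hg
      · refine ⟨(gpos G t).1 - X.length, by omega, Or.inl ⟨by omega, by omega⟩, ?_⟩
        rw [List.getElem?_append_right (by omega)] at hg
        rw [List.getElem?_append_left (by omega)]
        exact hg
    have hnR : ((c, true) :: (A ++ (c, false) :: B)).Nodup := r.nodup_iff.1 hn
    have huniq : ∀ (t : Fin G.n × Bool) (i j : ℕ),
        ((c, true) :: (A ++ (c, false) :: B))[i]? = some t →
        ((c, true) :: (A ++ (c, false) :: B))[j]? = some t → i = j := by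
      intro t i j h1 h2
      obtain ⟨hi, h1⟩ := List.getElem?_eq_some_iff.1 h1
      obtain ⟨hj, h2⟩ := List.getElem?_eq_some_iff.1 h2
      exact hnR.getElem_inj_iff.1 (h1.trans h2.symm)
    obtain ⟨j0, hj0, hp0, hg0⟩ := hj (c, true)
    obtain ⟨j1, hj1, hp1, hg1⟩ := hj (c, false)
    obtain ⟨j, hjj, hp, hg⟩ := hj s
    have e0 : j0 = 0 := huniq _ _ _ hg0 (by simp)
    have e1 : j1 = A.length + 1 := huniq _ _ _ hg1 (by simp)
    have n0 : j ≠ 0 := by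
      rintro rfl
      simp at hg
      exact hs (by rw [← hg])
    have n1 : j ≠ A.length + 1 := by
      rintro rfl
      simp at hg
      exact hs (by rw [← hg])
    have q0 := (gpos G (c, true)).2
    have q1 := (gpos G (c, false)).2
    have q := (gpos G s).2
    simp only [gpos, if_true] at hp0 q0
    simp only [gpos, Bool.false_eq_true, if_false] at hp1 q1
    have hd : ((G.foot c).1 + 2 * G.n - ((G.head c).1 + 1)) % (2 * G.n) = A.length := by
      rw [hmod _ _ (by omega)]
      split_ifs <;> omega
    have hr : ((gpos G s).1 + 2 * G.n - ((G.head c).1 + 1)) % (2 * G.n) = j - 1 := by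
      rw [hmod _ _ (by omega)]
      split_ifs <;> omega
    obtain ⟨k, rfl⟩ : ∃ k, j = k + 1 := ⟨j - 1, by omega⟩
    rw [List.getElem?_cons_succ] at hg
    unfold smoothPos
    rw [hd, hr]
    dsimp only
    simp only [Nat.add_sub_cancel]
    split_ifs with hk
    · refine ⟨by omega, ?_⟩
      rw [List.getElem?_append_left hk] at hg
      rw [List.getElem?_append_left (by simp; try omega), List.getElem?_reverse (by omega), ← hg]
      congr 1
      omega
    · refine ⟨by omega, ?_⟩
      rw [List.getElem?_append_right (by omega)] at hg
      obtain ⟨l, hl⟩ : ∃ l, k = A.length + 1 + l := ⟨k - (A.length + 1), by omega⟩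
      subst hl
      rw [List.getElem?_append_right (by simp; try omega)]
      rw [show A.length + 1 + l - A.length = l + 1 by omega, List.getElem?_cons_succ] at hg
      rw [← hg]
      congr 1
      simp
  refine cls_eq ⟨fun i => skipAt c i, ?_, skipAt_inj c, ?_, ?_, ?_⟩
  · simp [GaussDiagram.flatten, GaussDiagram.smooth]; omega
  · intro i hi
    have h1 := hgeneral (skipAt c i, true) (skipAt_ne c i)
    have h2 := hgeneral (skipAt c i, false) (skipAt_ne c i)
    simp only [gpos, if_true, Bool.false_eq_true, if_false] at h1 h2
    have := congrArg Fin.val hi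
    simp only [GaussDiagram.flatten, GaussDiagram.smooth] at this
    rw [Nat.mod_eq_of_lt h1.1, Nat.mod_eq_of_lt h2.1] at this
    rw [this, h2.2] at h1
    simp at h1
  · intro i
    have h1 := hgeneral (skipAt c i, true) (skipAt_ne c i)
    simp only [gpos, if_true] at h1
    simp only [GaussDiagram.flatten, GaussDiagram.smooth]
    rw [Nat.mod_eq_of_lt h1.1, List.getElem?_map, h1.2]
    rfl
  · intro i
    have h2 := hgeneral (skipAt c i, false) (skipAt_ne c i)
    simp only [gpos, Bool.false_eq_true, if_false] at h2
    simp only [GaussDiagram.flatten, GaussDiagram.smooth]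
    rw [Nat.mod_eq_of_lt h2.1, List.getElem?_map, h2.2]
    rfl

end FlatWord


namespace FlatWord

open List

theorem idxOf_map_inj {β γ : Type} [DecidableEq β] [DecidableEq γ] (f : β → γ)
    (hf : Function.Injective f) (W : List β) (a : β) : (W.map f).idxOf (f a) = W.idxOf a := by
  induction W with
  | nil => simp
  | cons b W ih =>
    by_cases h : b = a
    · subst h; simp
    · rw [List.map_cons, List.idxOf_cons_ne _ (fun hh => h (hf hh)), List.idxOf_cons_ne _ h, ih]

theorem sub_idx {β : Type} [DecidableEq β] {V L : List β} (h : V <+ L) (hn : L.Nodup) {a b : β}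
    (ha : a ∈ V) (hb : b ∈ V) : V.idxOf a < V.idxOf b ↔ L.idxOf a < L.idxOf b := by
  induction h with
  | slnil => simp at ha
  | @cons l₁ l₂ c h ih =>
    rw [List.nodup_cons] at hn
    have hca : c ≠ a := fun hh => hn.1 (h.subset (hh ▸ ha))
    have hcb : c ≠ b := fun hh => hn.1 (h.subset (hh ▸ hb))
    rw [List.idxOf_cons_ne _ hca, List.idxOf_cons_ne _ hcb, ih hn.2 ha hb]
    omega
  | @cons_cons l₁ l₂ c h ih =>
    rw [List.nodup_cons] at hn
    by_cases hca : c = a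
    · subst hca
      by_cases hcb : c = b
      · subst hcb; simp
      · rw [List.idxOf_cons_ne _ hcb, List.idxOf_cons_ne _ hcb]; simp
    · by_cases hcb : c = b
      · subst hcb; simp
      · rw [List.idxOf_cons_ne _ hca, List.idxOf_cons_ne _ hcb, List.idxOf_cons_ne _ hca,
          List.idxOf_cons_ne _ hcb]
        have ha' : a ∈ l₁ := by simpa [Ne.symm hca] using ha
        have hb' : b ∈ l₁ := by simpa [Ne.symm hcb] using hb
        have := ih hn.2 ha' hb'
        omega

theorem cyc_sub {β : Type} [DecidableEq β] {V L : List β} (h : V <+ L) (hn : L.Nodup) {a b c : β}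
    (ha : a ∈ V) (hb : b ∈ V) (hc : c ∈ V) : cyc V a b c = cyc L a b c := by
  unfold cyc
  rw [Bool.eq_iff_iff, arc_iff, arc_iff]
  have h1 := sub_idx h hn ha hb
  have h2 := sub_idx h hn hb ha
  have h3 := sub_idx h hn ha hc
  have h4 := sub_idx h hn hc hb
  omega

theorem rot_map {G G' : GaussDiagram} {W W'} {L V : List (Fin G'.n × Bool)} (hG : GRep G W)
    (hG' : GRep G' W') (f : Fin G.n × Bool → Fin G'.n × Bool) (hf : Function.Injective f)
    (φ : Fin (2 * G.n) → Fin (2 * G'.n)) (hφ : CyclicMap φ)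
    (hpos : ∀ s, gpos G' (f s) = φ (gpos G s)) (r : W' ~r L) (hV : V <+ L)
    (hsub : ∀ s, f s ∈ V) (hlen : V.length ≤ W.length) : W.map f ~r V := by
  have hnL : L.Nodup := r.nodup_iff.1 hG'.nodup
  have hnf : (W.map f).Nodup := hG.nodup.map hf
  refine rot_of_cyc hnf ?_ ?_
  · refine (List.subperm_of_subset hnf ?_).perm_of_length_le (by simpa using hlen)
    intro s hs
    obtain ⟨t, _, rfl⟩ := List.mem_map.1 hs
    exact hsub t
  · intro a ha b hb c hc
    obtain ⟨a, _, rfl⟩ := List.mem_map.1 ha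
    obtain ⟨b, _, rfl⟩ := List.mem_map.1 hb
    obtain ⟨c, _, rfl⟩ := List.mem_map.1 hc
    rw [cyc_sub hV hnL (hsub a) (hsub b) (hsub c),
      ← cyc_rot hG'.nodup r (hG'.mem _) (hG'.mem _) (hG'.mem _), hG'.cyc, hpos, hpos, hpos,
      ← hφ, ← hG.cyc]
    unfold cyc
    rw [idxOf_map_inj f hf, idxOf_map_inj f hf, idxOf_map_inj f hf]

theorem DO_fst {α : Type} [DecidableEq α] {U : List (α × Bool)} (hn : U.Nodup)
    (hp : ∀ a b, (a, b) ∈ U → (a, !b) ∈ U) : DO (U.map Prod.fst) := by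
  intro a ha
  obtain ⟨⟨a', b⟩, hab, rfl⟩ := List.mem_map.1 ha
  have h2 := hp _ _ hab
  obtain ⟨U1, p1⟩ : ∃ U1, U ~ (a', b) :: U1 := ⟨_, List.perm_cons_erase hab⟩
  have h3 : (a', !b) ∈ U1 := by
    have := p1.mem_iff.1 h2
    simpa using this
  obtain ⟨U2, p2⟩ : ∃ U2, U1 ~ (a', !b) :: U2 := ⟨_, List.perm_cons_erase h3⟩
  have p := p1.trans (p2.cons _)
  have hn' := p.nodup_iff.1 hn
  simp only [List.nodup_cons, List.mem_cons, not_or] at hn'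
  rw [(p.map Prod.fst).count_eq]
  simp only [List.map_cons, List.count_cons_self]
  have : List.count a' (U2.map Prod.fst) = 0 := by
    rw [List.count_eq_zero]
    intro hm
    obtain ⟨⟨a2, b2⟩, hab2, h4⟩ := List.mem_map.1 hm
    simp only at h4
    subst h4
    by_cases hb : b2 = b
    · subst hb; exact hn'.1.2 hab2
    · have : b2 = !b := by cases b <;> cases b2 <;> simp_all
      subst this; exact hn'.2.1 hab2
  rw [this]

theorem split_DO {α : Type} [DecidableEq α] {W A B : List (α × Bool)} {c : α} (hn : W.Nodup)
    (hm : ∀ a b, (a, b) ∈ W → (a, !b) ∈ W)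
    (r : W ~r (c, true) :: A ++ (c, false) :: B) : DO ((A.reverse ++ B).map Prod.fst) := by
  have p : W ~ (c, true) :: (c, false) :: (A.reverse ++ B) := by
    refine r.perm.trans ?_
    rw [List.perm_iff_count]; intro s; simp [List.count_append, List.count_cons]; omega
  have hn' := p.nodup_iff.1 hn
  simp only [List.nodup_cons, List.mem_cons, not_or] at hn'
  refine DO_fst hn'.2.2 ?_
  intro a b hab
  have h1 := hm a b (p.mem_iff.2 (by simp only [List.mem_cons]; exact Or.inr (Or.inr hab)))
  have h2 := p.mem_iff.1 h1
  simp only [List.mem_cons] at h2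
  rcases h2 with h2 | h2 | h2
  · exfalso
    have : (a, b) = (c, false) := by cases b <;> simp_all
    rw [this] at hab; exact hn'.2.1 hab
  · exfalso
    have : (a, b) = (c, true) := by cases b <;> simp_all
    rw [this] at hab; exact hn'.1.2 hab
  · exact h2

theorem GRep.split_DO {G : GaussDiagram} {W} (h : GRep G W) {c : Fin G.n} {A B}
    (r : W ~r (c, true) :: A ++ (c, false) :: B) : DO ((A.reverse ++ B).map Prod.fst) :=
  FlatWord.split_DO h.nodup (fun _ _ _ => h.mem _) r

noncomputable def termW (i w : ℤ) (F : FlatClass) (s : ℤ) : FlatClass →₀ ℤ :=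
  if |w| = i then Finsupp.single F s else 0

noncomputable def term (G : GaussDiagram) (i : ℤ) (c : Fin G.n) : FlatClass →₀ ℤ :=
  termW i (G.parity c) (Fclass (G.smooth c).flatten) (G.sign c)

theorem Sone_eq (G : GaussDiagram) (i : ℤ) : Sone G i = ∑ c, term G i c := rfl

theorem GRep.term {G : GaussDiagram} {W} (h : GRep G W) {c : Fin G.n} {A B} (i : ℤ)
    (r : W ~r (c, true) :: A ++ (c, false) :: B) :
    term G i c = termW i (wt G.sign A) (sm A B) (G.sign c) := by
  unfold FlatWord.term
  rw [h.parity r, h.smooth r]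

theorem wt_append {α : Type} (sg : α → ℤ) (A B : List (α × Bool)) :
    wt sg (A ++ B) = wt sg A + wt sg B := by simp [wt]

theorem wt_cons {α : Type} (sg : α → ℤ) (s) (B : List (α × Bool)) :
    wt sg (s :: B) = (if s.2 then sg s.1 else -sg s.1) + wt sg B := by simp [wt]

theorem wt_nil {α : Type} (sg : α → ℤ) : wt sg [] = 0 := by simp [wt]

theorem wt_reverse {α : Type} (sg : α → ℤ) (A : List (α × Bool)) :
    wt sg A.reverse = wt sg A := by simp [wt]

/-- The map of endpoints induced by a map of chords. -/
def lift {α β : Type} (e : α → β) (s : α × Bool) : β × Bool := (e s.1, s.2)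

theorem lift_inj {α β : Type} {e : α → β} (he : Function.Injective e) :
    Function.Injective (lift e) := by
  rintro ⟨a, b⟩ ⟨c, d⟩ h
  simp only [lift, Prod.mk.injEq] at h
  rw [he h.1, h.2]

theorem GRep.term_map {G : GaussDiagram} {W} (h : GRep G W) {α : Type} [DecidableEq α]
    {c : Fin G.n} {e : Fin G.n → α} (he : Function.Injective e) {sg : α → ℤ}
    (hsg : ∀ j, sg (e j) = G.sign j) {A B} (i : ℤ)
    (r : W.map (lift e) ~r (e c, true) :: A ++ (e c, false) :: B) :
    FlatWord.term G i c = termW i (wt sg A) (sm A B) (G.sign c) := by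
  obtain ⟨A0, B0, r0⟩ := split_exists (s := (c, true)) (t := (c, false)) (by simp)
    (h.mem _) (h.mem _)
  have r1 := r0.map (lift e)
  have hn : (W.map (lift e)).Nodup := h.nodup.map (lift_inj he)
  have r2 := r1.symm.trans r
  simp only [List.map_append, List.map_cons] at r2
  have hn2 := r1.nodup_iff.1 hn
  simp only [List.map_append, List.map_cons] at hn2
  obtain ⟨hA, hB⟩ := split_unique (s := (e c, true)) (t := (e c, false)) hn2 r2
  rw [h.term i r0, ← hA, ← hB]
  congr 1
  · simp only [wt, List.map_map]
    congr 1
    refine List.map_congr_left fun s _ => ?_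
    simp [lift, hsg]
  · unfold sm
    rw [← cls_map (h.split_DO r0) e he]
    congr 1
    simp [Function.comp_def, lift]

theorem flatMap_rot {β γ : Type} {u v : List β} (r : u ~r v) (σ : β → List γ) :
    u.flatMap σ ~r v.flatMap σ := by
  obtain ⟨X, Y, rfl, rfl⟩ := rot_iff.1 r
  rw [List.flatMap_append, List.flatMap_append]
  exact List.isRotated_append

/-- Substitution, with reversal of the blocks selected by `k`. -/
def fl {β : Type} (k : β → Bool) (σ : β → List β) (s : β) : List β :=
  if k s then (σ s).reverse else σ s

theorem wt_flatMap {α : Type} (sg : α → ℤ) (σ σ' : α × Bool → List (α × Bool))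
    (hw : ∀ s, wt sg (σ s) = wt sg (σ' s)) (A : List (α × Bool)) :
    wt sg (A.flatMap σ) = wt sg (A.flatMap σ') := by
  induction A with
  | nil => rfl
  | cons s A ih => rw [List.flatMap_cons, List.flatMap_cons, wt_append, wt_append, hw, ih]

theorem flatMap_fl {β : Type} [DecidableEq β] (A B : List β) (hd : ∀ s ∈ B, s ∉ A)
    (σ : β → List β) :
    (A.flatMap σ).reverse ++ B.flatMap σ =
      (A.reverse ++ B).flatMap (fl (fun s => decide (s ∈ A)) σ) := by
  rw [List.flatMap_append]
  congr 1
  · rw [List.reverse_flatMap]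
    refine List.flatMap_congr fun s hs => ?_
    have : s ∈ A := by simpa using hs
    simp [fl, this]
  · refine List.flatMap_congr fun s hs => ?_
    simp [fl, hd s hs]

theorem sub_other {α : Type} [DecidableEq α] (sg : α → ℤ) (N : List (α × Bool)) (c : α)
    (σ σ' : α × Bool → List (α × Bool)) (hN : N.Nodup) (hc : ∀ b, (c, b) ∈ N)
    (hσ : ∀ b, σ (c, b) = [(c, b)]) (hσ' : ∀ b, σ' (c, b) = [(c, b)])
    (hw : ∀ s, wt sg (σ s) = wt sg (σ' s))
    (hflat : ∀ U (k : α × Bool → Bool), (c, true) :: (c, false) :: U ~ N →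
      DO ((U.flatMap (fl k σ)).map Prod.fst) →
      cls ((U.flatMap (fl k σ)).map Prod.fst) = cls ((U.flatMap (fl k σ')).map Prod.fst)) :
    ∃ A B A' B', N.flatMap σ ~r (c, true) :: A ++ (c, false) :: B ∧
      N.flatMap σ' ~r (c, true) :: A' ++ (c, false) :: B' ∧ wt sg A = wt sg A' ∧
      (DO ((A.reverse ++ B).map Prod.fst) → sm A B = sm A' B') := by
  obtain ⟨A, B, r⟩ := split_exists (s := (c, true)) (t := (c, false)) (by simp) (hc _) (hc _)
  have hd : ∀ s ∈ B, s ∉ A := by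
    have hn := r.nodup_iff.1 hN
    simp only [List.cons_append, List.nodup_cons, List.nodup_append] at hn
    intro s hB hA
    exact hn.2.2.2 s hA s (by simp [hB]) rfl
  refine ⟨A.flatMap σ, B.flatMap σ, A.flatMap σ', B.flatMap σ', ?_, ?_, wt_flatMap _ _ _ hw A, ?_⟩
  · have := flatMap_rot r σ
    simpa [hσ] using this
  · have := flatMap_rot r σ'
    simpa [hσ'] using this
  · unfold sm
    rw [flatMap_fl A B hd σ, flatMap_fl A B hd σ']
    refine hflat _ _ ?_
    refine List.Perm.trans ?_ r.perm.symm
    rw [List.perm_iff_count]; intro s; simp [List.count_append, List.count_cons]; omega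

/-- Comparison of the terms of a chord not involved in the move. -/
theorem term_other {G G' : GaussDiagram} {W W'} (hG : GRep G W) (hG' : GRep G' W')
    {e : Fin G.n → Fin G'.n} (he : Function.Injective e)
    (hsg : ∀ j, G'.sign (e j) = G.sign j) (i : ℤ) (c : Fin G.n) (N : List (Fin G'.n × Bool))
    (σ σ' : Fin G'.n × Bool → List (Fin G'.n × Bool)) (hN : N.Nodup) (hc : ∀ b, (e c, b) ∈ N)
    (hσ : ∀ b, σ (e c, b) = [(e c, b)]) (hσ' : ∀ b, σ' (e c, b) = [(e c, b)])
    (hw : ∀ s, wt G'.sign (σ s) = wt G'.sign (σ' s))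
    (hflat : ∀ U (k : Fin G'.n × Bool → Bool), (e c, true) :: (e c, false) :: U ~ N →
      DO ((U.flatMap (fl k σ)).map Prod.fst) →
      cls ((U.flatMap (fl k σ)).map Prod.fst) = cls ((U.flatMap (fl k σ')).map Prod.fst))
    (r : W' ~r N.flatMap σ) (r' : W.map (lift e) ~r N.flatMap σ') :
    term G' i (e c) = term G i c := by
  obtain ⟨A, B, A', B', r1, r2, h1, h2⟩ :=
    sub_other G'.sign N (e c) σ σ' hN hc hσ hσ' hw hflat
  rw [hG'.term i (r.trans r1), hG.term_map he hsg i (r'.trans r2), h1,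
    h2 (hG'.split_DO (r.trans r1)), hsg]

end FlatWord


namespace FlatWord

open List

theorem perm_rot {β : Type} {X Y : List β} {Z : List β} (h : Z ~r X ++ Y) : Z ~r Y ++ X :=
  h.trans List.isRotated_append

theorem GRep.adj {G : GaussDiagram} {W} (h : GRep G W) {s t : Fin G.n × Bool} (hst : s ≠ t)
    (hp : gpos G t = psucc (gpos G s)) : ∃ T, W ~r s :: t :: T := by
  have hs := h.get s
  have ht := h.get t
  have hlt := (gpos G s).2
  have hlen := h.len
  rw [hp] at ht
  set p := (gpos G s).1 with hpdef
  by_cases hc : p + 1 < 2 * G.n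
  · have e1 : (psucc (gpos G s)).1 = p + 1 := Nat.mod_eq_of_lt hc
    rw [e1] at ht
    obtain ⟨h1, h2⟩ := List.getElem?_eq_some_iff.1 hs
    obtain ⟨h3, h4⟩ := List.getElem?_eq_some_iff.1 ht
    have : W = W.take p ++ s :: t :: W.drop (p + 2) := by
      conv_lhs => rw [← List.take_append_drop p W, List.drop_eq_getElem_cons h1, h2,
        List.drop_eq_getElem_cons h3, h4]
    refine ⟨W.drop (p + 2) ++ W.take p, ?_⟩
    have h5 : W ~r W.take p ++ s :: t :: W.drop (p + 2) := by rw [← this]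
    have := perm_rot h5
    simpa using this
  · have hpe : p + 1 = 2 * G.n := by omega
    have e1 : (psucc (gpos G s)).1 = 0 := by
      show (p + 1) % (2 * G.n) = 0
      rw [hpe]; simp
    rw [e1] at ht
    rcases W with _ | ⟨t', M⟩
    · simp at ht
    simp at ht; subst ht
    have hM : M ≠ [] := by
      rintro rfl
      obtain ⟨h1, h2⟩ := List.getElem?_eq_some_iff.1 hs
      simp at h2; exact hst h2.symm
    obtain ⟨M', s', rfl⟩ : ∃ M' s', M = M' ++ [s'] :=
      ⟨M.dropLast, M.getLast hM, (List.dropLast_append_getLast hM).symm⟩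
    simp at hlen
    have hp2 : p = M'.length + 1 := by omega
    rw [hp2] at hs
    simp at hs; subst hs
    refine ⟨M', ?_⟩
    have : t' :: (M' ++ [s']) ~r [s'] ++ (t' :: M') := perm_rot (X := t' :: M') (List.IsRotated.refl _)
    simpa using this

theorem GRep.wt_total {G : GaussDiagram} {W} (h : GRep G W) : wt G.sign W = 0 := by
  have hp : W ~ (Finset.univ : Finset (Fin G.n × Bool)).toList :=
    (List.perm_ext_iff_of_nodup h.nodup (Finset.nodup_toList _)).2 (fun s => by simp [h.mem s])
  unfold wt
  rw [(hp.map _).sum_eq, Finset.sum_map_toList, Fintype.sum_prod_type]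
  simp

theorem wt_perm {α : Type} (sg : α → ℤ) {A B : List (α × Bool)} (h : A ~ B) :
    wt sg A = wt sg B := by
  unfold wt; exact (h.map _).sum_eq

/-- Location of an adjacent pair in a cyclic word starting with another adjacent pair. -/
theorem infix_rot {β : Type} {s t f g : β} {T T' : List β}
    (hsf : s ≠ f) (hsg : s ≠ g) (htf : t ≠ f) (htg : t ≠ g)
    (r : s :: t :: T ~r f :: g :: T') : ∃ A B, T = A ++ f :: g :: B := by
  obtain ⟨X, Y, h1, h2⟩ := rot_iff.1 r
  rcases Y with _ | ⟨y, Y⟩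
  · simp at h1 h2; rw [← h1] at h2; simp at h2; exact absurd h2.1.symm hsf
  simp at h2
  obtain ⟨rfl, h2⟩ := h2
  rcases Y with _ | ⟨y, Y⟩
  · simp at h2
    rw [← h2] at h1; simp at h1; exact absurd h1.1 hsg
  simp at h2
  obtain ⟨rfl, h2⟩ := h2
  rcases X with _ | ⟨x, X⟩
  · simp at h1; exact absurd h1.1 hsf
  simp at h1
  obtain ⟨rfl, h1⟩ := h1
  rcases X with _ | ⟨x, X⟩
  · simp at h1; exact absurd h1.1 htf
  simp at h1
  exact ⟨X, Y, h1.2⟩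

theorem infix_two {β : Type} {f f' g g' : β} {A B A' B' : List β}
    (h1 : f ≠ g) (h2 : f ≠ g') (h3 : f' ≠ g) (h4 : f' ≠ g')
    (h : A ++ f :: f' :: B = A' ++ g :: g' :: B') :
    (∃ M, A' = A ++ f :: f' :: M ∧ B = M ++ g :: g' :: B') ∨
    (∃ M, A = A' ++ g :: g' :: M ∧ B' = M ++ f :: f' :: B) := by
  rcases List.append_eq_append_iff.1 h with ⟨M, e1, e2⟩ | ⟨M, e1, e2⟩
  · left
    rcases M with _ | ⟨m, M⟩
    · simp at e2; exact absurd e2.1 h1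
    simp at e2
    obtain ⟨rfl, e2⟩ := e2
    rcases M with _ | ⟨m, M⟩
    · simp at e2; exact absurd e2.1 h3
    simp at e2
    obtain ⟨rfl, e2⟩ := e2
    exact ⟨M, e1, e2⟩
  · right
    rcases M with _ | ⟨m, M⟩
    · simp at e2; exact absurd e2.1.symm h1
    simp at e2
    obtain ⟨rfl, e2⟩ := e2
    rcases M with _ | ⟨m, M⟩
    · simp at e2; exact absurd e2.1.symm h2
    simp at e2
    obtain ⟨rfl, e2⟩ := e2
    exact ⟨M, e1, e2⟩

theorem flatMap_id {β : Type} (k : β → Bool) (σ : β → List β) (X : List β)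
    (h : ∀ s ∈ X, σ s = [s]) : X.flatMap (fl k σ) = X := by
  induction X with
  | nil => rfl
  | cons s X ih =>
    rw [List.flatMap_cons, ih (fun s hs => h s (by simp [hs])), fl, h s (by simp)]
    simp

theorem flatMap_id' {β : Type} (σ : β → List β) (X : List β)
    (h : ∀ s ∈ X, σ s = [s]) : X.flatMap σ = X := by
  exact flatMap_id (fun _ => false) σ X h

theorem cls_flatMap_rot {α : Type} [DecidableEq α] {U X : List (α × Bool)} (r : U ~r X)
    (τ : α × Bool → List (α × Bool)) (h : DO ((U.flatMap τ).map Prod.fst)) :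
    DO ((X.flatMap τ).map Prod.fst) ∧
    cls ((U.flatMap τ).map Prod.fst) = cls ((X.flatMap τ).map Prod.fst) :=
  ⟨h.perm ((flatMap_rot r τ).map Prod.fst).perm, cls_rot h ((flatMap_rot r τ).map Prod.fst)⟩

theorem rot_of_mem {β : Type} {s : β} {U : List β} (h : s ∈ U) : ∃ X, U ~r s :: X := by
  obtain ⟨P, Q, rfl⟩ := List.append_of_mem h
  exact ⟨Q ++ P, perm_rot (List.IsRotated.refl _)⟩

/-! ### The single chord move -/

theorem gpos_lift {G G' : GaussDiagram} {e : Fin G.n → Fin G'.n}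
    {φ : Fin (2 * G.n) → Fin (2 * G'.n)}
    (h : ∀ i, G'.head (e i) = φ (G.head i) ∧ G'.foot (e i) = φ (G.foot i)) (s) :
    gpos G' (lift e s) = φ (gpos G s) := by
  rcases s with ⟨a, b⟩
  cases b <;> simp [gpos, lift, h]

theorem Sone_single {G G' : GaussDiagram} (i : ℤ) (hi : 1 ≤ i) (h : SingleChordMove G G') :
    Sone G i = Sone G' i := by
  obtain ⟨hP, hP', hn, e, φ, y, he, hy, hφ, hpos, hadj⟩ := h
  obtain ⟨W, hW⟩ := exists_grep hP
  obtain ⟨W', hW'⟩ := exists_grep hP'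
  obtain ⟨b, T, r⟩ : ∃ b T, W' ~r (y, b) :: (y, !b) :: T := by
    rcases hadj with ha | ha
    · obtain ⟨T, r⟩ := hW'.adj (s := (y, true)) (t := (y, false)) (by simp) (by simpa [gpos] using ha)
      exact ⟨true, T, r⟩
    · obtain ⟨T, r⟩ := hW'.adj (s := (y, false)) (t := (y, true)) (by simp) (by simpa [gpos] using ha)
      exact ⟨false, T, r⟩
  have hnd := r.nodup_iff.1 hW'.nodup
  have hnd0 := hnd
  simp only [List.nodup_cons, List.mem_cons, not_or] at hnd
  have hyT : ∀ b', (y, b') ∉ T := by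
    intro b'
    have h1 := hnd.1.2
    have h2 := hnd.2.1
    cases b <;> cases b' <;> simp_all
  have hmemT : ∀ s, s.1 ≠ y → s ∈ T := by
    intro s hs
    have := r.perm.mem_iff.1 (hW'.mem s)
    simp only [List.mem_cons] at this
    rcases this with h1 | h1 | h1
    · rw [h1] at hs; exact absurd rfl hs
    · rw [h1] at hs; exact absurd rfl hs
    · exact h1
  have rW : W.map (lift e) ~r T := by
    refine rot_map hW hW' (lift e) (lift_inj he) φ hφ
      (gpos_lift fun j => ⟨(hpos j).1, (hpos j).2.1⟩) r
      ((List.sublist_cons_self _ _).trans (List.sublist_cons_self _ _)) ?_ ?_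
    · intro s; exact hmemT _ (hy _)
    · have := r.perm.length_eq
      have h1 := hW.len
      have h2 := hW'.len
      simp only [List.length_cons] at this
      omega
  have hy0 : term G' i y = 0 := by
    have hpar : G'.parity y = 0 := by
      cases b
      · have r2 : W' ~r (y, true) :: T ++ (y, false) :: [] := by
          have := perm_rot (X := [(y, false)]) r
          simpa using this
        rw [hW'.parity r2]
        have h1 := hW'.wt_total
        rw [wt_perm _ r.perm, wt_cons, wt_cons] at h1
        simpa using h1
      · rw [hW'.parity (A := []) (B := T) r]; simp [wt]
    unfold term termW
    rw [hpar, if_neg]; simp; omega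
  have hother : ∀ c, term G' i (e c) = term G i c := by
    intro c
    have hcy := hy c
    refine term_other hW hW' he (fun j => (hpos j).2.2) i c ((y, b) :: T)
      (fun s => if s.1 = y then [(y, b), (y, !b)] else [s])
      (fun s => if s.1 = y then [] else [s]) ?_ ?_ ?_ ?_ ?_ ?_ ?_ ?_
    · exact List.nodup_cons.2 ⟨hyT b, hnd.2.2⟩
    · intro b'; exact List.mem_cons_of_mem _ (hmemT _ hcy)
    · intro b'; simp [hcy]
    · intro b'; simp [hcy]
    · intro s; by_cases hs : s.1 = y
      · cases b <;> simp [hs, wt]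
      · simp [hs]
    · intro U k hU hDO
      have hyU : (y, b) ∈ U := by
        have : (y, b) ∈ (e c, true) :: (e c, false) :: U := hU.mem_iff.2 (by simp)
        simpa [Ne.symm hcy] using this
      obtain ⟨X, rX⟩ := rot_of_mem hyU
      have hX : ∀ s ∈ X, s.1 ≠ y := by
        have hUn : U.Nodup := by
          have := hU.nodup_iff.2 (List.nodup_cons.2 ⟨hyT b, hnd.2.2⟩)
          exact (List.nodup_cons.1 (List.nodup_cons.1 this).2).2
        have hXn := rX.nodup_iff.1 hUn
        intro s hs hsy
        have hsU : s ∈ U := rX.perm.mem_iff.2 (by simp [hs])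
        have : s ∈ (y, b) :: T := hU.mem_iff.1 (by simp [hsU])
        rcases List.mem_cons.1 this with h1 | h1
        · subst h1; exact (List.nodup_cons.1 hXn).1 hs
        · rcases s with ⟨a, b'⟩
          simp only at hsy; subst hsy
          exact hyT b' h1
      obtain ⟨hD1, e1⟩ := cls_flatMap_rot rX _ hDO
      have p' : ∀ (k : Fin G'.n × Bool → Bool), (((y, b) :: X).flatMap (fl k (fun s : Fin G'.n × Bool => if s.1 = y then
          [(y, b), (y, !b)] else [s]))).map Prod.fst = y :: y :: X.map Prod.fst := by
        intro k
        rw [List.flatMap_cons, flatMap_id k _ X (fun s hs => by simp [hX s hs])]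
        by_cases hk : k (y, b) <;> simp [fl, hk]
      have p'' : (((y, b) :: X).flatMap (fl k (fun s : Fin G'.n × Bool => if s.1 = y then
          [] else [s]))).map Prod.fst = X.map Prod.fst := by
        rw [List.flatMap_cons, flatMap_id k _ X (fun s hs => by simp [hX s hs])]
        simp [fl]
      rw [p'] at e1 hD1
      have hD2 := (DO.cons2 hD1).2
      have hD3 : DO ((U.flatMap (fl k (fun s : Fin G'.n × Bool => if s.1 = y then
          [] else [s]))).map Prod.fst) := by
        refine DO.perm hD2 ?_
        rw [← p'']
        exact (((flatMap_rot rX _).map Prod.fst).perm).symm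
      rw [e1, cls_single hD1, (cls_flatMap_rot rX _ hD3).2, p'']
    · rw [List.flatMap_cons, flatMap_id' _ T]
      · simpa using r
      · intro s hs
        have : s.1 ≠ y := by rintro h1; exact hyT s.2 (by rw [← h1]; exact hs)
        simp [this]
    · rw [List.flatMap_cons, flatMap_id' _ T]
      · simpa using rW
      · intro s hs
        have : s.1 ≠ y := by rintro h1; exact hyT s.2 (by rw [← h1]; exact hs)
        simp [this]
  rw [Sone_eq, Sone_eq]
  have huniv : (Finset.univ : Finset (Fin G'.n)) = insert y (Finset.univ.image e) := by
    symm
    apply Finset.eq_univ_of_card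
    rw [Finset.card_insert_of_notMem (by simpa using hy), Finset.card_image_of_injective _ he]
    simp [hn]
  rw [huniv, Finset.sum_insert (by simpa using hy), Finset.sum_image (fun a _ b _ h => he h), hy0,
    zero_add]
  exact Finset.sum_congr rfl fun c _ => (hother c).symm

end FlatWord


namespace FlatWord

open List

theorem termW_cancel (i w : ℤ) (F : FlatClass) {s t : ℤ} (h : s = -t) :
    termW i w F s + termW i w F t = 0 := by
  unfold termW
  split_ifs
  · rw [← Finsupp.single_add, h]; simp
  · simp

theorem map_swap_id {α : Type} [DecidableEq α] {a b : α} {X : List α} (ha : a ∉ X) (hb : b ∉ X) :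
    X.map (Equiv.swap a b) = X := by
  conv_rhs => rw [← List.map_id X]
  refine List.map_congr_left fun s hs => ?_
  rw [Equiv.swap_apply_of_ne_of_ne]
  · rfl
  · rintro rfl; exact ha hs
  · rintro rfl; exact hb hs

theorem notMem_fst {α : Type} {a : α} {X : List (α × Bool)} (h : ∀ b, (a, b) ∉ X) :
    a ∉ X.map Prod.fst := by
  intro hm
  obtain ⟨⟨a', b⟩, h1, rfl⟩ := List.mem_map.1 hm
  exact h b h1

theorem two_cancel {G : GaussDiagram} {W} (h : GRep G W) (i : ℤ) {y₁ y₂ : Fin G.n}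
    (hs : G.sign y₁ = -G.sign y₂) {p q : Fin G.n} {A B}
    (hpq : (p = y₁ ∧ q = y₂) ∨ (p = y₂ ∧ q = y₁))
    (r : W ~r (y₁, true) :: (y₂, true) :: A ++ (p, false) :: (q, false) :: B) :
    term G i y₁ + term G i y₂ = 0 := by
  have hnd := r.nodup_iff.1 h.nodup
  rcases hpq with ⟨rfl, rfl⟩ | ⟨rfl, rfl⟩
  · have r1 : W ~r (p, true) :: ((q, true) :: A) ++ (p, false) :: ((q, false) :: B) := by
      simpa using r
    have r2 : W ~r (q, true) :: (A ++ [(p, false)]) ++ (q, false) :: (B ++ [(p, true)]) := by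
      have := perm_rot (X := [(p, true)]) r
      simpa using this
    rw [h.term i r1, h.term i r2]
    have d1 := h.split_DO r1
    have d2 := h.split_DO r2
    have e1 : sm ((q, true) :: A) ((q, false) :: B) =
        cls ((A.map Prod.fst).reverse ++ B.map Prod.fst) := by
      unfold sm
      rw [← cls_single_mid (a := q)]
      · simp
      · simpa using d1
    have e2 : sm (A ++ [(p, false)]) (B ++ [(p, true)]) =
        cls ((A.map Prod.fst).reverse ++ B.map Prod.fst) := by
      unfold sm
      have e3 : ((A ++ [(p, false)]).reverse ++ (B ++ [(p, true)])).map Prod.fst =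
        (p :: ((A.map Prod.fst).reverse ++ B.map Prod.fst)) ++ [p] := by simp
      rw [e3] at d2 ⊢
      rw [cls_append_comm d2]
      have d3 := d2.perm (List.perm_append_comm)
      exact cls_single d3
    have e3 : wt G.sign ((q, true) :: A) = wt G.sign (A ++ [(p, false)]) := by
      rw [wt_append, wt_cons, wt_cons, wt_nil]; simp [hs]; ring
    rw [e1, e2, e3]
    exact termW_cancel _ _ _ hs
  · have r1 : W ~r (q, true) :: ((p, true) :: A ++ [(p, false)]) ++ (q, false) :: B := by
      simpa using r
    have r2 : W ~r (p, true) :: A ++ (p, false) :: ((q, false) :: B ++ [(q, true)]) := by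
      have := perm_rot (X := [(q, true)]) r
      simpa using this
    rw [h.term i r1, h.term i r2]
    have d1 := h.split_DO r1
    have d2 := h.split_DO r2
    have e3 : wt G.sign ((p, true) :: A ++ [(p, false)]) = wt G.sign A := by
      rw [wt_append, wt_cons, wt_cons, wt_nil]; simp
    have e1 : sm ((p, true) :: A ++ [(p, false)]) B = sm A ((q, false) :: B ++ [(q, true)]) := by
      unfold sm
      have e3 : (A.reverse ++ ((q, false) :: B ++ [(q, true)])).map Prod.fst =
        ((A.map Prod.fst).reverse ++ q :: B.map Prod.fst) ++ [q] := by simp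
      have e4 : (((p, true) :: A ++ [(p, false)]).reverse ++ B).map Prod.fst =
        p :: ((A.map Prod.fst).reverse ++ p :: B.map Prod.fst) := by simp
      rw [e3] at d2 ⊢
      rw [e4] at d1 ⊢
      rw [cls_append_comm d2, ← cls_map d1 (Equiv.swap p q) (Equiv.injective _)]
      simp only [List.cons_append, List.nodup_cons, List.nodup_append, List.mem_cons, List.mem_append,
        not_or] at hnd
      have hA : ∀ b, (p, b) ∉ A ∧ (q, b) ∉ A := by
        intro b
        have := hnd.2.2.2.2
        cases b <;> refine ⟨fun h => ?_, fun h => ?_⟩ <;> grind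
      have hB : ∀ b, (p, b) ∉ B ∧ (q, b) ∉ B := by
        intro b
        cases b <;> refine ⟨fun h => ?_, fun h => ?_⟩ <;> grind
      have m1 := map_swap_id (notMem_fst fun b => (hA b).1) (notMem_fst fun b => (hA b).2)
      have m2 := map_swap_id (notMem_fst fun b => (hB b).1) (notMem_fst fun b => (hB b).2)
      rw [List.map_cons, List.map_append, List.map_cons, List.map_reverse, m1, m2]
      simp
    rw [e1, e3]
    exact termW_cancel _ _ _ hs

theorem two_other {G G' : GaussDiagram} {W W'} (hG : GRep G W) (hG' : GRep G' W') (i : ℤ)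
    {e : Fin G.n → Fin G'.n} (he : Function.Injective e)
    (hsg : ∀ j, G'.sign (e j) = G.sign j)
    {y₁ y₂ : Fin G'.n} (hy : ∀ i, e i ≠ y₁ ∧ e i ≠ y₂)
    (hs : G'.sign y₁ = -G'.sign y₂) {p q : Fin G'.n} {A B}
    (hpq : (p = y₁ ∧ q = y₂) ∨ (p = y₂ ∧ q = y₁))
    (r : W' ~r (y₁, true) :: (y₂, true) :: A ++ (p, false) :: (q, false) :: B)
    (r' : W.map (lift e) ~r A ++ B) (c : Fin G.n) : term G' i (e c) = term G i c := by
  have hnd := r.nodup_iff.1 hG'.nodup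
  obtain ⟨hc1, hc2⟩ := hy c
  have hcp : e c ≠ p := by rcases hpq with ⟨rfl, rfl⟩ | ⟨rfl, rfl⟩ <;> assumption
  have hcq : e c ≠ q := by rcases hpq with ⟨rfl, rfl⟩ | ⟨rfl, rfl⟩ <;> assumption
  have hAB : ∀ s, s ∈ A ++ B → s ≠ (y₁, true) ∧ s ≠ (p, false) := by
    intro s hs
    rw [← List.mem_reverse] at hs
    simp only [List.cons_append, List.nodup_cons, List.nodup_append, List.mem_cons,
      List.mem_append, not_or] at hnd
    constructor <;> rintro rfl <;> grind
  have hN : ((y₁, true) :: A ++ (p, false) :: B).Nodup := by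
    refine hnd.sublist ?_
    simp only [List.cons_append]
    refine List.Sublist.cons_cons _ (List.Sublist.cons _ ?_)
    exact List.Sublist.append (List.Sublist.refl _) (by simp)
  set σ : Fin G'.n × Bool → List (Fin G'.n × Bool) := fun s =>
    if s = (y₁, true) then [(y₁, true), (y₂, true)] else
      if s = (p, false) then [(p, false), (q, false)] else [s] with hσ
  set σ' : Fin G'.n × Bool → List (Fin G'.n × Bool) := fun s =>
    if s = (y₁, true) then [] else if s = (p, false) then [] else [s] with hσ'
  have s1 : σ (y₁, true) = [(y₁, true), (y₂, true)] := by simp [hσ]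
  have s2 : σ (p, false) = [(p, false), (q, false)] := by simp [hσ]
  have s3 : ∀ s, s ≠ (y₁, true) → s ≠ (p, false) → σ s = [s] := by
    intro s h1 h2; simp [hσ, h1, h2]
  have s1' : σ' (y₁, true) = [] := by simp [hσ']
  have s2' : σ' (p, false) = [] := by simp [hσ']
  have s3' : ∀ s, s ≠ (y₁, true) → s ≠ (p, false) → σ' s = [s] := by
    intro s h1 h2; simp [hσ', h1, h2]
  clear_value σ σ'
  have cne : ∀ b, (e c, b) ≠ (y₁, true) ∧ (e c, b) ≠ (p, false) := by
    intro b; simp [hc1, hcp]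
  refine term_other hG hG' he hsg i c ((y₁, true) :: A ++ (p, false) :: B) σ σ' hN ?_ ?_ ?_ ?_ ?_ ?_ ?_
  · intro b
    have := r.perm.mem_iff.1 (hG'.mem (e c, b))
    simpa [hc1, hc2, hcp, hcq] using this
  · intro b; exact s3 _ (cne b).1 (cne b).2
  · intro b; exact s3' _ (cne b).1 (cne b).2
  · intro s
    by_cases h1 : s = (y₁, true)
    · subst h1; rw [s1, s1']; simp [wt, hs]
    by_cases h2 : s = (p, false)
    · subst h2; rw [s2, s2']
      rcases hpq with ⟨rfl, rfl⟩ | ⟨rfl, rfl⟩ <;> simp [wt, hs]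
    rw [s3 s h1 h2, s3' s h1 h2]
  · intro U k hU hDO
    have hm1 : (y₁, true) ∈ U := by
      have : (y₁, true) ∈ (e c, true) :: (e c, false) :: U := hU.mem_iff.2 (by simp)
      simpa [Ne.symm hc1] using this
    have hm2 : (p, false) ∈ U := by
      have : (p, false) ∈ (e c, true) :: (e c, false) :: U := hU.mem_iff.2 (by simp)
      simpa [Ne.symm hcp] using this
    obtain ⟨X, Y, rX⟩ := split_exists (s := (y₁, true)) (t := (p, false)) (by simp) hm1 hm2
    have hUn : U.Nodup := by
      have := hU.nodup_iff.2 hN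
      exact (List.nodup_cons.1 (List.nodup_cons.1 this).2).2
    have hXn := rX.nodup_iff.1 hUn
    have hX : ∀ s ∈ X, s ≠ (y₁, true) ∧ s ≠ (p, false) := by
      simp only [List.cons_append, List.nodup_cons, List.nodup_append, List.mem_cons,
        List.mem_append, not_or] at hXn
      intro s hs; constructor <;> rintro rfl <;> grind
    have hY : ∀ s ∈ Y, s ≠ (y₁, true) ∧ s ≠ (p, false) := by
      simp only [List.cons_append, List.nodup_cons, List.nodup_append, List.mem_cons,
        List.mem_append, not_or] at hXn
      intro s hs; constructor <;> rintro rfl <;> grind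
    obtain ⟨hD1, e1⟩ := cls_flatMap_rot rX _ hDO
    have p' : (((y₁, true) :: X ++ (p, false) :: Y).flatMap (fl k σ)).map Prod.fst =
        ((fl k σ (y₁, true)).map Prod.fst) ++ X.map Prod.fst ++
          ((fl k σ (p, false)).map Prod.fst) ++ Y.map Prod.fst := by
      rw [List.cons_append, List.flatMap_cons, List.flatMap_append, List.flatMap_cons,
        flatMap_id k σ X (fun s hs => s3 s (hX s hs).1 (hX s hs).2),
        flatMap_id k σ Y (fun s hs => s3 s (hY s hs).1 (hY s hs).2)]
      simp
    have p'' : (((y₁, true) :: X ++ (p, false) :: Y).flatMap (fl k σ')).map Prod.fst =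
        X.map Prod.fst ++ Y.map Prod.fst := by
      rw [List.cons_append, List.flatMap_cons, List.flatMap_append, List.flatMap_cons,
        flatMap_id k σ' X (fun s hs => s3' s (hX s hs).1 (hX s hs).2),
        flatMap_id k σ' Y (fun s hs => s3' s (hY s hs).1 (hY s hs).2)]
      simp [fl, s1', s2']
    rw [p'] at e1 hD1
    have hS : (fl k σ (y₁, true)).map Prod.fst = [y₁, y₂] ∨
        (fl k σ (y₁, true)).map Prod.fst = [y₂, y₁] := by
      unfold fl; rw [s1]; split_ifs <;> simp
    have hT : (fl k σ (p, false)).map Prod.fst = [y₁, y₂] ∨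
        (fl k σ (p, false)).map Prod.fst = [y₂, y₁] := by
      unfold fl; rw [s2]; rcases hpq with ⟨rfl, rfl⟩ | ⟨rfl, rfl⟩ <;> split_ifs <;> simp
    have hD2 : DO (X.map Prod.fst ++ Y.map Prod.fst) := by
      refine (DO.two (a := y₁) (b := y₂) ?_ ?_ hD1).2.2.2
      · rcases hS with h | h <;> rw [h]; exact List.Perm.swap _ _ _
      · rcases hT with h | h <;> rw [h]; exact List.Perm.swap _ _ _
    have hD3 : DO ((U.flatMap (fl k σ')).map Prod.fst) := by
      refine DO.perm hD2 ?_
      rw [← p'']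
      exact (((flatMap_rot rX _).map Prod.fst).perm).symm
    rw [e1, cls_two hS hT hD1, (cls_flatMap_rot rX _ hD3).2, p'']
  · rw [List.cons_append, List.flatMap_cons, List.flatMap_append, List.flatMap_cons,
      flatMap_id' σ A (fun s hs => s3 s (hAB s (by simp [hs])).1 (hAB s (by simp [hs])).2),
      flatMap_id' σ B (fun s hs => s3 s (hAB s (by simp [hs])).1 (hAB s (by simp [hs])).2), s1, s2]
    simpa using r
  · rw [List.cons_append, List.flatMap_cons, List.flatMap_append, List.flatMap_cons,
      flatMap_id' σ' A (fun s hs => s3' s (hAB s (by simp [hs])).1 (hAB s (by simp [hs])).2),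
      flatMap_id' σ' B (fun s hs => s3' s (hAB s (by simp [hs])).1 (hAB s (by simp [hs])).2), s1', s2']
    simpa using r'

theorem Sone_two_aux {G G' : GaussDiagram} (i : ℤ) (hP : G.Proper) (hP' : G'.Proper)
    (hn : G'.n = G.n + 2)
    {e : Fin G.n → Fin G'.n} {φ : Fin (2 * G.n) → Fin (2 * G'.n)} {y₁ y₂ : Fin G'.n}
    (he : Function.Injective e) (hyy : y₁ ≠ y₂) (hy : ∀ i, e i ≠ y₁ ∧ e i ≠ y₂) (hφ : CyclicMap φ)
    (hpos : ∀ i, G'.head (e i) = φ (G.head i) ∧ G'.foot (e i) = φ (G.foot i) ∧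
      G'.sign (e i) = G.sign i)
    (hh : G'.head y₂ = psucc (G'.head y₁)) (hf : adjPos (G'.foot y₁) (G'.foot y₂))
    (hs : G'.sign y₁ = -G'.sign y₂) : Sone G i = Sone G' i := by
  obtain ⟨W, hW⟩ := exists_grep hP
  obtain ⟨W', hW'⟩ := exists_grep hP'
  obtain ⟨T, r0⟩ := hW'.adj (s := (y₁, true)) (t := (y₂, true)) (by simpa using hyy)
    (by simpa [gpos] using hh)
  obtain ⟨p, q, hpq, T', r1⟩ : ∃ p q, ((p = y₁ ∧ q = y₂) ∨ (p = y₂ ∧ q = y₁)) ∧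
      ∃ T', W' ~r (p, false) :: (q, false) :: T' := by
    rcases hf with hf | hf
    · exact ⟨y₁, y₂, Or.inl ⟨rfl, rfl⟩, hW'.adj (by simpa using hyy) (by simpa [gpos] using hf)⟩
    · exact ⟨y₂, y₁, Or.inr ⟨rfl, rfl⟩, hW'.adj (by simpa using hyy.symm) (by simpa [gpos] using hf)⟩
  obtain ⟨A, B, rfl⟩ := infix_rot (by simp) (by simp) (by simp) (by simp) (r0.symm.trans r1)
  have r : W' ~r (y₁, true) :: (y₂, true) :: A ++ (p, false) :: (q, false) :: B := r0
  have rW : W.map (lift e) ~r A ++ B := by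
    refine rot_map hW hW' (lift e) (lift_inj he) φ hφ
      (gpos_lift fun j => ⟨(hpos j).1, (hpos j).2.1⟩) r ?_ ?_ ?_
    · simp only [List.cons_append]
      refine List.Sublist.cons _ (List.Sublist.cons _ ?_)
      exact List.Sublist.append (List.Sublist.refl _)
        ((List.sublist_cons_self _ _).trans (List.sublist_cons_self _ _))
    · intro s
      have h1 := hy s.1
      have hcp : e s.1 ≠ p := by rcases hpq with ⟨rfl, rfl⟩ | ⟨rfl, rfl⟩; exacts [h1.1, h1.2]
      have hcq : e s.1 ≠ q := by rcases hpq with ⟨rfl, rfl⟩ | ⟨rfl, rfl⟩; exacts [h1.2, h1.1]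
      have := r.perm.mem_iff.1 (hW'.mem (lift e s))
      simpa [lift, h1.1, h1.2, hcp, hcq] using this
    · have := r.perm.length_eq
      have h1 := hW.len
      have h2 := hW'.len
      simp only [List.length_cons, List.length_append] at this ⊢
      omega
  have hother := two_other hW hW' i he (fun j => (hpos j).2.2) hy hs hpq r rW
  have hcan := two_cancel hW' i hs hpq r
  rw [Sone_eq, Sone_eq]
  have hy2 : y₂ ∉ Finset.univ.image e := by
    simp only [Finset.mem_image, not_exists, not_and]; intro j _ h; exact (hy j).2 h
  have hy1 : y₁ ∉ insert y₂ (Finset.univ.image e) := by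
    simp only [Finset.mem_insert, Finset.mem_image, not_or, not_exists, not_and]
    exact ⟨hyy, fun j _ h => (hy j).1 h⟩
  have huniv : (Finset.univ : Finset (Fin G'.n)) = insert y₁ (insert y₂ (Finset.univ.image e)) := by
    symm
    apply Finset.eq_univ_of_card
    rw [Finset.card_insert_of_notMem hy1, Finset.card_insert_of_notMem hy2,
      Finset.card_image_of_injective _ he]
    simp [hn]
  rw [huniv, Finset.sum_insert hy1, Finset.sum_insert hy2, Finset.sum_image (fun a _ b _ h => he h),
    ← add_assoc, hcan, zero_add]
  exact Finset.sum_congr rfl fun c _ => (hother c).symm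

theorem Sone_two {G G' : GaussDiagram} (i : ℤ) (h : TwoChordMove G G') :
    Sone G i = Sone G' i := by
  obtain ⟨hP, hP', hn, e, φ, y₁, y₂, he, hyy, hy, hφ, hpos, hh, hf, hs⟩ := h
  rcases hh with hh | hh
  · exact Sone_two_aux i hP hP' hn he hyy hy hφ hpos hh hf hs
  · exact Sone_two_aux i hP hP' hn he hyy.symm (fun j => ⟨(hy j).2, (hy j).1⟩) hφ hpos hh hf.symm
      (by rw [hs]; simp)

end FlatWord


namespace FlatWord

open List

/-- An ordered pair or its reverse. -/
def pr {β : Type} (a : Bool) (s t : β) : List β := if a then [s, t] else [t, s]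

theorem pr_true {β : Type} (s t : β) : pr true s t = [s, t] := rfl
theorem pr_false {β : Type} (s t : β) : pr false s t = [t, s] := rfl
theorem pr_not {β : Type} (a : Bool) (s t : β) : pr (!a) s t = (pr a s t).reverse := by
  cases a <;> rfl
theorem pr_swap {β : Type} (a : Bool) (s t : β) : pr a t s = pr (!a) s t := by
  cases a <;> rfl
theorem pr_map {β γ : Type} (f : β → γ) (a : Bool) (s t : β) :
    (pr a s t).map f = pr a (f s) (f t) := by
  cases a <;> rfl
theorem mem_pr {β : Type} (a : Bool) (s t r : β) : r ∈ pr a s t ↔ r = s ∨ r = t := by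
  cases a <;> simp [pr, or_comm]

/-- `(X, Y)` and `(X', Y')` differ by reversing the block `v` in one of the two words. -/
def Diff {β : Type} (v X X' Y Y' : List β) : Prop :=
  (∃ M N, X = M ++ v ++ N ∧ X' = M ++ v.reverse ++ N ∧ Y' = Y) ∨
  (∃ M N, Y = M ++ v ++ N ∧ Y' = M ++ v.reverse ++ N ∧ X' = X)

theorem Diff.symm {β : Type} {v X X' Y Y' : List β} (h : Diff v X X' Y Y') :
    Diff v.reverse X' X Y' Y := by
  rcases h with ⟨M, N, h1, h2, h3⟩ | ⟨M, N, h1, h2, h3⟩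
  · exact Or.inl ⟨M, N, h2, by simpa using h1, h3.symm⟩
  · exact Or.inr ⟨M, N, h2, by simpa using h1, h3.symm⟩

theorem Diff.sm {α : Type} {v X X' Y Y' : List (α × Bool)} (h : Diff v X X' Y Y') :
    ∃ v', (v' = v.map Prod.fst ∨ v' = (v.map Prod.fst).reverse) ∧
    Diff v' (X.map Prod.fst).reverse (X'.map Prod.fst).reverse (Y.map Prod.fst)
      (Y'.map Prod.fst) := by
  rcases h with ⟨M, N, rfl, rfl, rfl⟩ | ⟨M, N, rfl, rfl, rfl⟩
  · exact ⟨(v.map Prod.fst).reverse, Or.inr rfl, Or.inl ⟨(N.map Prod.fst).reverse,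
      (M.map Prod.fst).reverse, by simp, by simp, rfl⟩⟩
  · exact ⟨(v.map Prod.fst), Or.inl rfl, Or.inr ⟨(M.map Prod.fst),
      (N.map Prod.fst), by simp, by simp, rfl⟩⟩

theorem Diff.wt {α : Type} (sg : α → ℤ) {v X X' Y Y' : List (α × Bool)} (h : Diff v X X' Y Y') :
    wt sg X = wt sg X' := by
  rcases h with ⟨M, N, rfl, rfl, rfl⟩ | ⟨M, N, rfl, rfl, rfl⟩
  · simp [wt_append, wt_reverse]
  · rfl

theorem flat_one {α : Type} [DecidableEq α] {p q : α} {v X X' Y Y' : List α}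
    (hv : v = [p, q] ∨ v = [q, p]) (h : Diff v X X' Y Y')
    (d1 : DO (X ++ [p, q] ++ Y)) (d2 : DO (q :: X' ++ Y' ++ [p])) :
    cls (X ++ [p, q] ++ Y) = cls (q :: X' ++ Y' ++ [p]) := by
  have hvr : v.reverse = [p, q] ∨ v.reverse = [q, p] := by
    rcases hv with rfl | rfl <;> simp
  have hp : v ~ [p, q] := by
    rcases hv with rfl | rfl
    · exact List.Perm.refl _
    · exact List.Perm.swap _ _ _
  have hpr : v.reverse ~ [p, q] := (List.reverse_perm v).trans hp
  have r2 : q :: X' ++ Y' ++ [p] ~r [p, q] ++ X' ++ Y' := by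
    have := perm_rot (List.IsRotated.refl (q :: X' ++ Y' ++ [p]))
    simpa using this
  have d2' := d2.perm r2.perm
  rw [cls_rot d2 r2]
  rcases h with ⟨M, N, rfl, rfl, rfl⟩ | ⟨M, N, rfl, rfl, rfl⟩
  · have r1 : M ++ v ++ N ++ [p, q] ++ Y' ~r v ++ N ++ [p, q] ++ (Y' ++ M) := by
      have := perm_rot (X := M) (Y := v ++ N ++ [p, q] ++ Y')
        (List.IsRotated.refl (M ++ (v ++ N ++ [p, q] ++ Y')))
      simpa using this
    have d1' := d1.perm r1.perm
    have d2'' : DO ([p, q] ++ M ++ v.reverse ++ (N ++ Y')) := by simpa using d2'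
    have e2 := cls_two (Or.inl rfl) hvr d2''
    have e1 := cls_two hv (Or.inl rfl) d1'
    have d3 := (DO.two hp (List.Perm.refl _) d1').2.2.2
    rw [cls_rot d1 r1, e1]
    have : [p, q] ++ (M ++ v.reverse ++ N) ++ Y' = [p, q] ++ M ++ v.reverse ++ (N ++ Y') := by simp
    rw [this, e2, ← List.append_assoc] at *
    rw [cls_append_comm d3]
  · have r1 : X' ++ [p, q] ++ (M ++ v ++ N) ~r [p, q] ++ M ++ v ++ (N ++ X') := by
      have := perm_rot (X := X') (Y := [p, q] ++ (M ++ v ++ N))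
        (List.IsRotated.refl (X' ++ ([p, q] ++ (M ++ v ++ N))))
      simpa using this
    have d1' := d1.perm r1.perm
    have d2'' : DO ([p, q] ++ (X' ++ M) ++ v.reverse ++ N) := by simpa using d2'
    have e2 := cls_two (Or.inl rfl) hvr d2''
    have e1 := cls_two (Or.inl rfl) hv d1'
    have d3 := (DO.two (List.Perm.refl _) hp d1').2.2.2
    rw [cls_rot d1 r1, e1]
    have : [p, q] ++ X' ++ (M ++ v.reverse ++ N) = [p, q] ++ (X' ++ M) ++ v.reverse ++ N := by simp
    rw [this, e2]
    rw [← List.append_assoc] at *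
    rw [cls_append_comm d3]
    simp

theorem flat_two {α : Type} [DecidableEq α] {p q : α} (hpq : p ≠ q) {v X X' Y Y' : List α}
    (hv : v = [p, q] ∨ v = [q, p]) (h : Diff v X X' Y Y')
    (d1 : DO (q :: X ++ p :: Y)) (d2 : DO (X' ++ q :: Y' ++ [p])) :
    cls (q :: X ++ p :: Y) = cls (X' ++ q :: Y' ++ [p]) := by
  have r2 : X' ++ q :: Y' ++ [p] ~r p :: X' ++ q :: Y' := by
    have := perm_rot (List.IsRotated.refl (X' ++ q :: Y' ++ [p]))
    simpa using this
  have d2' := d2.perm r2.perm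
  rw [cls_rot d2 r2, ← cls_map d1 (Equiv.swap p q) (Equiv.injective _)]
  have hqp := hpq.symm
  have cp : List.count p (q :: X ++ p :: Y) = 2 := d1 p (by simp)
  have cq : List.count q (q :: X ++ p :: Y) = 2 := d1 q (by simp)
  have sv : v.map (Equiv.swap p q) = v.reverse := by
    rcases hv with rfl | rfl <;> simp
  have cvp : List.count p v = 1 := by rcases hv with rfl | rfl <;> simp [hpq, hqp]
  have cvq : List.count q v = 1 := by rcases hv with rfl | rfl <;> simp [hpq, hqp]
  rcases h with ⟨M, N, rfl, rfl, rfl⟩ | ⟨M, N, rfl, rfl, rfl⟩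
  · simp only [List.cons_append, List.count_cons, List.count_append, cvp, cvq] at cp cq
    simp only [beq_self_eq_true, if_true, beq_iff_eq, hpq, hqp, if_false] at cp cq
    have m1 : M.map (Equiv.swap p q) = M :=
      map_swap_id (List.count_eq_zero.1 (by omega)) (List.count_eq_zero.1 (by omega))
    have m2 : N.map (Equiv.swap p q) = N :=
      map_swap_id (List.count_eq_zero.1 (by omega)) (List.count_eq_zero.1 (by omega))
    have m3 : Y'.map (Equiv.swap p q) = Y' :=
      map_swap_id (List.count_eq_zero.1 (by omega)) (List.count_eq_zero.1 (by omega))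
    simp only [List.map_cons, List.map_append, m1, m2, m3, sv, Equiv.swap_apply_left,
      Equiv.swap_apply_right]
  · simp only [List.cons_append, List.count_cons, List.count_append, cvp, cvq] at cp cq
    simp only [beq_self_eq_true, if_true, beq_iff_eq, hpq, hqp, if_false] at cp cq
    have m1 : M.map (Equiv.swap p q) = M :=
      map_swap_id (List.count_eq_zero.1 (by omega)) (List.count_eq_zero.1 (by omega))
    have m2 : N.map (Equiv.swap p q) = N :=
      map_swap_id (List.count_eq_zero.1 (by omega)) (List.count_eq_zero.1 (by omega))
    have m3 : X'.map (Equiv.swap p q) = X' :=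
      map_swap_id (List.count_eq_zero.1 (by omega)) (List.count_eq_zero.1 (by omega))
    simp only [List.map_cons, List.map_append, m1, m2, m3, sv, Equiv.swap_apply_left,
      Equiv.swap_apply_right]

/-- The two words give the same contribution for the chord `c`. -/
def SameTerm {α : Type} (sg : α → ℤ) (c : α) (w w' : List (α × Bool)) : Prop :=
  ∃ A B A' B', w ~r (c, true) :: A ++ (c, false) :: B ∧
    w' ~r (c, true) :: A' ++ (c, false) :: B' ∧ wt sg A = wt sg A' ∧ sm A B = sm A' B'

theorem SameTerm.symm {α : Type} {sg : α → ℤ} {c : α} {w w' : List (α × Bool)}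
    (h : SameTerm sg c w w') : SameTerm sg c w' w := by
  obtain ⟨A, B, A', B', h1, h2, h3, h4⟩ := h
  exact ⟨A', B', A, B, h2, h1, h3.symm, h4.symm⟩

/-- The word is a Gauss word. -/
def Full {α : Type} (w : List (α × Bool)) : Prop :=
  w.Nodup ∧ ∀ a b, (a, b) ∈ w → (a, !b) ∈ w

theorem tc_one {α : Type} [DecidableEq α] (sg : α → ℤ) {c p q : α} {bs bt : Bool}
    {v A B A' B' w w' : List (α × Bool)} (hw : Full w) (hw' : Full w')
    (r : w ~r (c, true) :: (p, bs) :: A ++ (c, false) :: (q, bt) :: B)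
    (r' : w' ~r (p, bs) :: (c, true) :: A' ++ (q, bt) :: (c, false) :: B')
    (hv : v.map Prod.fst = [p, q] ∨ v.map Prod.fst = [q, p]) (hd : Diff v A A' B B')
    (hs : wt sg [(p, bs)] = wt sg [(q, bt)]) : SameTerm sg c w w' := by
  have r1 : w ~r (c, true) :: ((p, bs) :: A) ++ (c, false) :: ((q, bt) :: B) := by
    simpa using r
  have r2 : w' ~r (c, true) :: (A' ++ [(q, bt)]) ++ (c, false) :: (B' ++ [(p, bs)]) := by
    have := perm_rot (X := [(p, bs)]) r'
    simpa using this
  refine ⟨_, _, _, _, r1, r2, ?_, ?_⟩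
  · have e1 : wt sg ((p, bs) :: A) = wt sg [(p, bs)] + wt sg A := by
      rw [← wt_append]; rfl
    rw [e1, wt_append, hs, hd.wt sg, add_comm]
  · have d1 := split_DO hw.1 hw.2 r1
    have d2 := split_DO hw'.1 hw'.2 r2
    obtain ⟨v', hv', hd'⟩ := hd.sm
    have hv2 : v' = [p, q] ∨ v' = [q, p] := by
      rcases hv with h | h <;> rcases hv' with h' | h' <;> rw [h', h] <;> simp
    have := flat_one hv2 hd' (by simpa using d1) (by simpa using d2)
    unfold FlatWord.sm
    simpa using this

theorem tc_two {α : Type} [DecidableEq α] (sg : α → ℤ) {c p q : α} (hpq : p ≠ q) {bs bt : Bool}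
    {v A B A' B' w w' : List (α × Bool)} (hw : Full w) (hw' : Full w')
    (r : w ~r (c, true) :: (p, bs) :: A ++ (q, bt) :: (c, false) :: B)
    (r' : w' ~r (p, bs) :: (c, true) :: A' ++ (c, false) :: (q, bt) :: B')
    (hv : v.map Prod.fst = [p, q] ∨ v.map Prod.fst = [q, p]) (hd : Diff v A A' B B')
    (hs : wt sg [(p, bs)] + wt sg [(q, bt)] = 0) : SameTerm sg c w w' := by
  have r1 : w ~r (c, true) :: ((p, bs) :: A ++ [(q, bt)]) ++ (c, false) :: B := by
    simpa using r
  have r2 : w' ~r (c, true) :: A' ++ (c, false) :: ((q, bt) :: B' ++ [(p, bs)]) := by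
    have := perm_rot (X := [(p, bs)]) r'
    simpa using this
  refine ⟨_, _, _, _, r1, r2, ?_, ?_⟩
  · have e1 : wt sg ((p, bs) :: A ++ [(q, bt)]) = wt sg [(p, bs)] + wt sg A + wt sg [(q, bt)] := by
      rw [← wt_append, ← wt_append]; rfl
    rw [e1, ← hd.wt sg]; linarith
  · have d1 := split_DO hw.1 hw.2 r1
    have d2 := split_DO hw'.1 hw'.2 r2
    obtain ⟨v', hv', hd'⟩ := hd.sm
    have hv2 : v' = [p, q] ∨ v' = [q, p] := by
      rcases hv with h | h <;> rcases hv' with h' | h' <;> rw [h', h] <;> simp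
    have := flat_two hpq hv2 hd' (by simpa using d1) (by simpa using d2)
    unfold FlatWord.sm
    simpa using this

theorem tc {α : Type} [DecidableEq α] (sg : α → ℤ) {c p q : α} (hpq : p ≠ q) {bs bt : Bool}
    {v A B A' B' w w' : List (α × Bool)} (hw : Full w) (hw' : Full w') (a b : Bool)
    (r : w ~r pr a (c, true) (p, bs) ++ A ++ pr b (c, false) (q, bt) ++ B)
    (r' : w' ~r pr (!a) (c, true) (p, bs) ++ A' ++ pr (!b) (c, false) (q, bt) ++ B')
    (hv : v.map Prod.fst = [p, q] ∨ v.map Prod.fst = [q, p]) (hd : Diff v A A' B B')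
    (hs : if a = b then wt sg [(p, bs)] = wt sg [(q, bt)] else
      wt sg [(p, bs)] + wt sg [(q, bt)] = 0) : SameTerm sg c w w' := by
  have hv' : v.reverse.map Prod.fst = [p, q] ∨ v.reverse.map Prod.fst = [q, p] := by
    rw [List.map_reverse]
    rcases hv with h | h <;> rw [h] <;> simp
  cases a <;> cases b <;> simp only [pr_true, pr_false, Bool.not_true, Bool.not_false] at r r'
  · refine (tc_one sg (v := v.reverse) hw' hw ?_ ?_ hv' hd.symm (by simpa using hs)).symm
    · simpa using r'
    · simpa using r
  · refine (tc_two sg (v := v.reverse) hpq hw' hw ?_ ?_ hv' hd.symm (by simpa using hs)).symm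
    · simpa using r'
    · simpa using r
  · refine tc_two sg hpq hw hw' ?_ ?_ hv hd (by simpa using hs)
    · simpa using r
    · simpa using r'
  · refine tc_one sg hw hw' ?_ ?_ hv hd (by simpa using hs)
    · simpa using r
    · simpa using r'

end FlatWord


namespace FlatWord

open List

/-- The cyclic word of a triangle. -/
def cfg {β : Type} (o : Bool) (V₁ V₂ V₃ A B C : List β) : List β :=
  if o then V₁ ++ A ++ V₂ ++ B ++ V₃ ++ C else V₁ ++ A ++ V₃ ++ B ++ V₂ ++ C

theorem tri_chords {α : Type} [DecidableEq α] (sg : α → ℤ) {x y z : α} (hxy : x ≠ y)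
    (hyz : y ≠ z) (hxz : x ≠ z) {w w' : List (α × Bool)} (hw : Full w) (hw' : Full w')
    (o a b d : Bool) (A B C : List (α × Bool))
    (r : w ~r cfg o (pr a (x, true) (y, true)) (pr b (x, false) (z, false))
      (pr d (y, false) (z, true)) A B C)
    (r' : w' ~r cfg o (pr (!a) (x, true) (y, true)) (pr (!b) (x, false) (z, false))
      (pr (!d) (y, false) (z, true)) A B C)
    (h1 : if a = b then sg y = -sg z else sg y = sg z)
    (h2 : if a = d then sg x = -sg z else sg x = sg z)
    (h3 : if b = d then sg x = sg y else sg x = -sg y) :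
    SameTerm sg x w w' ∧ SameTerm sg y w w' ∧ SameTerm sg z w w' := by
  have f1 : ∀ (a : Bool) (s t : α × Bool), (pr a s t).map Prod.fst = [s.1, t.1] ∨
      (pr a s t).map Prod.fst = [t.1, s.1] := by
    intro a s t; cases a <;> simp [pr]
  have f2 : ∀ (a : Bool) (s t : α × Bool), (pr a s t).map Prod.fst = [t.1, s.1] ∨
      (pr a s t).map Prod.fst = [s.1, t.1] := by
    intro a s t; cases a <;> simp [pr]
  have g1 : if a = b then wt sg [(y, true)] = wt sg [(z, false)] else
      wt sg [(y, true)] + wt sg [(z, false)] = 0 := by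
    split_ifs at h1 ⊢ <;> simp [wt, h1]
  have g2 : if (!a) = d then wt sg [(x, true)] = wt sg [(z, true)] else
      wt sg [(x, true)] + wt sg [(z, true)] = 0 := by
    cases a <;> cases d <;> simp at h2 ⊢ <;> simp [wt, h2]
  have g3 : if (!d) = (!b) then wt sg [(y, false)] = wt sg [(x, false)] else
      wt sg [(y, false)] + wt sg [(x, false)] = 0 := by
    cases d <;> cases b <;> simp at h3 ⊢ <;> simp [wt, h3]
  cases o
  · simp only [cfg, Bool.false_eq_true, if_false] at r r'
    refine ⟨?_, ?_, ?_⟩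
    · refine tc sg (v := pr d (y, false) (z, true)) hyz hw hw' a b
        (A := A ++ pr d (y, false) (z, true) ++ B) (A' := A ++ pr (!d) (y, false) (z, true) ++ B)
        (B := C) (B' := C) ?_ ?_ (f1 _ _ _) ?_ g1
      · simpa using r
      · simpa using r'
      · exact Or.inl ⟨A, B, rfl, by rw [pr_not], rfl⟩
    · refine tc sg (v := pr b (x, false) (z, false)) hxz hw hw' (!a) d
        (B := B ++ pr b (x, false) (z, false) ++ C) (B' := B ++ pr (!b) (x, false) (z, false) ++ C)
        (A := A) (A' := A) ?_ ?_ (f1 _ _ _) ?_ g2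
      · rw [pr_swap]; simpa using r
      · rw [pr_swap]; simpa using r'
      · exact Or.inr ⟨B, C, rfl, by rw [pr_not], rfl⟩
    · refine tc sg (v := pr a (x, true) (y, true)) hxy.symm hw hw' (!d) (!b)
        (B := C ++ pr a (x, true) (y, true) ++ A) (B' := C ++ pr (!a) (x, true) (y, true) ++ A)
        (A := B) (A' := B) ?_ ?_ (f2 _ _ _) ?_ g3
      · rw [pr_swap _ (y, false) (z, true), pr_swap _ (x, false) (z, false)]
        have := perm_rot (X := pr a (x, true) (y, true) ++ A) (by simpa using r)
        simpa using this
      · rw [pr_swap _ (y, false) (z, true), pr_swap _ (x, false) (z, false)]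
        have := perm_rot (X := pr (!a) (x, true) (y, true) ++ A) (by simpa using r')
        simpa using this
      · exact Or.inr ⟨C, A, rfl, by rw [pr_not], rfl⟩
  · simp only [cfg, if_true] at r r'
    refine ⟨?_, ?_, ?_⟩
    · refine tc sg (v := pr d (y, false) (z, true)) hyz hw hw' a b
        (B := B ++ pr d (y, false) (z, true) ++ C) (B' := B ++ pr (!d) (y, false) (z, true) ++ C)
        (A := A) (A' := A) ?_ ?_ (f1 _ _ _) ?_ g1
      · simpa using r
      · simpa using r'
      · exact Or.inr ⟨B, C, rfl, by rw [pr_not], rfl⟩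
    · refine tc sg (v := pr b (x, false) (z, false)) hxz hw hw' (!a) d
        (A := A ++ pr b (x, false) (z, false) ++ B) (A' := A ++ pr (!b) (x, false) (z, false) ++ B)
        (B := C) (B' := C) ?_ ?_ (f1 _ _ _) ?_ g2
      · rw [pr_swap]; simpa using r
      · rw [pr_swap]; simpa using r'
      · exact Or.inl ⟨A, B, rfl, by rw [pr_not], rfl⟩
    · refine tc sg (v := pr a (x, true) (y, true)) hxy.symm hw hw' (!d) (!b)
        (A := C ++ pr a (x, true) (y, true) ++ A) (A' := C ++ pr (!a) (x, true) (y, true) ++ A)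
        (B := B) (B' := B) ?_ ?_ (f2 _ _ _) ?_ g3
      · rw [pr_swap _ (y, false) (z, true), pr_swap _ (x, false) (z, false)]
        have := perm_rot (X := pr a (x, true) (y, true) ++ A ++ pr b (x, false) (z, false) ++ B)
          (by simpa using r)
        simpa using this
      · rw [pr_swap _ (y, false) (z, true), pr_swap _ (x, false) (z, false)]
        have := perm_rot (X := pr (!a) (x, true) (y, true) ++ A ++ pr (!b) (x, false) (z, false)
          ++ B) (by simpa using r')
        simpa using this
      · exact Or.inl ⟨C, A, rfl, by rw [pr_not], rfl⟩

/-- Existence of a triangle configuration. -/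
theorem tri_cfg {G : GaussDiagram} {W} (h : GRep G W) {x y z w₁ w₂ w₃}
    (ht : TriangleVertices G x y z w₁ w₂ w₃) :
    ∃ o a b d A B C, W ~r cfg o (pr a (x, true) (y, true)) (pr b (x, false) (z, false))
      (pr d (y, false) (z, true)) A B C := by
  obtain ⟨hxy, hyz, hxz, h1, h2, h3⟩ := ht
  obtain ⟨a, T1, r1⟩ : ∃ a T, W ~r pr a (x, true) (y, true) ++ T := by
    rcases h1 with ⟨ha, hb⟩ | ⟨ha, hb⟩
    · obtain ⟨T, r⟩ := h.adj (s := (x, true)) (t := (y, true)) (by simpa using hxy)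
        (by simp [gpos, ha, hb])
      exact ⟨true, T, r⟩
    · obtain ⟨T, r⟩ := h.adj (s := (y, true)) (t := (x, true)) (by simpa using hxy.symm)
        (by simp [gpos, ha, hb])
      exact ⟨false, T, r⟩
  obtain ⟨b, T2, r2⟩ : ∃ a T, W ~r pr a (x, false) (z, false) ++ T := by
    rcases h2 with ⟨ha, hb⟩ | ⟨ha, hb⟩
    · obtain ⟨T, r⟩ := h.adj (s := (x, false)) (t := (z, false)) (by simpa using hxz)
        (by simp [gpos, ha, hb])
      exact ⟨true, T, r⟩
    · obtain ⟨T, r⟩ := h.adj (s := (z, false)) (t := (x, false)) (by simpa using hxz.symm)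
        (by simp [gpos, ha, hb])
      exact ⟨false, T, r⟩
  obtain ⟨d, T3, r3⟩ : ∃ a T, W ~r pr a (y, false) (z, true) ++ T := by
    rcases h3 with ⟨ha, hb⟩ | ⟨ha, hb⟩
    · obtain ⟨T, r⟩ := h.adj (s := (y, false)) (t := (z, true)) (by simp)
        (by simp [gpos, ha, hb])
      exact ⟨true, T, r⟩
    · obtain ⟨T, r⟩ := h.adj (s := (z, true)) (t := (y, false)) (by simp)
        (by simp [gpos, ha, hb])
      exact ⟨false, T, r⟩
  have e2 : ∃ A B, T1 = A ++ pr b (x, false) (z, false) ++ B := by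
    have r12 := r1.symm.trans r2
    cases a <;> cases b <;> simp only [pr_true, pr_false] at r12 ⊢ <;>
    · obtain ⟨A, B, hh⟩ := infix_rot (by simp) (by simp) (by simp) (by simp) r12
      exact ⟨A, B, by simpa using hh⟩
  have e3 : ∃ A B, T1 = A ++ pr d (y, false) (z, true) ++ B := by
    have r13 := r1.symm.trans r3
    cases a <;> cases d <;> simp only [pr_true, pr_false] at r13 ⊢ <;>
    · obtain ⟨A, B, hh⟩ := infix_rot (by simp [hxy, hyz, hxz]) (by simp [hxy, hyz, hxz])
        (by simp [hxy, hyz, hxz]) (by simp [hxy, hyz, hxz]) r13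
      exact ⟨A, B, by simpa using hh⟩
  obtain ⟨A, B, e2⟩ := e2
  obtain ⟨A', B', e3⟩ := e3
  have e := e2.symm.trans e3
  have key : (∃ M, A' = A ++ pr b (x, false) (z, false) ++ M) ∨
      (∃ M, A = A' ++ pr d (y, false) (z, true) ++ M) := by
    cases b <;> cases d <;> simp only [pr_true, pr_false] at e ⊢ <;>
    · have e' := e
      simp only [List.append_assoc, List.cons_append, List.nil_append] at e'
      have this := fun h1 h2 h3 h4 => infix_two h1 h2 h3 h4 e'
      rcases this (by simp [hxy, hxy.symm, hyz, hyz.symm, hxz, hxz.symm])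
        (by simp [hxy, hxy.symm, hyz, hyz.symm, hxz, hxz.symm])
        (by simp [hxy, hxy.symm, hyz, hyz.symm, hxz, hxz.symm])
        (by simp [hxy, hxy.symm, hyz, hyz.symm, hxz, hxz.symm]) with
        ⟨M, hh, _⟩ | ⟨M, hh, _⟩
      · exact Or.inl ⟨M, by simpa using hh⟩
      · exact Or.inr ⟨M, by simpa using hh⟩
  rcases key with ⟨M, rfl⟩ | ⟨M, rfl⟩
  · refine ⟨true, a, b, d, A, M, B', ?_⟩
    rw [e3] at r1
    simpa [cfg] using r1
  · refine ⟨false, a, b, d, A', M, B, ?_⟩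
    rw [e2] at r1
    simpa [cfg] using r1

theorem tri_crosses {G : GaussDiagram} {W} (h : GRep G W) {x y z : Fin G.n} (hxy : x ≠ y)
    (hyz : y ≠ z) (hxz : x ≠ z) {o a b d A B C}
    (r : W ~r cfg o (pr a (x, true) (y, true)) (pr b (x, false) (z, false))
      (pr d (y, false) (z, true)) A B C) :
    G.crosses x y = (a == o) ∧ G.crosses x z = (b != o) ∧ G.crosses y z = (d == o) := by
  have hnd := r.nodup_iff.1 h.nodup
  have hABC : ∀ c, (c = x ∨ c = y ∨ c = z) → ∀ k, (c, k) ∉ A ∧ (c, k) ∉ B ∧ (c, k) ∉ C := by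
    have hp : cfg o (pr a (x, true) (y, true)) (pr b (x, false) (z, false))
      (pr d (y, false) (z, true)) A B C ~ [(x, true), (y, true), (x, false), (z, false),
        (y, false), (z, true)] ++ (A ++ B ++ C) := by
      rw [List.perm_iff_count]; intro s
      cases o <;> cases a <;> cases b <;> cases d <;>
        simp [cfg, pr, List.count_append, List.count_cons] <;> omega
    have h2 := (List.nodup_append.1 (hp.nodup_iff.1 hnd)).2.2
    intro c hc k
    have h3 : (c, k) ∉ A ++ B ++ C := by
      intro hm
      refine h2 (c, k) ?_ (c, k) hm rfl
      rcases hc with rfl | rfl | rfl <;> cases k <;> simp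
    simpa [and_assoc] using h3
  have hx := hABC x (by simp)
  have hy := hABC y (by simp)
  have hz := hABC z (by simp)
  -- splits at x
  have sx : ∃ A1 B1, W ~r (x, true) :: A1 ++ (x, false) :: B1 ∧
      ((y, true) ∈ A1 ↔ a = true) ∧ ((y, false) ∈ A1 ↔ o = false) ∧
      ((z, false) ∈ A1 ↔ b = false) ∧ ((z, true) ∈ A1 ↔ o = false) := by
    refine ⟨(if a then [(y, true)] else []) ++ A ++ (if o then [] else
      pr d (y, false) (z, true) ++ B) ++ (if b then [] else [(z, false)]),
      (if b then [(z, false)] else []) ++ (if o then B ++ pr d (y, false) (z, true) else []) ++ C ++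
        (if a then [] else [(y, true)]), ?_, ?_, ?_, ?_, ?_⟩
    · cases a
      · have r1 : W ~r [(y, true)] ++ ((x, true) :: ((if false then [(y, true)] else []) ++ A ++ (if o then [] else
          pr d (y, false) (z, true) ++ B) ++ (if b then [] else [(z, false)])) ++ (x, false) ::
          ((if b then [(z, false)] else []) ++ (if o then B ++ pr d (y, false) (z, true) else []) ++ C)) := by
          cases b <;> cases o <;> simpa [cfg, pr_true, pr_false] using r
        have := perm_rot r1
        simpa using this
      · cases b <;> cases o <;> simpa [cfg, pr_true, pr_false] using r
    · cases a <;> cases b <;> cases o <;> simp [mem_pr, hy, hz, hxy, hyz, hxz]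
    · cases a <;> cases b <;> cases o <;> simp [mem_pr, hy, hz, hxy, hyz, hxz]
    · cases a <;> cases b <;> cases o <;> simp [mem_pr, hy, hz, hxy, hyz, hxz, hyz.symm]
    · cases a <;> cases b <;> cases o <;> simp [mem_pr, hy, hz, hxy, hyz, hxz, hyz.symm]
  have sy : ∃ A1 B1, W ~r (y, true) :: A1 ++ (y, false) :: B1 ∧
      ((z, false) ∈ A1 ↔ o = true) ∧ ((z, true) ∈ A1 ↔ d = false) := by
    refine ⟨(if a then [] else [(x, true)]) ++ A ++ (if o then
      pr b (x, false) (z, false) ++ B else []) ++ (if d then [] else [(z, true)]),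
      (if d then [(z, true)] else []) ++ (if o then [] else B ++ pr b (x, false) (z, false)) ++ C ++
        (if a then [(x, true)] else []), ?_, ?_, ?_⟩
    · cases a
      · cases d <;> cases o <;> simpa [cfg, pr_true, pr_false] using r
      · have r1 : W ~r [(x, true)] ++ ((y, true) :: (A ++ (if o then
          pr b (x, false) (z, false) ++ B else []) ++ (if d then [] else [(z, true)])) ++ (y, false) ::
          ((if d then [(z, true)] else []) ++ (if o then [] else B ++ pr b (x, false) (z, false)) ++ C)) := by
          cases d <;> cases o <;> simpa [cfg, pr_true, pr_false] using r
        have := perm_rot r1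
        simpa using this
    · cases a <;> cases d <;> cases o <;> simp [mem_pr, hz, hxy, hyz, hxz.symm]
    · cases a <;> cases d <;> cases o <;> simp [mem_pr, hz, hxy, hyz, hxz.symm]
  obtain ⟨A1, B1, rx, m1, m2, m3, m4⟩ := sx
  obtain ⟨A2, B2, ry, m5, m6⟩ := sy
  rw [h.crosses rx y hxy.symm, h.crosses rx z hxz.symm, h.crosses ry z hyz.symm]
  refine ⟨?_, ?_, ?_⟩
  · simp only [m1, m2]; cases a <;> cases o <;> rfl
  · simp only [m3, m4]; cases b <;> cases o <;> rfl
  · simp only [m5, m6]; cases d <;> cases o <;> rfl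

theorem tri_signs {G G' : GaussDiagram} {x y z : Fin G.n} {x' y' z' : Fin G'.n} {o a b d : Bool}
    (h1 : G.crosses x y = (a == o) ∧ G.crosses x z = (b != o) ∧ G.crosses y z = (d == o))
    (h2 : G'.crosses x' y' = ((!a) == o) ∧ G'.crosses x' z' = ((!b) != o) ∧
      G'.crosses y' z' = ((!d) == o))
    (h : AdmissibleSigns G G' x y z x' y' z') :
    (if a = b then G.sign y = -G.sign z else G.sign y = G.sign z) ∧
    (if a = d then G.sign x = -G.sign z else G.sign x = G.sign z) ∧
    (if b = d then G.sign x = G.sign y else G.sign x = -G.sign y) := by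
  unfold AdmissibleSigns at h
  rw [h1.1, h1.2.1, h1.2.2, h2.1, h2.2.1, h2.2.2] at h
  generalize G.sign x = sx at *
  generalize G.sign y = sy at *
  generalize G.sign z = sz at *
  clear h1 h2
  cases o <;> cases a <;> cases b <;> cases d <;> simp at h ⊢ <;> omega

end FlatWord


namespace FlatWord

open List

theorem cfg_perm {α : Type} [DecidableEq α] (o a b d : Bool) (x y z : α) (A B C) :
    cfg o (pr a (x, true) (y, true)) (pr b (x, false) (z, false))
      (pr d (y, false) (z, true)) A B C ~ [(x, true), (y, true), (x, false), (z, false),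
        (y, false), (z, true)] ++ (A ++ B ++ C) := by
  rw [List.perm_iff_count]; intro s
  cases o <;> cases a <;> cases b <;> cases d <;>
    simp [cfg, pr, List.count_append, List.count_cons] <;> omega

theorem cfg_avoid {α : Type} [DecidableEq α] {o a b d : Bool} {x y z : α} {A B C}
    (hnd : (cfg o (pr a (x, true) (y, true)) (pr b (x, false) (z, false))
      (pr d (y, false) (z, true)) A B C).Nodup) {s : α × Bool} (hs : s ∈ A ++ B ++ C) :
    s.1 ≠ x ∧ s.1 ≠ y ∧ s.1 ≠ z := by
  have h2 := (List.nodup_append.1 ((cfg_perm o a b d x y z A B C).nodup_iff.1 hnd)).2.2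
  obtain ⟨c, k⟩ := s
  refine ⟨?_, ?_, ?_⟩ <;> rintro rfl <;> refine h2 (_, k) ?_ (_, k) hs rfl <;> cases k <;> simp

theorem cls_cfg {α : Type} [DecidableEq α] {x y z : α} {A B C s t v : List α} (o : Bool)
    (hxy : x ≠ y) (hyz : y ≠ z) (hxz : x ≠ z)
    (hs : s = [x, y] ∨ s = [y, x]) (ht : t = [x, z] ∨ t = [z, x]) (hv : v = [y, z] ∨ v = [z, y])
    (h : DO (cfg o s t v A B C)) :
    cls (cfg o s t v A B C) = cls (cfg o s.reverse t.reverse v.reverse A B C) := by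
  cases o
  · simp only [cfg, Bool.false_eq_true, if_false] at h ⊢
    exact cls_tri hxy.symm hxz hyz hs.symm hv ht h
  · simp only [cfg, if_true] at h ⊢
    exact cls_tri hxy hyz hxz hs ht hv h

theorem cfg_flatMap {β : Type} (o : Bool) {m1 m2 m3 : β} {A B C : List β} (τ : β → List β)
    (hA : A.flatMap τ = A) (hB : B.flatMap τ = B) (hC : C.flatMap τ = C) :
    (cfg o [m1] [m2] [m3] A B C).flatMap τ = cfg o (τ m1) (τ m2) (τ m3) A B C := by
  cases o <;> simp [cfg, List.flatMap_append, hA, hB, hC]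

theorem cfg_map {β γ : Type} (o : Bool) (V₁ V₂ V₃ A B C : List β) (f : β → γ) :
    (cfg o V₁ V₂ V₃ A B C).map f =
      cfg o (V₁.map f) (V₂.map f) (V₃.map f) (A.map f) (B.map f) (C.map f) := by
  cases o <;> simp [cfg]

theorem cfg_exists {β : Type} {U : List β} {m1 m2 m3 : β} (h12 : m1 ≠ m2) (h13 : m1 ≠ m3)
    (h23 : m2 ≠ m3) (h1 : m1 ∈ U) (h2 : m2 ∈ U) (h3 : m3 ∈ U) :
    ∃ o A B C, U ~r cfg o [m1] [m2] [m3] A B C := by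
  obtain ⟨X, Y, r⟩ := split_exists h12 h1 h2
  have hm := r.perm.mem_iff.1 h3
  simp only [List.cons_append, List.mem_cons, List.mem_append, h13.symm, h23.symm, false_or] at hm
  rcases hm with hm | hm
  · obtain ⟨P, Q, rfl⟩ := List.append_of_mem hm
    exact ⟨false, P, Q, Y, by simpa [cfg] using r⟩
  · obtain ⟨P, Q, rfl⟩ := List.append_of_mem hm
    exact ⟨true, X, P, Q, by simpa [cfg] using r⟩

theorem cfg_nodup {β : Type} [DecidableEq β] {o : Bool} {m1 m2 m3 : β} {A B C : List β}
    (h : (cfg o [m1] [m2] [m3] A B C).Nodup) {s : β} (hs : s ∈ A ++ B ++ C) :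
    s ≠ m1 ∧ s ≠ m2 ∧ s ≠ m3 := by
  have hp : cfg o [m1] [m2] [m3] A B C ~ [m1, m2, m3] ++ (A ++ B ++ C) := by
    rw [List.perm_iff_count]; intro s
    cases o <;> simp [cfg, List.count_append, List.count_cons] <;> omega
  have h2 := (List.nodup_append.1 (hp.nodup_iff.1 h)).2.2
  refine ⟨?_, ?_, ?_⟩ <;> rintro rfl <;> exact h2 _ (by simp) _ hs rfl

theorem tri_other {G G' : GaussDiagram} {W W'} (hG : GRep G W) (hG' : GRep G' W') (i : ℤ)
    {e : Fin G.n → Fin G'.n} (he : Function.Injective e)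
    (hsg : ∀ j, G'.sign (e j) = G.sign j) {x y z : Fin G'.n} (hxy : x ≠ y)
    (hyz : y ≠ z) (hxz : x ≠ z) {o a b d : Bool} {A B C}
    (r : W.map (lift e) ~r cfg o (pr a (x, true) (y, true)) (pr b (x, false) (z, false))
      (pr d (y, false) (z, true)) A B C)
    (r' : W' ~r cfg o (pr (!a) (x, true) (y, true)) (pr (!b) (x, false) (z, false))
      (pr (!d) (y, false) (z, true)) A B C) (c : Fin G.n) (hcx : e c ≠ x) (hcy : e c ≠ y)
    (hcz : e c ≠ z) : term G' i (e c) = term G i c := by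
  have hnd := r'.nodup_iff.1 hG'.nodup
  have hABC : ∀ s ∈ A ++ B ++ C, s ≠ (x, true) ∧ s ≠ (x, false) ∧ s ≠ (y, false) := by
    intro s hs
    obtain ⟨h1, h2, h3⟩ := cfg_avoid hnd hs
    refine ⟨?_, ?_, ?_⟩ <;> rintro rfl <;> simp_all
  set σ' : Fin G'.n × Bool → List (Fin G'.n × Bool) := fun s =>
    if s = (x, true) then pr a (x, true) (y, true) else
      if s = (x, false) then pr b (x, false) (z, false) else
      if s = (y, false) then pr d (y, false) (z, true) else [s] with hσ'
  have s1 : σ' (x, true) = pr a (x, true) (y, true) := by simp [hσ']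
  have s2 : σ' (x, false) = pr b (x, false) (z, false) := by simp [hσ']
  have s3 : σ' (y, false) = pr d (y, false) (z, true) := by simp [hσ', hxy.symm]
  have s4 : ∀ s, (s ≠ (x, true) ∧ s ≠ (x, false) ∧ s ≠ (y, false)) → σ' s = [s] := by
    rintro s ⟨h1, h2, h3⟩; simp [hσ', h1, h2, h3]
  clear_value σ'
  obtain ⟨σ, hσ⟩ : ∃ σ : Fin G'.n × Bool → List (Fin G'.n × Bool),
    ∀ s, σ s = (σ' s).reverse := ⟨_, fun _ => rfl⟩
  have t4 : ∀ s, (s ≠ (x, true) ∧ s ≠ (x, false) ∧ s ≠ (y, false)) → σ s = [s] := by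
    intro s h; rw [hσ, s4 s h]; rfl
  have cne : ∀ b, (e c, b) ≠ (x, true) ∧ (e c, b) ≠ (x, false) ∧ (e c, b) ≠ (y, false) := by
    intro b; simp [hcx, hcy]
  have hN : (cfg o [(x, true)] [(x, false)] [(y, false)] A B C).Nodup := by
    have h1 := (cfg_perm _ _ _ _ _ _ _ _ _ _).nodup_iff.1 hnd
    have hp : cfg o [(x, true)] [(x, false)] [(y, false)] A B C ~
        [(x, true), (x, false), (y, false)] ++ (A ++ B ++ C) := by
      rw [List.perm_iff_count]; intro s
      cases o <;> simp [cfg, List.count_append, List.count_cons] <;> omega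
    rw [hp.nodup_iff]
    refine h1.sublist (List.Sublist.append ?_ (List.Sublist.refl _))
    refine List.Sublist.cons_cons _ (List.Sublist.cons _ (List.Sublist.cons_cons _
      (List.Sublist.cons _ (List.Sublist.cons_cons _ (by simp)))))
  refine term_other hG hG' he hsg i c (cfg o [(x, true)] [(x, false)] [(y, false)] A B C) σ σ'
    hN ?_ ?_ ?_ ?_ ?_ ?_ ?_
  · intro k
    have := r'.perm.mem_iff.1 (hG'.mem (e c, k))
    cases o <;> simpa [cfg, mem_pr, hcx, hcy, hcz] using this
  · intro k; exact t4 _ (cne k)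
  · intro k; exact s4 _ (cne k)
  · intro s; rw [hσ, wt_reverse]
  · intro U k hU hDO
    have hm : ∀ m ∈ cfg o [(x, true)] [(x, false)] [(y, false)] A B C, m.1 ≠ e c → m ∈ U := by
      intro m hm hmc
      have := hU.mem_iff.2 hm
      simp only [List.mem_cons] at this
      rcases this with rfl | rfl | h
      · exact absurd rfl hmc
      · exact absurd rfl hmc
      · exact h
    obtain ⟨o', X, Y, Z, rX⟩ := cfg_exists (U := U) (m1 := (x, true)) (m2 := (x, false))
      (m3 := (y, false)) (by simp) (by simp) (by simpa using hxy)
      (hm _ (by cases o <;> simp [cfg]) hcx.symm) (hm _ (by cases o <;> simp [cfg]) hcx.symm)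
      (hm _ (by cases o <;> simp [cfg]) hcy.symm)
    have hUn : U.Nodup := by
      have := hU.nodup_iff.2 hN
      exact (List.nodup_cons.1 (List.nodup_cons.1 this).2).2
    have hav := fun s hs => cfg_nodup (s := s) (rX.nodup_iff.1 hUn) hs
    have p' := cfg_flatMap o' (m1 := (x, true)) (m2 := (x, false)) (m3 := (y, false)) (fl k σ)
      (flatMap_id k σ X fun s hs => t4 s (hav s (by simp [hs])))
      (flatMap_id k σ Y fun s hs => t4 s (hav s (by simp [hs])))
      (flatMap_id k σ Z fun s hs => t4 s (hav s (by simp [hs])))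
    have p'' := cfg_flatMap o' (m1 := (x, true)) (m2 := (x, false)) (m3 := (y, false)) (fl k σ')
      (flatMap_id k σ' X fun s hs => s4 s (hav s (by simp [hs])))
      (flatMap_id k σ' Y fun s hs => s4 s (hav s (by simp [hs])))
      (flatMap_id k σ' Z fun s hs => s4 s (hav s (by simp [hs])))
    have hrev : ∀ s, fl k σ' s = (fl k σ s).reverse := by
      intro s; unfold fl; rw [hσ]; split_ifs <;> simp
    obtain ⟨hD1, e1⟩ := cls_flatMap_rot rX _ hDO
    have hD3 : DO ((U.flatMap (fl k σ')).map Prod.fst) := by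
      refine DO.perm hDO (List.Perm.map _ ?_)
      refine List.Perm.flatMap_left _ fun s _ => ?_
      rw [hrev]; exact (List.reverse_perm _).symm
    rw [e1, (cls_flatMap_rot rX _ hD3).2]
    rw [p', cfg_map] at hD1 ⊢
    rw [p'', cfg_map, hrev, hrev, hrev, List.map_reverse, List.map_reverse, List.map_reverse]
    refine cls_cfg o' hxy hyz hxz ?_ ?_ ?_ hD1
    · unfold fl; rw [hσ, s1]; cases a <;> split_ifs <;> simp [pr]
    · unfold fl; rw [hσ, s2]; cases b <;> split_ifs <;> simp [pr]
    · unfold fl; rw [hσ, s3]; cases d <;> split_ifs <;> simp [pr]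
  · rw [cfg_flatMap o σ (flatMap_id' σ A fun s hs => t4 s (hABC s (by simp [hs])))
      (flatMap_id' σ B fun s hs => t4 s (hABC s (by simp [hs])))
      (flatMap_id' σ C fun s hs => t4 s (hABC s (by simp [hs]))), hσ, hσ, hσ, s1, s2, s3,
      ← pr_not, ← pr_not, ← pr_not]
    exact r'
  · rw [cfg_flatMap o σ' (flatMap_id' σ' A fun s hs => s4 s (hABC s (by simp [hs])))
      (flatMap_id' σ' B fun s hs => s4 s (hABC s (by simp [hs])))
      (flatMap_id' σ' C fun s hs => s4 s (hABC s (by simp [hs]))), s1, s2, s3]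
    exact r

theorem Sone_triangle {G G' : GaussDiagram} (i : ℤ) (h : TriangleMove G G') :
    Sone G i = Sone G' i := by
  obtain ⟨hP, hP', e, φ, x, y, z, w₁, w₂, w₃, he, -, hφ, hT, hsg, hpos,
    ⟨⟨hx1, hy1⟩, ⟨hx2, hz2⟩, ⟨hy3, hz3⟩⟩, hA⟩ := h
  obtain ⟨W, hW⟩ := exists_grep hP
  obtain ⟨W', hW'⟩ := exists_grep hP'
  obtain ⟨o, a, b, d, A, B, C, r⟩ := tri_cfg hW hT
  obtain ⟨hxy, hyz, hxz, -⟩ := hT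
  have hxy' : e x ≠ e y := he.1.ne hxy
  have hyz' : e y ≠ e z := he.1.ne hyz
  have hxz' : e x ≠ e z := he.1.ne hxz
  have r1 : W.map (lift e) ~r cfg o (pr a (e x, true) (e y, true))
      (pr b (e x, false) (e z, false)) (pr d (e y, false) (e z, true)) (A.map (lift e))
      (B.map (lift e)) (C.map (lift e)) := by
    have := r.map (lift e)
    rw [cfg_map, pr_map, pr_map, pr_map] at this
    exact this
  have hn1 : (W.map (lift e)).Nodup := hW.nodup.map (lift_inj he.1)
  generalize A.map (lift e) = A1 at r1
  generalize B.map (lift e) = B1 at r1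
  generalize C.map (lift e) = C1 at r1
  have hav := fun s hs => cfg_avoid (s := s) (r1.nodup_iff.1 hn1) hs
  obtain ⟨ρ, hρ⟩ : ∃ ρ : Equiv.Perm (Fin G'.n × Bool), ρ =
    Equiv.swap (e x, true) (e y, true) * Equiv.swap (e x, false) (e z, false) *
      Equiv.swap (e y, false) (e z, true) := ⟨_, rfl⟩
  have q1 : ρ (e x, true) = (e y, true) := by
    simp [hρ, Equiv.swap_apply_def, hxy', hyz', hxz', hxy'.symm, hyz'.symm, hxz'.symm]
  have q2 : ρ (e y, true) = (e x, true) := by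
    simp [hρ, Equiv.swap_apply_def, hxy', hyz', hxz', hxy'.symm, hyz'.symm, hxz'.symm]
  have q3 : ρ (e x, false) = (e z, false) := by
    simp [hρ, Equiv.swap_apply_def, hxy', hyz', hxz', hxy'.symm, hyz'.symm, hxz'.symm]
  have q4 : ρ (e z, false) = (e x, false) := by
    simp [hρ, Equiv.swap_apply_def, hxy', hyz', hxz', hxy'.symm, hyz'.symm, hxz'.symm]
  have q5 : ρ (e y, false) = (e z, true) := by
    simp [hρ, Equiv.swap_apply_def, hxy', hyz', hxz', hxy'.symm, hyz'.symm, hxz'.symm]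
  have q6 : ρ (e z, true) = (e y, false) := by
    simp [hρ, Equiv.swap_apply_def, hxy', hyz', hxz', hxy'.symm, hyz'.symm, hxz'.symm]
  have q7 : ∀ s : Fin G'.n × Bool, s.1 ≠ e x ∧ s.1 ≠ e y ∧ s.1 ≠ e z → ρ s = s := by
    rintro ⟨s, k⟩ ⟨h1, h2, h3⟩
    simp only at h1 h2 h3
    simp [hρ, Equiv.swap_apply_def, h1, h2, h3]
  clear hρ
  have hid : ∀ X : List (Fin G'.n × Bool), (∀ s ∈ X, s ∈ A1 ++ B1 ++ C1) → X.map ρ = X := by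
    intro X hX
    conv_rhs => rw [← List.map_id X]
    exact List.map_congr_left fun s hs => q7 s (hav s (hX s hs))
  have hcard : G'.n = G.n := by
    have := Fintype.card_of_bijective he
    simpa using this.symm
  have r2 : W.map (ρ ∘ lift e) ~r W' := by
    refine rot_map hW hW' _ (ρ.injective.comp (lift_inj he.1)) φ hφ ?_ (List.IsRotated.refl _)
      (List.Sublist.refl _) (fun s => hW'.mem _) (by rw [hW.len, hW'.len, hcard])
    rintro ⟨j, k⟩
    simp only [Function.comp, lift]
    by_cases jx : j = x
    · subst jx; cases k
      · rw [q3]; simpa [gpos] using hz2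
      · rw [q1]; simpa [gpos] using hy1
    by_cases jy : j = y
    · subst jy; cases k
      · rw [q5]; simpa [gpos] using hz3
      · rw [q2]; simpa [gpos] using hx1
    by_cases jz : j = z
    · subst jz; cases k
      · rw [q4]; simpa [gpos] using hx2
      · rw [q6]; simpa [gpos] using hy3
    rw [q7 _ ⟨he.1.ne jx, he.1.ne jy, he.1.ne jz⟩]
    have := hpos j jx jy jz
    cases k
    · simpa [gpos] using this.2
    · simpa [gpos] using this.1
  have r' : W' ~r cfg o (pr (!a) (e x, true) (e y, true))
      (pr (!b) (e x, false) (e z, false)) (pr (!d) (e y, false) (e z, true)) A1 B1 C1 := by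
    refine r2.symm.trans ?_
    have := r1.map ρ
    rw [cfg_map, pr_map, pr_map, pr_map, q1, q2, q3, q4, q5, q6, hid A1 (by simp +contextual),
      hid B1 (by simp +contextual), hid C1 (by simp +contextual), List.map_map,
      pr_swap _ (e x, true), pr_swap _ (e x, false), pr_swap _ (e y, false)] at this
    exact this
  obtain ⟨g1, g2, g3⟩ := tri_signs (tri_crosses hW hxy hyz hxz r)
    (tri_crosses hW' hxy' hyz' hxz' r') hA
  rw [← hsg, ← hsg] at g1 g2 g3
  have hF : Full (W.map (lift e)) := by
    refine ⟨hn1, fun p k hm => ?_⟩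
    obtain ⟨j, rfl⟩ := he.2 p
    exact List.mem_map.2 ⟨(j, !k), hW.mem _, rfl⟩
  have hF' : Full W' := ⟨hW'.nodup, fun _ _ _ => hW'.mem _⟩
  have hst : ∀ c, SameTerm G'.sign (e c) (W.map (lift e)) W' → term G i c = term G' i (e c) := by
    rintro c ⟨P, Q, P', Q', k1, k2, k3, k4⟩
    rw [hW.term_map he.1 hsg i k1, hW'.term i k2, k3, k4, hsg]
  obtain ⟨c1, c2, c3⟩ := tri_chords G'.sign hxy' hyz' hxz' hF hF' o a b d A1 B1 C1 r1 r' g1 g2 g3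
  rw [Sone_eq, Sone_eq]
  refine Fintype.sum_bijective e he _ _ fun c => ?_
  by_cases jx : c = x
  · subst jx; exact hst _ c1
  by_cases jy : c = y
  · subst jy; exact hst _ c2
  by_cases jz : c = z
  · subst jz; exact hst _ c3
  exact (tri_other hW hW' i he.1 hsg hxy' hyz' hxz' r1 r' c (he.1.ne jx) (he.1.ne jy)
    (he.1.ne jz)).symm

theorem Sone_move {G G' : GaussDiagram} (i : ℤ) (hi : 1 ≤ i) (h : GaussMove G G') :
    Sone G i = Sone G' i := by
  rcases h with h | h | h | h | h | h
  · exact Sone_single i hi h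
  · exact (Sone_single i hi h).symm
  · exact Sone_two i h
  · exact (Sone_two i h).symm
  · exact Sone_triangle i h
  · exact (Sone_triangle i h).symm

end FlatWord

/-- For `i ≥ 1`, the formal sum `S_i(G) = ∑_{x ∈ V_i(G)} sgn(x)·F(G^x)`
in the free ℤ-module on flat equivalence classes of flat Gauss diagrams is unchanged by a
single chord move, a two chord move or a triangle move — hence by any finite sequence of
chord moves. -/
theorem Sone_invariant (i : ℤ) (hi : 1 ≤ i) (G G' : GaussDiagram)
    (h : Relation.ReflTransGen GaussMove G G') :
    Sone G i = Sone G' i := by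
  induction h with
  | refl => rfl
  | tail _ hm ih => exact ih.trans (FlatWord.Sone_move i hi hm)
end
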